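/- Let A = ℂQ/⟨R⟩ be an acyclic tame bound quiver algebra and α ∈ ℕ^{Q_0} a dimension vector with P_A(α) ≠ ∅. If C(α) ⊆ mod(A,α) is an indecomposable irreducible component which is not an orbit closure, then C(α) contains a Schur A-module, i.e., a module V with End_A(V) ≅ ℂ. -/

import Mathlib

open Matrix
noncomputable section

/-- A (finite-vertex) quiver: vertices, arrows, tail and head maps. -/
structure Quiv where
  V : Type
  A : Type
  t : A → V
  h : A → V
  [fV : Fintype V]
  [dV : DecidableEq V]

attribute [instance] Quiv.fV Quiv.dV

/-- The `Quiver` structure on the vertices of `Q`: an arrow from `x` to `y` is an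
arrow of `Q` with tail `x` and head `y`.  This gives us `Quiver.Path x y`, the type of
oriented paths from `x` to `y` in `Q`. -/
instance quivToQuiver (Q : Quiv) : Quiver Q.V := ⟨fun x y => {a : Q.A // Q.t a = x ∧ Q.h a = y}⟩

/-- The space of matrix representations of `Q` of dimension vector `β`, with entries in a
commutative ring `R`. -/
def RepR (Q : Quiv) (R : Type) (β : Q.V → ℕ) := ∀ a : Q.A, Matrix (Fin (β (Q.h a))) (Fin (β (Q.t a))) R

/-- The representation space `rep(Q,β) = ∏_{a ∈ Q₁} ℂ^{β(ha) × β(ta)}`. -/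
abbrev QRep (Q : Quiv) (β : Q.V → ℕ) := RepR Q ℂ β

/-- Transport of a rectangular matrix along equalities of its sizes. -/
def castM {R : Type} {m n m' n' : ℕ} (hm : m = m') (hn : n = n')
    (M : Matrix (Fin m) (Fin n) R) : Matrix (Fin m') (Fin n') R :=
  M.submatrix (Fin.cast hm.symm) (Fin.cast hn.symm)

/-- The value `W(p)` of a representation `W` on an oriented path `p` (the product of the
matrices attached to the arrows of `p`; the trivial path gives the identity matrix). -/
def evalPath {Q : Quiv} {R : Type} [CommRing R] {β : Q.V → ℕ} (W : RepR Q R β) :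
    ∀ {x y : Q.V}, Quiver.Path x y → Matrix (Fin (β y)) (Fin (β x)) R
  | _, _, Quiver.Path.nil => 1
  | _, _, Quiver.Path.cons p e =>
      (castM (congrArg β e.2.2) (congrArg β e.2.1) (W e.1)) * evalPath W p
variable (Q : Quiv)

/-- A formal (finite) linear combination of parallel oriented paths in `Q`, together with its
endpoints: the element of the path algebra it represents lives in `e_y · ℂQ · e_x`. -/
def FormalRel := Σ (x : Q.V) (y : Q.V), (Quiver.Path x y →₀ ℂ)

variable {Q}

/-- Evaluation of a representation on a formal linear combination of parallel paths. -/
def evalLin {β : Q.V → ℕ} (W : QRep Q β) {x y : Q.V} (c : Quiver.Path x y →₀ ℂ) :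
    Matrix (Fin (β y)) (Fin (β x)) ℂ :=
  c.sum fun p k => k • evalPath W p

/-- Evaluation of a representation over `ℂ[x]` on a formal linear combination of paths. -/
def evalLinP {β : Q.V → ℕ} (W : RepR Q (Polynomial ℂ) β) {x y : Q.V}
    (c : Quiver.Path x y →₀ ℂ) : Matrix (Fin (β y)) (Fin (β x)) (Polynomial ℂ) :=
  c.sum fun p k => (Polynomial.C k) • evalPath W p

/-- The module variety `mod(A,β)` of the algebra `A = ℂQ/⟨S⟩`: all `β`-dimensional
representations of `Q` annihilating every relation in `S`. -/
def modSet (S : Set (FormalRel Q)) (β : Q.V → ℕ) : Set (QRep Q β) :=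
  {W | ∀ r ∈ S, evalLin W r.2.2 = 0}

/-- A set of relations is admissible if every path occurring in it has length at least two. -/
def AdmissibleRels (S : Set (FormalRel Q)) : Prop :=
  ∀ r ∈ S, ∀ p ∈ r.2.2.support, 2 ≤ p.length

/-- The base change group `GL(β) = ∏_x GL(β(x),ℂ)`. -/
abbrev GLb (β : Q.V → ℕ) := ∀ x : Q.V, Matrix.GeneralLinearGroup (Fin (β x)) ℂ

/-- The action of `GL(β)` on `rep(Q,β)` by simultaneous conjugation. -/
def gAct {β : Q.V → ℕ} (g : GLb β) (W : QRep Q β) : QRep Q β :=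
  fun a => ((g (Q.h a)).val) * W a * (((g (Q.t a))⁻¹).val)

/-- The character of `GL(β)` induced by the weight `σ`: `g ↦ ∏_x det(g(x))^{σ(x)}`.  -/
def chi {β : Q.V → ℕ} (σ : Q.V → ℤ) (g : GLb β) : ℂ :=
  ∏ x : Q.V, ((g x).val.det) ^ (σ x)

/-- Index type of the coordinates on `rep(Q,β)`. -/
def RepCoord (β : Q.V → ℕ) := Σ a : Q.A, Fin (β (Q.h a)) × Fin (β (Q.t a))

/-- The coordinates of a point of `rep(Q,β)`. -/
def repCoords {β : Q.V → ℕ} (W : QRep Q β) : RepCoord (Q := Q) β → ℂ :=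
  fun c => W c.1 c.2.1 c.2.2

/-- `F` is a polynomial function on `rep(Q,β)`. -/
def IsPolyFun {β : Q.V → ℕ} (F : QRep Q β → ℂ) : Prop :=
  ∃ P : MvPolynomial (RepCoord (Q := Q) β) ℂ, ∀ W, F W = MvPolynomial.eval (repCoords W) P

/-- `F` is a semi-invariant of weight `σ` on `rep(Q,β)`. -/
def IsSemiInvariant {β : Q.V → ℕ} (σ : Q.V → ℤ) (F : QRep Q β → ℂ) : Prop :=
  IsPolyFun F ∧ ∀ (g : GLb β) (W : QRep Q β), F (gAct g W) = chi σ g * F W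

/-- The orbit semigroup `S_Q(W)` of a representation `W ∈ rep(Q,β)`: all weights `σ` admitting
a semi-invariant of weight `σ` not vanishing at `W`. -/
def OrbitSemigroup {β : Q.V → ℕ} (W : QRep Q β) : Set (Q.V → ℤ) :=
  {σ | ∃ F : QRep Q β → ℂ, IsSemiInvariant σ F ∧ F W ≠ 0}

/-- `W` is `σ`-semi-stable: some positive multiple of `σ` lies in the orbit semigroup. -/
def SemiStable {β : Q.V → ℕ} (σ : Q.V → ℤ) (W : QRep Q β) : Prop :=
  ∃ n : ℕ, 1 ≤ n ∧ (fun x => (n : ℤ) * σ x) ∈ OrbitSemigroup W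

/-- The weight `σ` is `W`-saturated: if `nσ` lies in the orbit semigroup of `W` for some
integer `n ≥ 1`, then so does `σ`. -/
def WSaturated {β : Q.V → ℕ} (W : QRep Q β) (σ : Q.V → ℤ) : Prop :=
  (∃ n : ℕ, 1 ≤ n ∧ (fun x => (n : ℤ) * σ x) ∈ OrbitSemigroup W) → σ ∈ OrbitSemigroup W

/-- `Q` is connected: any two vertices are joined by an unoriented walk. -/
def QConnected (Q : Quiv) : Prop :=
  ∀ x y : Q.V, Relation.ReflTransGen
    (fun u v => ∃ a : Q.A, (Q.t a = u ∧ Q.h a = v) ∨ (Q.t a = v ∧ Q.h a = u)) x y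

/-- `Q` is acyclic: the only oriented path from a vertex to itself is the trivial one. -/
def QAcyclic (Q : Quiv) : Prop := ∀ (x : Q.V) (p : Quiver.Path x x), p = Quiver.Path.nil
section Capacity

variable (Q : Quiv) (β : Q.V → ℕ) (σ : Q.V → ℤ)

/-- Vertices where the weight `σ` is positive. -/
abbrev PosV := {x : Q.V // 0 < σ x}

/-- Vertices where the weight `σ` is negative. -/
abbrev NegV := {x : Q.V // σ x < 0}

/-- `σ₊` at a positive vertex. -/
abbrev posP (i : PosV Q σ) : ℕ := (σ i.1).toNat

/-- `σ₋` at a negative vertex. -/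
abbrev negP (j : NegV Q σ) : ℕ := (-σ j.1).toNat

/-- Row index type of the `N × N` block matrices: block rows are indexed by pairs `(j,q)`
with `q ∈ I_j⁻`, each of height `β(w_j)`; so `N = Σ_j σ₋(w_j)β(w_j)` rows in total. -/
abbrev RowT := Σ j : NegV Q σ, Fin (negP Q σ j) × Fin (β j.1)

/-- Column index type of the `N × N` block matrices: block columns indexed by pairs `(i,r)`
with `r ∈ I_i⁺`, each of width `β(v_i)`; so `N = Σ_i σ₊(v_i)β(v_i)` columns in total. -/
abbrev ColT := Σ i : PosV Q σ, Fin (posP Q σ i) × Fin (β i.1)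

/-- The index set `I_σ = {(i,j,p,q,r)}`. -/
structure BIdx where
  i : PosV Q σ
  j : NegV Q σ
  p : Quiver.Path i.1 j.1
  q : Fin (negP Q σ j)
  r : Fin (posP Q σ i)

variable {Q β σ}

/-- The block matrix `W^{i,j,p}_{q,r}`: its `(q,r)` block entry is `W(p)` and all other
entries vanish. -/
def blockMat (W : QRep Q β) (d : BIdx Q σ) : Matrix (RowT Q β σ) (ColT Q β σ) ℂ :=
  fun s u =>
    if hj : s.1 = d.j then
      if hi : u.1 = d.i then
        if Fin.cast (congrArg (negP Q σ) hj) s.2.1 = d.q ∧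
           Fin.cast (congrArg (posP Q σ) hi) u.2.1 = d.r then
          evalPath W d.p (Fin.cast (congrArg (fun z => β z.1) hj) s.2.2)
            (Fin.cast (congrArg (fun z => β z.1) hi) u.2.2)
        else 0
      else 0
    else 0

/-- The Brascamp–Lieb (completely positive) operator `T_{W,σ}` associated to the quiver
datum `(W,σ)`, with Kraus operators the block matrices `W^{i,j,p}_{q,r}`. -/
def BLop (W : QRep Q β) (X : Matrix (RowT Q β σ) (RowT Q β σ) ℂ) :
    Matrix (ColT Q β σ) (ColT Q β σ) ℂ :=
  ∑ᶠ d : BIdx Q σ, (blockMat W d)ᵀ * X * blockMat W d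

/-- The capacity `cap_Q(W,σ)` of the quiver datum `(W,σ)`: the infimum of
`Det (T_{W,σ}(X))` over real positive definite matrices `X` with `Det X = 1`. -/
def capQ (W : QRep Q β) : ℝ :=
  sInf {r : ℝ | ∃ X : Matrix (RowT Q β σ) (RowT Q β σ) ℝ, X.PosDef ∧ X.det = 1 ∧
    r = ((BLop (σ := σ) W (X.map Complex.ofReal)).det).re}

/-- `Span_ℂ(W^{i,j,p}_{q,r} : (i,j,p,q,r) ∈ I_σ)` contains a non-singular `N × N` matrix. -/
def SpanNonsingular (W : QRep Q β) (σ : Q.V → ℤ) : Prop :=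
  ∃ M ∈ Submodule.span ℂ (Set.range (blockMat (σ := σ) W)),
    Function.Bijective (Matrix.mulVecLin M)

end Capacity
section HomExt

variable {Q : Quiv}

/-- The space of morphisms of representations `Hom(V,W)`, as a subspace of
`∏_x Hom(V(x),W(x))` (in matrix form). -/
def HomS {α γ : Q.V → ℕ} (V : QRep Q α) (W : QRep Q γ) :
    Submodule ℂ (∀ x : Q.V, Matrix (Fin (γ x)) (Fin (α x)) ℂ) where
  carrier := {φ | ∀ a : Q.A, φ (Q.h a) * V a = W a * φ (Q.t a)}
  add_mem' := by
    intro φ ψ hφ hψ a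
    simp only [Pi.add_apply, Matrix.add_mul, Matrix.mul_add, hφ a, hψ a]
  zero_mem' := by intro a; simp
  smul_mem' := by
    intro c φ hφ a
    simp only [Pi.smul_apply, Matrix.smul_mul, Matrix.mul_smul, hφ a]

/-- `dim_ℂ Hom(V,W)`. -/
def dimHom {α γ : Q.V → ℕ} (V : QRep Q α) (W : QRep Q γ) : ℕ :=
  Module.finrank ℂ (HomS V W)

/-- A family of matrices is componentwise surjective (as linear maps). -/
def MorSurj {α γ : Q.V → ℕ} (φ : ∀ x : Q.V, Matrix (Fin (γ x)) (Fin (α x)) ℂ) : Prop :=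
  ∀ x, Function.Surjective (Matrix.mulVecLin (φ x))

/-- A family of matrices is componentwise injective (as linear maps). -/
def MorInj {α γ : Q.V → ℕ} (φ : ∀ x : Q.V, Matrix (Fin (γ x)) (Fin (α x)) ℂ) : Prop :=
  ∀ x, Function.Injective (Matrix.mulVecLin (φ x))

/-- Isomorphism of representations (possibly of different dimension vectors). -/
def RIso {α γ : Q.V → ℕ} (V : QRep Q α) (W : QRep Q γ) : Prop :=
  ∃ u : ∀ x : Q.V, ((Fin (α x) → ℂ) ≃ₗ[ℂ] (Fin (γ x) → ℂ)),
    ∀ a : Q.A, (u (Q.h a)).toLinearMap ∘ₗ (V a).mulVecLin =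
      (W a).mulVecLin ∘ₗ (u (Q.t a)).toLinearMap

/-- The space of `1`-cochains from `V` to `W`: families `φ(a) : V(ta) → W(ha)`. -/
abbrev C1sp (α γ : Q.V → ℕ) := ∀ a : Q.A, Matrix (Fin (γ (Q.h a))) (Fin (α (Q.t a))) ℂ

/-- The derivative (Leibniz rule) of a path with respect to a `1`-cochain `φ`:
`D_{a_s ⋯ a_1}(φ) = Σ_k W(a_s ⋯ a_{k+1}) φ(a_k) V(a_{k-1} ⋯ a_1)`. -/
def der {α γ : Q.V → ℕ} (V : QRep Q α) (W : QRep Q γ) (φ : C1sp (Q := Q) α γ) :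
    ∀ {x y : Q.V}, Quiver.Path x y → Matrix (Fin (γ y)) (Fin (α x)) ℂ
  | _, _, Quiver.Path.nil => 0
  | _, _, Quiver.Path.cons p e =>
      castM (congrArg γ e.2.2) (congrArg α e.2.1) (φ e.1) * evalPath V p
      + castM (congrArg γ e.2.2) (congrArg γ e.2.1) (W e.1) * der V W φ p

lemma der_add {α γ : Q.V → ℕ} (V : QRep Q α) (W : QRep Q γ) (φ ψ : C1sp (Q := Q) α γ)
    {x y : Q.V} (p : Quiver.Path x y) :
    der V W (φ + ψ) p = der V W φ p + der V W ψ p := by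
  induction p with
  | nil => simp [der]
  | cons p e ih =>
      simp only [der, ih, Pi.add_apply, castM, Matrix.submatrix_add, Matrix.add_mul,
        Matrix.mul_add]
      abel

lemma der_smul {α γ : Q.V → ℕ} (V : QRep Q α) (W : QRep Q γ) (c : ℂ) (φ : C1sp (Q := Q) α γ)
    {x y : Q.V} (p : Quiver.Path x y) :
    der V W (c • φ) p = c • der V W φ p := by
  induction p with
  | nil => simp [der]
  | cons p e ih =>
      simp only [der, ih, Pi.smul_apply, castM, Matrix.submatrix_smul, Matrix.smul_mul,
        Matrix.mul_smul, smul_add]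

lemma der_zero {α γ : Q.V → ℕ} (V : QRep Q α) (W : QRep Q γ)
    {x y : Q.V} (p : Quiver.Path x y) :
    der V W (0 : C1sp (Q := Q) α γ) p = 0 := by
  induction p with
  | nil => simp [der]
  | cons p e ih =>
      simp [der, ih, castM]

/-- The derivative of a formal linear combination of parallel paths. -/
def derRel {α γ : Q.V → ℕ} (V : QRep Q α) (W : QRep Q γ) (φ : C1sp (Q := Q) α γ)
    {x y : Q.V} (c : Quiver.Path x y →₀ ℂ) : Matrix (Fin (γ y)) (Fin (α x)) ℂ :=
  c.sum fun p k => k • der V W φ p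

/-- The space of `1`-cocycles relative to the set of relations `S`: cochains whose
derivative kills every relation in `S`. -/
def Z1 (S : Set (FormalRel Q)) {α γ : Q.V → ℕ} (V : QRep Q α) (W : QRep Q γ) :
    Submodule ℂ (C1sp (Q := Q) α γ) where
  carrier := {φ | ∀ r ∈ S, derRel V W φ r.2.2 = 0}
  add_mem' := by
    intro φ ψ hφ hψ r hr
    have : derRel V W (φ + ψ) r.2.2 = derRel V W φ r.2.2 + derRel V W ψ r.2.2 := by
      simp only [derRel, der_add, smul_add]
      exact Finsupp.sum_add
    rw [this, hφ r hr, hψ r hr, add_zero]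
  zero_mem' := by
    intro r hr
    simp [derRel, der_zero]
  smul_mem' := by
    intro c φ hφ r hr
    have : derRel V W (c • φ) r.2.2 = c • derRel V W φ r.2.2 := by
      simp only [derRel, der_smul, Finsupp.smul_sum, smul_comm c]
    rw [this, hφ r hr, smul_zero]

/-- The coboundary map `d⁰ : ∏_x Hom(V(x),W(x)) → C¹`,
`f ↦ (a ↦ f(ha) V(a) − W(a) f(ta))`. -/
def d0map {α γ : Q.V → ℕ} (V : QRep Q α) (W : QRep Q γ) :
    (∀ x : Q.V, Matrix (Fin (γ x)) (Fin (α x)) ℂ) →ₗ[ℂ] C1sp (Q := Q) α γ where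
  toFun f := fun a => f (Q.h a) * V a - W a * f (Q.t a)
  map_add' f g := by
    funext a
    simp only [Pi.add_apply, Matrix.add_mul, Matrix.mul_add]
    abel
  map_smul' c f := by
    funext a
    simp only [Pi.smul_apply, Matrix.smul_mul, Matrix.mul_smul, smul_sub, RingHom.id_apply]

/-- The space of `1`-coboundaries. -/
def B1 {α γ : Q.V → ℕ} (V : QRep Q α) (W : QRep Q γ) : Submodule ℂ (C1sp (Q := Q) α γ) :=
  LinearMap.range (d0map V W)

/-- `dim_ℂ Ext¹(V,W)` over the algebra `ℂQ/⟨S⟩`, computed as the dimension of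
`Z¹/B¹` (for modules, `B¹ ⊆ Z¹`, so this is `dim Z¹ − dim B¹`). -/
def dimExt1 (S : Set (FormalRel Q)) {α γ : Q.V → ℕ} (V : QRep Q α) (W : QRep Q γ) : ℕ :=
  Module.finrank ℂ (Z1 S V W) - Module.finrank ℂ ↥((B1 V W) ⊓ (Z1 S V W))

end HomExt
section ProjPdim

variable {Q : Quiv}

/-- `P` is a projective module over `ℂQ/⟨S⟩` (in matrix-representation form):
every morphism from `P` to the target of a surjection of modules lifts. -/
def IsProjRep (S : Set (FormalRel Q)) {γ : Q.V → ℕ} (P : QRep Q γ) : Prop :=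
  ∀ (δ ε : Q.V → ℕ) (M : QRep Q δ) (N : QRep Q ε), M ∈ modSet S δ → N ∈ modSet S ε →
    ∀ g ∈ HomS M N, MorSurj g → ∀ f ∈ HomS P N,
      ∃ h ∈ HomS P M, ∀ x, g x * h x = f x

/-- `V` has projective dimension at most one over `ℂQ/⟨S⟩`: there is a short exact
sequence `0 → P₁ → P₀ → V → 0` with `P₀, P₁` projective. -/
def PdimLE1 (S : Set (FormalRel Q)) {β : Q.V → ℕ} (V : QRep Q β) : Prop :=
  ∃ (γ₀ γ₁ : Q.V → ℕ) (P₀ : QRep Q γ₀) (P₁ : QRep Q γ₁),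
    P₀ ∈ modSet S γ₀ ∧ P₁ ∈ modSet S γ₁ ∧ IsProjRep S P₀ ∧ IsProjRep S P₁ ∧
    ∃ i ∈ HomS P₁ P₀, ∃ p ∈ HomS P₀ V, MorInj i ∧ MorSurj p ∧
      ∀ x, LinearMap.range (Matrix.mulVecLin (i x)) = LinearMap.ker (Matrix.mulVecLin (p x))

/-- The set `P_A(α) = {V ∈ mod(A,α) : pdim_A V ≤ 1}` where `A = ℂQ/⟨S⟩`. -/
def PAset (S : Set (FormalRel Q)) (α : Q.V → ℕ) : Set (QRep Q α) :=
  {V | V ∈ modSet S α ∧ PdimLE1 S V}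

end ProjPdim

section Zariski

/-- The Zariski topology on the affine space `ι → ℂ`: generated by the complements of
hypersurfaces. -/
def zarPi (ι : Type) : TopologicalSpace (ι → ℂ) :=
  TopologicalSpace.generateFrom
    {U | ∃ p : MvPolynomial ι ℂ, U = {w | MvPolynomial.eval w p ≠ 0}}

variable {Q : Quiv}

/-- The Zariski topology on `rep(Q,β)`. -/
def zarTop (β : Q.V → ℕ) : TopologicalSpace (QRep Q β) :=
  TopologicalSpace.induced (repCoords (β := β)) (zarPi _)

/-- Zariski closure in `rep(Q,β)`. -/
def zclosure {β : Q.V → ℕ} (s : Set (QRep Q β)) : Set (QRep Q β) :=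
  @closure _ (zarTop β) s

/-- Zariski-open. -/
def zIsOpen {β : Q.V → ℕ} (s : Set (QRep Q β)) : Prop := @IsOpen _ (zarTop β) s

/-- Zariski-closed. -/
def zIsClosed {β : Q.V → ℕ} (s : Set (QRep Q β)) : Prop := @IsClosed _ (zarTop β) s

/-- Irreducibility in the Zariski topology. -/
def zIrred {β : Q.V → ℕ} (s : Set (QRep Q β)) : Prop := @IsIrreducible _ (zarTop β) s

/-- Dimension of a subset of `rep(Q,β)`: the topological Krull dimension in the
(subspace) Zariski topology. -/
def zdim {β : Q.V → ℕ} (s : Set (QRep Q β)) : WithBot ℕ∞ :=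
  @topologicalKrullDim s (TopologicalSpace.induced Subtype.val (zarTop β))

/-- `C(α)`: the closure of `P_A(α)`. -/
def Cset (S : Set (FormalRel Q)) (α : Q.V → ℕ) : Set (QRep Q α) := zclosure (PAset S α)

/-- `C` is an irreducible component of `M` (for `M` closed in `rep(Q,α)`): a maximal
irreducible closed subset of `M`. -/
def IsIrrCompOf {β : Q.V → ℕ} (C M : Set (QRep Q β)) : Prop :=
  zIrred C ∧ zIsClosed C ∧ C ⊆ M ∧
    ∀ C' : Set (QRep Q β), zIrred C' → zIsClosed C' → C' ⊆ M → C ⊆ C' → C' = C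

/-- `V` is an indecomposable representation: it is nonzero and its endomorphism algebra
has no idempotents other than `0` and `1`. -/
def IsIndecRep {α : Q.V → ℕ} (V : QRep Q α) : Prop :=
  (∃ x, α x ≠ 0) ∧
  ∀ φ ∈ HomS V V, (∀ x, φ x * φ x = φ x) → φ = 0 ∨ φ = fun x => (1 : Matrix _ _ ℂ)

/-- `C` is an indecomposable irreducible component of `M`: an irreducible component
containing a dense open subset of indecomposable representations. -/
def IsIndecComp {β : Q.V → ℕ} (C M : Set (QRep Q β)) : Prop :=
  IsIrrCompOf C M ∧
  ∃ U : Set (QRep Q β), zIsOpen U ∧ C ⊆ zclosure (C ∩ U) ∧ ∀ V ∈ C ∩ U, IsIndecRep V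

/-- The `GL(α)`-orbit of `V`. -/
def orbitOf {α : Q.V → ℕ} (V : QRep Q α) : Set (QRep Q α) := {W | ∃ g : GLb α, gAct g V = W}

/-- `C` is an orbit closure `closure(GL(α)·V)` of some module `V ∈ mod(A,α)`. -/
def IsOrbitClosure (S : Set (FormalRel Q)) {α : Q.V → ℕ} (C : Set (QRep Q α)) : Prop :=
  ∃ V ∈ modSet S α, C = zclosure (orbitOf V)

/-- The coordinates on `∏_x ℂ^{α(x) × α(x)}`, the ambient space of `GL(α)`. -/
def glCoords {α : Q.V → ℕ} (g : ∀ x : Q.V, Matrix (Fin (α x)) (Fin (α x)) ℂ) :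
    (Σ x : Q.V, Fin (α x) × Fin (α x)) → ℂ := fun c => g c.1 c.2.1 c.2.2

/-- The Zariski topology on `∏_x ℂ^{α(x) × α(x)}`. -/
def glTop (Q : Quiv) (α : Q.V → ℕ) :
    TopologicalSpace (∀ x : Q.V, Matrix (Fin (α x)) (Fin (α x)) ℂ) :=
  TopologicalSpace.induced glCoords (zarPi _)

/-- `GL(α)` as a (quasi-affine) subset of `∏_x ℂ^{α(x) × α(x)}`. -/
def glSet (Q : Quiv) (α : Q.V → ℕ) : Set (∀ x : Q.V, Matrix (Fin (α x)) (Fin (α x)) ℂ) :=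
  {g | ∀ x, IsUnit (g x)}

/-- The dimension of the group variety `GL(α)`. -/
def glDim (Q : Quiv) (α : Q.V → ℕ) : WithBot ℕ∞ :=
  @topologicalKrullDim (glSet Q α) (TopologicalSpace.induced Subtype.val (glTop Q α))

end Zariski
section Sums

variable {Q : Quiv}

/-- `W` is a direct sum of the representations `V i` (up to isomorphism of the underlying
block-diagonal structure). -/
def IsSumOf {ι : Type} [Fintype ι] [DecidableEq ι] {αs : ι → Q.V → ℕ} {δ : Q.V → ℕ}
    (W : QRep Q δ) (V : ∀ i, QRep Q (αs i)) : Prop :=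
  ∃ u : ∀ x : Q.V, ((Fin (δ x) → ℂ) ≃ₗ[ℂ] ((Σ i, Fin (αs i x)) → ℂ)),
    ∀ a : Q.A, (u (Q.h a)).toLinearMap ∘ₗ (W a).mulVecLin =
      (Matrix.blockDiagonal' (fun i => V i a)).mulVecLin ∘ₗ (u (Q.t a)).toLinearMap

/-- The constructible subset `C₁ ⊕ ⋯ ⊕ C_l ⊆ rep(Q,δ)`: representations isomorphic to a
direct sum `V₁ ⊕ ⋯ ⊕ V_l` with `V_i ∈ C_i`. -/
def sumSet {ι : Type} [Fintype ι] [DecidableEq ι] (αs : ι → Q.V → ℕ)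
    (Cs : ∀ i, Set (QRep Q (αs i))) (δ : Q.V → ℕ) : Set (QRep Q δ) :=
  {W | ∃ V : ∀ i, QRep Q (αs i), (∀ i, V i ∈ Cs i) ∧ IsSumOf W V}

/-- The generic `Ext¹` between two subsets:
`ext¹(C,D) = min {dim Ext¹(X,Y) : (X,Y) ∈ C × D}`. -/
def genExt1 (S : Set (FormalRel Q)) {α α' : Q.V → ℕ}
    (C : Set (QRep Q α)) (D : Set (QRep Q α')) : ℕ :=
  sInf {n : ℕ | ∃ X ∈ C, ∃ Y ∈ D, n = dimExt1 S X Y}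

end Sums

section ExtHigher

variable {Q : Quiv}

/-- A representation of `Q` packaged with its dimension vector. -/
def PRp (Q : Quiv) := Σ γ : Q.V → ℕ, QRep Q γ

instance : Inhabited (PRp Q) := ⟨⟨fun _ => 0, fun _ => 0⟩⟩

/-- `K` is a (first) syzygy of `M` over `ℂQ/⟨S⟩`: there is a short exact sequence
`0 → K → P → M → 0` with `P` a projective module. -/
def IsSyzOf (S : Set (FormalRel Q)) (K M : PRp Q) : Prop :=
  K.2 ∈ modSet S K.1 ∧ ∃ (γP : Q.V → ℕ) (P : QRep Q γP), P ∈ modSet S γP ∧ IsProjRep S P ∧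
    ∃ i ∈ HomS K.2 P, ∃ p ∈ HomS P M.2, MorInj i ∧ MorSurj p ∧
      ∀ x, LinearMap.range (Matrix.mulVecLin (i x)) = LinearMap.ker (Matrix.mulVecLin (p x))

/-- A chosen syzygy of `M` over `ℂQ/⟨S⟩`. -/
def syz (S : Set (FormalRel Q)) (M : PRp Q) : PRp Q :=
  Classical.epsilon (fun K => IsSyzOf S K M)

/-- `dim_ℂ Ext^l (M,N)` over `ℂQ/⟨S⟩`, via dimension shifting along syzygies:
`Ext⁰ = Hom`, `Ext¹` is computed by cochains, and `Ext^{l+2}(M,N) = Ext^{l+1}(ΩM,N)`. -/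
def dimExtN (S : Set (FormalRel Q)) : ℕ → PRp Q → PRp Q → ℕ
  | 0, M, N => dimHom M.2 N.2
  | 1, M, N => dimExt1 S M.2 N.2
  | (l+2), M, N => dimExtN S (l+1) (syz S M) N

/-- The simple representation `S_x` concentrated at the vertex `x`. -/
def simplePR (Q : Quiv) (x0 : Q.V) : PRp Q :=
  ⟨fun z => if z = x0 then 1 else 0, fun _ => 0⟩

/-- The Euler form pairing `⟨α, dim S_y⟩_B` of the algebra `B = ℂQ/⟨S⟩`:
`Σ_{l ≥ 0} (−1)^l Σ_x dim Ext^l_B(S_x,S_y) · α(x)`.  The weight `⟨α,−⟩_B` is the function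
`y ↦ eulerPair S α y`. -/
def eulerPair (S : Set (FormalRel Q)) (α : Q.V → ℕ) (y : Q.V) : ℤ :=
  ∑ᶠ l : ℕ, (-1 : ℤ)^l *
    ∑ x : Q.V, (α x : ℤ) * (dimExtN S l (simplePR Q x) (simplePR Q y) : ℤ)

/-- The set of relations annihilating `W`: the annihilator `Ann_{ℂQ}(W)`, so that
`B = ℂQ/Ann_{ℂQ}(W)`. -/
def annRel {β : Q.V → ℕ} (W : QRep Q β) : Set (FormalRel Q) :=
  {r | evalLin W r.2.2 = 0}

/-- The weight semigroup `L_W` of `W`: weights `σ` with `σ|_{supp β} = ⟨α,−⟩_B` for some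
dimension vector `α ∈ ℕ^{supp β}` with `P_B(α) ≠ ∅`, where `B = ℂQ/Ann_{ℂQ}(W)`. -/
def weightSgrp {β : Q.V → ℕ} (W : QRep Q β) : Set (Q.V → ℤ) :=
  {σ | ∃ α : Q.V → ℕ, (∀ x, β x = 0 → α x = 0) ∧ (PAset (annRel W) α).Nonempty ∧
    ∀ y, β y ≠ 0 → σ y = eulerPair (annRel W) α y}

end ExtHigher

section Tame

variable {Q : Quiv}

/-- Specialization of a representation over `ℂ[x]` at `λ ∈ ℂ`, i.e.
`M ⊗_{ℂ[x]} ℂ[x]/(x−λ)`. -/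
def polyEvalAt {γ : Q.V → ℕ} (M : RepR Q (Polynomial ℂ) γ) (lam : ℂ) : QRep Q γ :=
  fun a => (M a).map (fun p => Polynomial.eval lam p)

/-- The algebra `A = ℂQ/⟨S⟩` is tame: for every dimension `d` there are finitely many
`A`–`ℂ[x]`-bimodules `M₁,…,M_s`, free of finite rank over `ℂ[x]` (i.e. matrix
representations over `ℂ[x]` satisfying the relations), such that all but finitely many
isomorphism classes of `d`-dimensional indecomposable `A`-modules are of the form
`M_i ⊗_{ℂ[x]} ℂ[x]/(x−λ)`. -/
def IsTame (S : Set (FormalRel Q)) : Prop :=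
  ∀ d : ℕ, ∃ (s : ℕ) (γs : Fin s → (Q.V → ℕ)) (M : ∀ i, RepR Q (Polynomial ℂ) (γs i)),
    (∀ i, ∀ r ∈ S, evalLinP (M i) r.2.2 = 0) ∧
    ∃ (t : ℕ) (βs : Fin t → (Q.V → ℕ)) (E : ∀ k, QRep Q (βs k)),
      ∀ (α : Q.V → ℕ) (V : QRep Q α), V ∈ modSet S α → (∑ x, α x) = d → IsIndecRep V →
        (∃ k, RIso (E k) V) ∨ (∃ i lam, RIso (polyEvalAt (M i) lam) V)

end Tame

section Stability

variable {Q : Quiv}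

/-- `U` is a subrepresentation of `V` (a family of subspaces preserved by the structure
maps). -/
def SubRep {α : Q.V → ℕ} (V : QRep Q α) (U : ∀ x : Q.V, Submodule ℂ (Fin (α x) → ℂ)) : Prop :=
  ∀ a : Q.A, (U (Q.t a)).map (Matrix.mulVecLin (V a)) ≤ U (Q.h a)

/-- `V` is `θ`-stable: `V ≠ 0`, `θ · dim V = 0`, and `θ · dim V' < 0` for every proper
nonzero subrepresentation `V'` of `V`. -/
def ThetaStable {α : Q.V → ℕ} (θ : Q.V → ℤ) (V : QRep Q α) : Prop :=
  (∃ x, α x ≠ 0) ∧ (∑ x, θ x * (α x : ℤ)) = 0 ∧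
  ∀ U : ∀ x : Q.V, Submodule ℂ (Fin (α x) → ℂ), SubRep V U →
    (∃ x, U x ≠ ⊥) → (∃ x, U x ≠ ⊤) →
      (∑ x, θ x * (Module.finrank ℂ (U x) : ℤ)) < 0

/-- The morphism with components `f` from `P` is essential onto its image: any
subrepresentation of `P` mapping onto the image of `f` is all of `P`. -/
def IsEssentialTo {γ δ : Q.V → ℕ} (P : QRep Q γ)
    (f : ∀ x : Q.V, Matrix (Fin (δ x)) (Fin (γ x)) ℂ) : Prop :=
  ∀ U : ∀ x : Q.V, Submodule ℂ (Fin (γ x) → ℂ), SubRep P U →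
    (∀ x, (U x).map (Matrix.mulVecLin (f x)) = LinearMap.range (Matrix.mulVecLin (f x))) →
      ∀ x, U x = ⊤

end Stability

section Ideal

variable {Q : Quiv}

/-- The `(x,y)`-component of the two-sided ideal `⟨S⟩` of `ℂQ` generated by the
relations in `S`: the span of the translates `q·r·p` of relations `r ∈ S` by paths. -/
def idealComp (S : Set (FormalRel Q)) (x y : Q.V) : Submodule ℂ (Quiver.Path x y →₀ ℂ) :=
  Submodule.span ℂ {c | ∃ r ∈ S, ∃ (p : Quiver.Path x r.1) (q : Quiver.Path r.2.1 y),
    c = Finsupp.mapDomain (fun s => (p.comp s).comp q) r.2.2}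

/-- `W` is a faithful module over `A = ℂQ/⟨S⟩`: every element of `ℂQ` annihilating `W`
lies in the ideal `⟨S⟩`. -/
def FaithfulOver (S : Set (FormalRel Q)) {β : Q.V → ℕ} (W : QRep Q β) : Prop :=
  ∀ (x y : Q.V) (c : Quiver.Path x y →₀ ℂ), evalLin W c = 0 → c ∈ idealComp S x y

end Ideal
section Precomp

variable {Q : Quiv}

/-- Precomposition with a morphism `f : L → M` of representations, as a linear map
`Hom(M,N) → Hom(L,N)`, `φ ↦ φ ∘ f`. -/
def precompMap {γ₁ γ₀ δ : Q.V → ℕ} (L : QRep Q γ₁) (M : QRep Q γ₀) (N : QRep Q δ)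
    (f : ∀ x : Q.V, Matrix (Fin (γ₀ x)) (Fin (γ₁ x)) ℂ) (hf : f ∈ HomS L M) :
    (HomS M N) →ₗ[ℂ] (HomS L N) where
  toFun φ := ⟨fun x => φ.1 x * f x, by
    intro a
    have h1 : φ.1 (Q.h a) * M a = N a * φ.1 (Q.t a) := φ.2 a
    have h2 : f (Q.h a) * L a = M a * f (Q.t a) := hf a
    calc (φ.1 (Q.h a) * f (Q.h a)) * L a
        = φ.1 (Q.h a) * (f (Q.h a) * L a) := by rw [Matrix.mul_assoc]
      _ = φ.1 (Q.h a) * (M a * f (Q.t a)) := by rw [h2]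
      _ = (φ.1 (Q.h a) * M a) * f (Q.t a) := by rw [Matrix.mul_assoc]
      _ = (N a * φ.1 (Q.t a)) * f (Q.t a) := by rw [h1]
      _ = N a * (φ.1 (Q.t a) * f (Q.t a)) := by rw [Matrix.mul_assoc]⟩
  map_add' φ ψ := by
    apply Subtype.ext
    funext x
    simp [Matrix.add_mul]
  map_smul' c φ := by
    apply Subtype.ext
    funext x
    simp [Matrix.smul_mul]

end Precomp

section BipartiteQsig

variable (Q : Quiv) (β : Q.V → ℕ) (σ : Q.V → ℤ)

/-- The bipartite quiver `Q^σ`: its vertices are the vertices of `Q` where `σ` is positive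
together with those where `σ` is negative, and it has one arrow `a_p : v_i → w_j` for every
oriented path `p` in `Q` from `v_i` to `w_j`. -/
def Qsig : Quiv where
  V := PosV Q σ ⊕ NegV Q σ
  A := Σ (i : PosV Q σ) (j : NegV Q σ), Quiver.Path i.1 j.1
  t := fun a => Sum.inl a.1
  h := fun a => Sum.inr a.2.1
  fV := inferInstance
  dV := inferInstance

/-- The dimension vector `β` restricted to `Q^σ`. -/
def betaSig : (Qsig Q σ).V → ℕ := Sum.elim (fun i => β i.1) (fun j => β j.1)

/-- The weight `σ` restricted to `Q^σ`. -/
def sigSig : (Qsig Q σ).V → ℤ := Sum.elim (fun i => σ i.1) (fun j => σ j.1)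

/-- The morphism `φ : rep(Q,β) → rep(Q^σ,β)` given by `φ(W)(a_p) = W(p)`. -/
def phiSig (W : QRep Q β) : QRep (Qsig Q σ) (betaSig Q β σ) :=
  fun a => evalPath W a.2.2

end BipartiteQsig

/-- The subfield of `ℂ` generated by a subfield and a finite set. -/
def Subfield.adj (L : Subfield ℂ) (Λ : Finset ℂ) : Subfield ℂ := Subfield.closure (L ∪ Λ)

lemma Subfield.le_adj (L : Subfield ℂ) (Λ : Finset ℂ) : L ≤ L.adj Λ := fun _ hx =>
  Subfield.subset_closure (Or.inl hx)

lemma Subfield.mem_adj_of_mem (L : Subfield ℂ) {Λ : Finset ℂ} {x : ℂ} (hx : x ∈ Λ) :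
    x ∈ L.adj Λ := Subfield.subset_closure (Or.inr hx)

lemma Subfield.adj_le {L K : Subfield ℂ} {Λ : Finset ℂ} (h : L ≤ K) (h' : ∀ x ∈ Λ, x ∈ K) :
    L.adj Λ ≤ K :=
  (Subfield.closure_le).2 (Set.union_subset h h')

lemma Subfield.adj_mono {L L' : Subfield ℂ} {Λ Λ' : Finset ℂ} (h : L ≤ L') (h' : Λ ⊆ Λ') :
    L.adj Λ ≤ L'.adj Λ' :=
  Subfield.adj_le (h.trans (L'.le_adj _)) fun _ hx => L'.mem_adj_of_mem (h' hx)

lemma Subfield.adj_adj_le (L : Subfield ℂ) (Λ Λ' : Finset ℂ) :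
    (L.adj Λ).adj Λ' ≤ L.adj (Λ ∪ Λ') :=
  Subfield.adj_le (Subfield.adj_mono le_rfl Finset.subset_union_left)
    fun _ hx => L.mem_adj_of_mem (Finset.mem_union_right _ hx)

/-- Algebraically independent elements of `k(Λ)` are at most as many as the elements of `Λ`. -/
lemma card_le_card_of_algebraicIndependent {N : Type} [Fintype N] (k : Subfield ℂ) {t : N → ℂ}
    (ht : AlgebraicIndependent k t) {Λ : Finset ℂ} (h : ∀ j, t j ∈ k.adj Λ) :
    Fintype.card N ≤ Λ.card := by
  have halg : ∀ x ∈ k.adj Λ, IsAlgebraic (Algebra.adjoin k (Λ : Set ℂ)) x := by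
    intro x hx
    induction hx using Subfield.closure_induction with
    | mem x hx =>
      rcases hx with hx | hx
      · exact isAlgebraic_algebraMap (A := ℂ)
          (algebraMap k (Algebra.adjoin k (Λ : Set ℂ)) ⟨x, hx⟩)
      · exact isAlgebraic_algebraMap (A := ℂ)
          (⟨x, Algebra.subset_adjoin hx⟩ : Algebra.adjoin k (Λ : Set ℂ))
    | one => exact isAlgebraic_one
    | add x y _ _ hx hy => exact hx.add hy
    | neg x _ hx => exact hx.neg
    | inv x _ hx => exact hx.inv
    | mul x y _ _ hx hy => exact hx.mul hy
  have hind : (AlgebraicIndependent.matroid k ℂ).Indep (Set.range t) :=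
    AlgebraicIndependent.matroid_indep_iff.2 ht.coe_range
  have hsub : Set.range t ⊆ (AlgebraicIndependent.matroid k ℂ).closure (Λ : Set ℂ) := by
    rw [AlgebraicIndependent.matroid_closure_eq]
    rintro _ ⟨j, rfl⟩
    exact halg _ (h j)
  have h1 := hind.encard_le_eRk_of_subset hsub
  rw [Matroid.eRk_closure_eq] at h1
  have h2 := h1.trans (Matroid.eRk_le_encard _ _)
  have h3 : (Set.range t).encard = (Fintype.card N : ℕ∞) := by
    rw [← Set.image_univ, ht.injective.encard_image, Set.encard_univ]
    simp
  rw [h3, Set.encard_coe_eq_coe_finsetCard] at h2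
  exact_mod_cast h2

lemma exists_algebraicIndependent (N : Type) [Finite N] {k : Subfield ℂ}
    (hk : (k : Set ℂ).Countable) : ∃ t : N → ℂ, AlgebraicIndependent k t := by
  obtain ⟨s, hs⟩ := exists_isTranscendenceBasis' k ℂ
  obtain ⟨v, hv⟩ := hs
  have hcard := IsAlgClosed.cardinal_eq_cardinal_transcendence_basis_of_aleph0_lt v hv
    (by
      have := hk.to_subtype
      exact Cardinal.mk_le_aleph0_iff.2 this)
    (by simpa using Cardinal.aleph0_lt_continuum)
  have : Infinite s := by
    rw [Cardinal.infinite_iff]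
    have : Cardinal.aleph0 ≤ Cardinal.lift.{0} (Cardinal.mk s) := by
      rw [← hcard]
      simpa using Cardinal.aleph0_le_continuum
    simpa using this
  obtain ⟨n, ⟨e⟩⟩ := Finite.exists_equiv_fin N
  let f : N → s := fun x => Infinite.natEmbedding s (e x)
  have hf : Function.Injective f := (Infinite.natEmbedding s).injective.comp
    (Fin.val_injective.comp e.injective)
  exact ⟨v ∘ f, hv.1.comp f hf⟩

lemma countable_closure_subfield {s : Set ℂ} (hs : s.Countable) :
    ((Subfield.closure s : Subfield ℂ) : Set ℂ).Countable := by
  have h := Subfield.cardinalMk_closure_le_max s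
  have : Cardinal.mk s ≤ Cardinal.aleph0 := Cardinal.mk_le_aleph0_iff.2 hs.to_subtype
  rw [max_eq_right this] at h
  exact Set.countable_coe_iff.1 (Cardinal.mk_le_aleph0_iff.1 h)

/-- Solution spaces of linear systems over a subfield `L` are defined over `L`. -/
lemma exists_rational_coordinates {ι : Type} [Fintype ι] (L : Subfield ℂ)
    (E : Set (ι → ℂ)) (hE : ∀ r ∈ E, ∀ i, r i ∈ L) (K : Submodule ℂ (ι → ℂ))
    (hK : ∀ v, v ∈ K ↔ ∀ r ∈ E, ∑ i, r i * v i = 0) :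
    ∃ (κ : Type) (_ : Fintype κ) (a : κ → ι) (c : ι → κ → ℂ),
      (∀ i j, c i j ∈ L) ∧ (∀ v ∈ K, ∀ i, v i = ∑ j, c i j * v (a j)) ∧
      Fintype.card κ = Module.finrank ℂ K := by
  classical
  let S : Submodule L (ι → L) := Submodule.span L {r | (fun i => (r i : ℂ)) ∈ E}
  let ε : ι → (ι → L) ⧸ S := fun i => S.mkQ (Pi.single i 1)
  obtain ⟨κ, a, ha, hsp, hli⟩ := exists_linearIndependent' L ε
  have : Finite κ := Finite.of_injective a ha
  have := Fintype.ofFinite κ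
  have hspan : ∀ w : ι → L, S.mkQ w = ∑ i, w i • ε i := by
    intro w
    conv_lhs => rw [← Finset.univ_sum_single w, map_sum]
    refine Finset.sum_congr rfl fun i _ => ?_
    rw [← map_smul, ← Pi.single_smul, smul_eq_mul, mul_one]
  have hmem : ∀ i, ε i ∈ Submodule.span L (Set.range (ε ∘ a)) := fun i => by
    rw [hsp]; exact Submodule.subset_span ⟨i, rfl⟩
  have hex : ∀ i, ∃ c : κ → L, ∑ j, c j • (ε ∘ a) j = ε i := fun i =>
    (Submodule.mem_span_range_iff_exists_fun L).1 (hmem i)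
  choose c hc using hex
  have hca : ∀ j j', c (a j) j' = if j' = j then 1 else 0 := by
    intro j j'
    have h1 : ∑ k, (c (a j) k - if k = j then 1 else 0) • (ε ∘ a) k = 0 := by
      simp only [sub_smul, Finset.sum_sub_distrib, ite_smul, one_smul, zero_smul,
        Finset.sum_ite_eq', Finset.mem_univ, if_true]
      rw [hc, Function.comp_apply, sub_self]
    have := Fintype.linearIndependent_iff.1 hli _ h1 j'
    rwa [sub_eq_zero] at this
  have hann : ∀ v ∈ K, ∀ w ∈ S, ∑ i, (w i : ℂ) * v i = 0 := by
    intro v hv w hw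
    induction hw using Submodule.span_induction with
    | mem r hr => exact (hK v).1 hv _ hr
    | zero => simp
    | add x y _ _ hx hy => simp [add_mul, Finset.sum_add_distrib, hx, hy]
    | smul l x _ hx => simp [mul_assoc, ← Finset.mul_sum, hx]
  have hform : ∀ v ∈ K, ∀ i, v i = ∑ j, (c i j : ℂ) * v (a j) := by
    intro v hv i
    have hw : (Pi.single i 1 - ∑ j, c i j • Pi.single (a j) 1 : ι → L) ∈ S := by
      rw [← Submodule.Quotient.mk_eq_zero, ← Submodule.mkQ_apply, map_sub, map_sum]
      simp only [map_smul]
      rw [sub_eq_zero]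
      exact (hc i).symm
    have := hann v hv _ hw
    simp only [Pi.sub_apply, Finset.sum_apply, Pi.smul_apply, Pi.single_apply, smul_eq_mul,
      mul_ite, mul_one, mul_zero] at this
    push_cast at this
    simp only [sub_mul, Finset.sum_sub_distrib, Finset.sum_mul, apply_ite (Subtype.val),
      ite_mul] at this
    rw [Finset.sum_comm] at this
    simp [sub_eq_zero] at this
    exact this
  refine ⟨κ, inferInstance, a, fun i j => c i j, fun i j => (c i j).2, hform, ?_⟩
  let ρ : K →ₗ[ℂ] (κ → ℂ) := (LinearMap.funLeft ℂ ℂ a) ∘ₗ K.subtype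
  have hinj : Function.Injective ρ := by
    rw [injective_iff_map_eq_zero]
    intro v hv
    ext i
    rw [hform v v.2 i]
    simp only [ZeroMemClass.coe_zero, Pi.zero_apply]
    refine Finset.sum_eq_zero fun j _ => ?_
    have : (v : ι → ℂ) (a j) = 0 := congrFun hv j
    rw [this, mul_zero]
  have hsurj : Function.Surjective ρ := by
    intro u
    refine ⟨⟨fun i => ∑ j, (c i j : ℂ) * u j, (hK _).2 fun r hr => ?_⟩, ?_⟩
    · let r' : ι → L := fun i => ⟨r i, hE r hr i⟩
      have h0 : S.mkQ r' = 0 := by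
        rw [Submodule.mkQ_apply, Submodule.Quotient.mk_eq_zero]
        exact Submodule.subset_span hr
      rw [hspan] at h0
      have h1 : ∑ j, (∑ i, r' i * c i j) • (ε ∘ a) j = 0 := by
        rw [← h0]
        simp only [Finset.sum_smul]
        rw [Finset.sum_comm]
        refine Finset.sum_congr rfl fun i _ => ?_
        rw [← hc i, Finset.smul_sum]
        simp [mul_smul]
      have h2 := Fintype.linearIndependent_iff.1 hli _ h1
      simp only [Finset.mul_sum]
      rw [Finset.sum_comm]
      refine Finset.sum_eq_zero fun j _ => ?_
      have h3 : ∑ i, r i * (c i j : ℂ) = 0 := by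
        have := congrArg (Subtype.val) (h2 j)
        simpa [r'] using this
      simp only [← mul_assoc, ← Finset.sum_mul, h3, zero_mul]
    · funext j
      simp [ρ, LinearMap.funLeft_apply, hca, apply_ite (Subtype.val)]
  rw [(LinearEquiv.ofBijective ρ ⟨hinj, hsurj⟩).finrank_eq]
  simp

/-- An injective family of coordinates contains a bijective one. -/
lemma exists_bijective_coordinates {E κ : Type} [Fintype κ] [AddCommGroup E] [Module ℂ E]
    (f : E →ₗ[ℂ] (κ → ℂ)) (hf : Function.Injective f) :
    ∃ J : Finset κ, J.card = Module.finrank ℂ E ∧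
      Function.Bijective (fun e : E => fun j : J => f e j) := by
  classical
  have : FiniteDimensional ℂ E := FiniteDimensional.of_injective f hf
  let φ : κ → Module.Dual ℂ E := fun j => LinearMap.proj j ∘ₗ f
  obtain ⟨κ', a, ha, hsp, hli⟩ := exists_linearIndependent' ℂ φ
  have : Finite κ' := Finite.of_injective a ha
  have := Fintype.ofFinite κ'
  let J : Finset κ := Finset.univ.image a
  have hcard : J.card = Fintype.card κ' := by
    rw [Finset.card_image_of_injective _ ha, Finset.card_univ]
  let ρ : E →ₗ[ℂ] (J → ℂ) := LinearMap.funLeft ℂ ℂ (Subtype.val) ∘ₗ f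
  have hinj : Function.Injective ρ := by
    rw [injective_iff_map_eq_zero]
    intro e he
    have h1 : ∀ ψ ∈ Submodule.span ℂ (Set.range (φ ∘ a)), ψ e = 0 := by
      intro ψ hψ
      induction hψ using Submodule.span_induction with
      | mem r hr =>
        obtain ⟨j, rfl⟩ := hr
        exact congrFun he ⟨a j, Finset.mem_image_of_mem a (Finset.mem_univ j)⟩
      | zero => simp
      | add x y _ _ hx hy => simp [hx, hy]
      | smul l x _ hx => simp [hx]
    rw [hsp] at h1
    apply hf
    rw [map_zero]
    funext j
    exact h1 _ (Submodule.subset_span ⟨j, rfl⟩)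
  have hle : J.card ≤ Module.finrank ℂ E := by
    rw [hcard, ← Subspace.dual_finrank_eq]
    exact hli.fintype_card_le_finrank
  have heq : J.card = Module.finrank ℂ E := by
    refine le_antisymm hle ?_
    have := LinearMap.finrank_le_finrank_of_injective hinj
    simpa using this
  refine ⟨J, heq, hinj, ?_⟩
  have hfr : Module.finrank ℂ E = Module.finrank ℂ (J → ℂ) := by simp [heq]
  exact (LinearMap.injective_iff_surjective_of_finrank_eq_finrank hfr).1 hinj

section Rational

set_option linter.unusedSectionVars false

variable {A : Type} [Ring A] [Algebra ℂ A] {G : Type} {gen : G → A}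
variable {X Y Z : Type} [AddCommGroup X] [Module ℂ X] [Module A X] [IsScalarTower ℂ A X]
  [AddCommGroup Y] [Module ℂ Y] [Module A Y] [IsScalarTower ℂ A Y]
  [AddCommGroup Z] [Module ℂ Z]

instance finiteDimensional_hom [FiniteDimensional ℂ X] [FiniteDimensional ℂ Y] :
    FiniteDimensional ℂ (X →ₗ[A] Y) :=
  FiniteDimensional.of_injective (LinearMap.restrictScalarsₗ ℂ A X Y ℂ)
    (LinearMap.restrictScalars_injective ℂ)

lemma smul_comm_of_gens (hgen : Algebra.adjoin ℂ (Set.range gen) = ⊤) (f : X →ₗ[ℂ] Y)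
    (h : ∀ g x, f (gen g • x) = gen g • f x) (a : A) (x : X) : f (a • x) = a • f x := by
  have ha : a ∈ Algebra.adjoin ℂ (Set.range gen) := by rw [hgen]; trivial
  induction ha using Algebra.adjoin_induction generalizing x with
  | mem a ha => obtain ⟨g, rfl⟩ := ha; exact h g x
  | algebraMap r => simp [algebraMap_smul]
  | add a b _ _ ha hb => simp [add_smul, ha, hb]
  | mul a b _ _ ha hb => simp [mul_smul, ha, hb]

/-- A `ℂ`-linear map commuting with the generators of `A` is `A`-linear. -/
def homOfGens (hgen : Algebra.adjoin ℂ (Set.range gen) = ⊤) (f : X →ₗ[ℂ] Y)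
    (h : ∀ g x, f (gen g • x) = gen g • f x) : X →ₗ[A] Y :=
  { f with map_smul' := smul_comm_of_gens hgen f h }

@[simp] lemma homOfGens_apply (hgen : Algebra.adjoin ℂ (Set.range gen) = ⊤) (f : X →ₗ[ℂ] Y)
    (h : ∀ g x, f (gen g • x) = gen g • f x) (x : X) : homOfGens hgen f h x = f x := rfl

/-- The generators of `A` act on the basis `b` by matrices with entries in `L`. -/
def IsRatBasis (gen : G → A) (L : Subfield ℂ) {ι : Type} (b : Module.Basis ι ℂ X) : Prop :=
  ∀ g i j, b.repr (gen g • b j) i ∈ L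

lemma IsRatBasis.mono {L L' : Subfield ℂ} (h : L ≤ L') {ι : Type} {b : Module.Basis ι ℂ X}
    (hb : IsRatBasis gen L b) : IsRatBasis gen L' b := fun g i j => h (hb g i j)

variable {ι κ : Type} [Fintype ι] [Fintype κ]

/-- Matrix entries of a homomorphism. -/
def homEntries (bX : Module.Basis ι ℂ X) (bY : Module.Basis κ ℂ Y) :
    (X →ₗ[A] Y) →ₗ[ℂ] (κ × ι → ℂ) where
  toFun f := fun q => bY.repr (f (bX q.2)) q.1
  map_add' f g := by funext q; simp
  map_smul' c f := by funext q; simp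

lemma homEntries_injective (bX : Module.Basis ι ℂ X) (bY : Module.Basis κ ℂ Y) :
    Function.Injective (homEntries (A := A) bX bY) := by
  intro f g h
  apply LinearMap.restrictScalars_injective ℂ
  refine bX.ext fun i => ?_
  refine bY.ext_elem fun k => ?_
  exact congrFun h (k, i)

lemma mem_range_homEntries (hgen : Algebra.adjoin ℂ (Set.range gen) = ⊤)
    (bX : Module.Basis ι ℂ X) (bY : Module.Basis κ ℂ Y) (v : κ × ι → ℂ) :
    v ∈ LinearMap.range (homEntries (A := A) bX bY) ↔
      ∀ g k i, ∑ i', bX.repr (gen g • bX i) i' * v (k, i')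
        - ∑ k', bY.repr (gen g • bY k') k * v (k', i) = 0 := by
  have key : ∀ (f : X →ₗ[ℂ] Y) (g : G) (k : κ) (i : ι),
      bY.repr (f (gen g • bX i)) k - bY.repr (gen g • f (bX i)) k =
      ∑ i', bX.repr (gen g • bX i) i' * bY.repr (f (bX i')) k
        - ∑ k', bY.repr (gen g • bY k') k * bY.repr (f (bX i)) k' := by
    intro f g k i
    congr 1
    · conv_lhs => rw [← bX.sum_repr (gen g • bX i)]
      rw [map_sum, map_sum, Finsupp.finsetSum_apply]
      refine Finset.sum_congr rfl fun i' _ => ?_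
      rw [map_smul, map_smul, Finsupp.smul_apply, smul_eq_mul]
    · conv_lhs => rw [← bY.sum_repr (f (bX i))]
      rw [Finset.smul_sum, map_sum, Finsupp.finsetSum_apply]
      refine Finset.sum_congr rfl fun k' _ => ?_
      rw [smul_comm, map_smul, Finsupp.smul_apply, smul_eq_mul, mul_comm]
  constructor
  · rintro ⟨f, rfl⟩ g k i
    have := key (f.restrictScalars ℂ) g k i
    simp only [LinearMap.restrictScalars_apply, map_smul, sub_self] at this
    exact this.symm
  · intro h
    let f : X →ₗ[ℂ] Y := bX.constr ℂ fun i => ∑ k, v (k, i) • bY k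
    have hf : ∀ i k, bY.repr (f (bX i)) k = v (k, i) := by
      intro i k
      simp only [f, Module.Basis.constr_basis]
      rw [bY.repr_sum_self fun k => v (k, i)]
    refine ⟨homOfGens hgen f fun g x => ?_, ?_⟩
    · have : f ∘ₗ Algebra.lsmul ℂ ℂ X (gen g) =
          Algebra.lsmul ℂ ℂ Y (gen g) ∘ₗ f := by
        refine bX.ext fun i => bY.ext_elem fun k => ?_
        have h1 := key f g k i
        simp only [hf] at h1
        rw [h g k i, sub_eq_zero] at h1
        simpa using h1
      simpa using LinearMap.congr_fun this x
    · funext q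
      exact hf q.2 q.1

lemma exists_nat_isUnit {E : Type} [AddCommGroup E] [Module ℂ E] [FiniteDimensional ℂ Y]
    (T : E ≃ₗ[ℂ] (ι → ℂ)) [Finite ι] (D : E →ₗ[ℂ] Module.End ℂ Y) (e : E) (he : IsUnit (D e)) :
    ∃ w : ι → ℕ, IsUnit (D (T.symm fun i => (w i : ℂ))) := by
  classical
  have := Fintype.ofFinite ι
  let b := Module.finBasis ℂ Y
  let m : ι → Matrix _ _ ℂ := fun i => LinearMap.toMatrix b b (D (T.symm (Pi.single i 1)))
  let F : MvPolynomial ι ℂ :=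
    Matrix.det (∑ i, (MvPolynomial.X i : MvPolynomial ι ℂ) • (m i).map MvPolynomial.C)
  have hF : ∀ w : ι → ℂ, MvPolynomial.eval w F = LinearMap.det (D (T.symm w)) := by
    intro w
    rw [← LinearMap.det_toMatrix b]
    simp only [F]
    rw [RingHom.map_det]
    congr 1
    have : T.symm w = ∑ i, w i • T.symm (Pi.single i 1) := by
      conv_lhs => rw [← Finset.univ_sum_single w, map_sum]
      refine Finset.sum_congr rfl fun i _ => ?_
      rw [← map_smul, ← Pi.single_smul, smul_eq_mul, mul_one]
    rw [this]
    simp only [map_sum, map_smul]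
    ext x y
    simp [Matrix.sum_apply, m]
  have hF0 : F ≠ 0 := by
    intro h0
    have := hF (T e)
    rw [h0, map_zero, LinearEquiv.symm_apply_apply] at this
    exact ((LinearMap.isUnit_iff_isUnit_det _).1 he).ne_zero this.symm
  by_contra hcon
  push Not at hcon
  apply hF0
  refine MvPolynomial.funext_set (fun _ => Set.range (Nat.cast : ℕ → ℂ))
    (fun _ => Set.infinite_range_of_injective Nat.cast_injective) fun x hx => ?_
  have hx' : ∀ i, ∃ n : ℕ, (n : ℂ) = x i := fun i => hx i (Set.mem_univ i)
  choose w hw using hx'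
  obtain rfl : (fun i => (w i : ℂ)) = x := funext hw
  rw [hF, map_zero]
  by_contra h
  exact hcon w ((LinearMap.isUnit_iff_isUnit_det _).2 (isUnit_iff_ne_zero.2 h))

/-- Parameter count: a tuple `t` such that `∑ t_j D_j` is killed by a surjection onto `Y` is
generated, over a field of definition of `Y`, by few elements. -/
lemma exists_generators_of_killed [FiniteDimensional ℂ X] [FiniteDimensional ℂ Y]
    (hgen : Algebra.adjoin ℂ (Set.range gen) = ⊤) {L : Subfield ℂ}
    (bX : Module.Basis ι ℂ X) (bY : Module.Basis κ ℂ Y)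
    (hX : IsRatBasis gen L bX) (hY : IsRatBasis gen L bY)
    {N ζ : Type} [Fintype N] [Fintype ζ] (bZ : Module.Basis ζ ℂ Z)
    (D : N → Z →ₗ[ℂ] X) (hD : ∀ j z i, bX.repr (D j (bZ z)) i ∈ L)
    (p : X →ₗ[A] Y) (hp : Function.Surjective p) (K : Submodule ℂ (N → ℂ))
    (hK : ∀ t, t ∈ K ↔ ∀ z, p (∑ j, t j • D j z) = 0) {t : N → ℂ} (ht : t ∈ K) :
    ∃ Λ : Finset ℂ, Λ.card + Module.finrank ℂ (Y →ₗ[A] Y) ≤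
        Module.finrank ℂ (X →ₗ[A] Y) + Module.finrank ℂ K ∧ ∀ j, t j ∈ L.adj Λ := by
  classical
  obtain ⟨J, _, a, c, hc, hform, hcard⟩ := exists_rational_coordinates L
    (Set.range fun q : G × κ × ι => fun r : κ × ι =>
      (if r.1 = q.2.1 then bX.repr (gen q.1 • bX q.2.2) r.2 else 0) -
      (if r.2 = q.2.2 then bY.repr (gen q.1 • bY r.1) q.2.1 else 0))
    (by
      rintro _ ⟨q, rfl⟩ r
      refine L.sub_mem ?_ ?_
      · split_ifs
        exacts [hX _ _ _, L.zero_mem]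
      · split_ifs
        exacts [hY _ _ _, L.zero_mem])
    (LinearMap.range (homEntries (A := A) bX bY))
    (by
      intro v
      rw [mem_range_homEntries hgen]
      simp only [Set.forall_mem_range, Prod.forall]
      refine forall_congr' fun g => forall_congr' fun k => forall_congr' fun i => ?_
      simp only [sub_mul, Finset.sum_sub_distrib, Fintype.sum_prod_type, ite_mul, zero_mul]
      rw [Finset.sum_comm]
      simp)
  rw [LinearMap.finrank_range_of_inj (homEntries_injective bX bY)] at hcard
  -- endomorphisms of `Y` inside `Hom(X,Y)`
  let comp : (Y →ₗ[A] Y) →ₗ[ℂ] (X →ₗ[A] Y) :=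
    { toFun := fun u => u ∘ₗ p
      map_add' := fun u v => by ext; simp
      map_smul' := fun c u => by ext; simp }
  have hcomp : Function.Injective comp := by
    intro u v h
    ext y
    obtain ⟨x, rfl⟩ := hp y
    exact LinearMap.congr_fun h x
  let f : (Y →ₗ[A] Y) →ₗ[ℂ] (J → ℂ) :=
    LinearMap.funLeft ℂ ℂ a ∘ₗ homEntries (A := A) bX bY ∘ₗ comp
  have hf : Function.Injective f := by
    rw [injective_iff_map_eq_zero]
    intro u hu
    apply hcomp
    apply homEntries_injective bX bY
    rw [map_zero, map_zero]
    funext q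
    rw [hform _ ⟨_, rfl⟩ q]
    refine Finset.sum_eq_zero fun j _ => ?_
    have : homEntries (A := A) bX bY (comp u) (a j) = 0 := congrFun hu j
    rw [this, mul_zero]
  obtain ⟨J', hJ', hbij⟩ := exists_bijective_coordinates f hf
  let T : (Y →ₗ[A] Y) ≃ₗ[ℂ] (J' → ℂ) :=
    LinearEquiv.ofBijective (LinearMap.funLeft ℂ ℂ (Subtype.val) ∘ₗ f) hbij
  obtain ⟨w, hw⟩ := exists_nat_isUnit T (LinearMap.restrictScalarsₗ ℂ A Y Y ℂ) LinearMap.id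
    (by exact isUnit_one)
  set u := T.symm fun i => (w i : ℂ) with hu
  have hTu : ∀ j : J', homEntries (A := A) bX bY (comp u) (a j) = w j := by
    intro j
    have := congrFun (T.apply_symm_apply fun i => (w i : ℂ)) j
    exact this
  have huinj : Function.Injective u := ((Module.End.isUnit_iff _).1 hw).1
  let m := homEntries (A := A) bX bY (comp u)
  let Λ₁ : Finset ℂ := (Finset.univ \ J').image fun j => m (a j)
  have hΛ₁ : Λ₁.card + Module.finrank ℂ (Y →ₗ[A] Y) ≤ Module.finrank ℂ (X →ₗ[A] Y) := by
    rw [← hJ', ← hcard, ← Finset.card_univ,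
      ← Finset.card_sdiff_add_card_eq_card (Finset.subset_univ J')]
    exact Nat.add_le_add_right Finset.card_image_le _
  have hm : ∀ q, m q ∈ L.adj Λ₁ := by
    intro q
    change homEntries (A := A) bX bY (comp u) q ∈ _
    rw [hform _ ⟨_, rfl⟩ q]
    refine Subfield.sum_mem _ fun j _ => Subfield.mul_mem _ (L.le_adj _ (hc _ _)) ?_
    by_cases hj : j ∈ J'
    · rw [hTu ⟨j, hj⟩]
      exact natCast_mem _ _
    · exact L.mem_adj_of_mem (Finset.mem_image_of_mem (fun j => m (a j)) (by simp [hj]))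
  -- solve for `t`
  obtain ⟨J₂, _, a₂, c₂, hc₂, hform₂, hcard₂⟩ := exists_rational_coordinates (L.adj Λ₁)
    (Set.range fun q : ζ × κ => fun j : N => ∑ i, bX.repr (D j (bZ q.1)) i * m (q.2, i))
    (by
      rintro _ ⟨q, rfl⟩ j
      exact Subfield.sum_mem _ fun i _ => Subfield.mul_mem _ (L.le_adj _ (hD _ _ _)) (hm _))
    K
    (by
      have hpm : ∀ x k, bY.repr (u (p x)) k = ∑ i, bX.repr x i * m (k, i) := by
        intro x k
        conv_lhs => rw [← bX.sum_repr x]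
        have : ∀ i, u (p (bX.repr x i • bX i)) = bX.repr x i • u (p (bX i)) := fun i => by
          rw [LinearMap.map_smul_of_tower, LinearMap.map_smul_of_tower]
        simp only [map_sum, this, map_smul, Finsupp.finsetSum_apply, Finsupp.smul_apply,
          smul_eq_mul]
        rfl
      intro v
      rw [hK]
      simp only [Set.forall_mem_range, Prod.forall]
      have h1 : (∀ z, p (∑ j, v j • D j z) = 0) ↔ ∀ z, u (p (∑ j, v j • D j (bZ z))) = 0 := by
        constructor
        · intro h z
          rw [h, map_zero]
        · intro h z
          have : (p.restrictScalars ℂ) ∘ₗ (∑ j, v j • D j) = 0 := by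
            refine bZ.ext fun z => ?_
            apply huinj
            simpa using h z
          simpa using LinearMap.congr_fun this z
      rw [h1]
      refine forall_congr' fun z => ?_
      rw [← bY.repr.map_eq_zero_iff, Finsupp.ext_iff]
      refine forall_congr' fun k => ?_
      rw [hpm]
      simp only [map_sum, map_smul, Finsupp.finsetSum_apply, Finsupp.smul_apply, smul_eq_mul,
        Finset.sum_mul, Finsupp.coe_zero, Pi.zero_apply]
      rw [Finset.sum_comm]
      exact Eq.congr (Finset.sum_congr rfl fun j _ => Finset.sum_congr rfl fun i _ => by ring) rfl)
  let Λ₂ : Finset ℂ := Finset.univ.image fun j => t (a₂ j)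
  refine ⟨Λ₁ ∪ Λ₂, ?_, fun j => L.adj_adj_le _ _ ?_⟩
  · have h1 := Finset.card_union_le Λ₁ Λ₂
    have h2 : Λ₂.card ≤ Module.finrank ℂ K := by
      rw [← hcard₂]
      exact Finset.card_image_le
    omega
  · rw [hform₂ t ht j]
    refine Subfield.sum_mem _ fun i _ => Subfield.mul_mem _
      (Subfield.le_adj _ _ (hc₂ _ _)) (Subfield.mem_adj_of_mem _ ?_)
    exact Finset.mem_image_of_mem (fun j => t (a₂ j)) (Finset.mem_univ i)

end Rational

section Wild

/-- Indecomposable modules, through idempotent endomorphisms. -/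
def Indec (A M : Type) [Ring A] [AddCommGroup M] [Module A M] : Prop :=
  Nontrivial M ∧ ∀ e : M →ₗ[A] M, e ∘ₗ e = e → e = 0 ∨ e = LinearMap.id

variable {A : Type} [Ring A] [Algebra ℂ A] {G : Type}

instance finiteDimensional_sub {M : Type} [AddCommGroup M] [Module ℂ M] [Module A M]
    [IsScalarTower ℂ A M] [FiniteDimensional ℂ M] (p : Submodule A M) : FiniteDimensional ℂ p :=
  FiniteDimensional.of_injective (p.subtype.restrictScalars ℂ) p.injective_subtype

instance finiteDimensional_quot {M : Type} [AddCommGroup M] [Module ℂ M] [Module A M]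
    [IsScalarTower ℂ A M] [FiniteDimensional ℂ M] (p : Submodule A M) :
    FiniteDimensional ℂ (M ⧸ p) :=
  Module.Finite.of_surjective (p.mkQ.restrictScalars ℂ) p.mkQ_surjective

lemma finrank_quot_le {M : Type} [AddCommGroup M] [Module ℂ M] [Module A M]
    [IsScalarTower ℂ A M] [FiniteDimensional ℂ M] (p : Submodule A M) :
    Module.finrank ℂ (M ⧸ p) ≤ Module.finrank ℂ M :=
  LinearMap.finrank_le_finrank_of_surjective (f := p.mkQ.restrictScalars ℂ) p.mkQ_surjective

/-- `M` is defined over an extension of `k` generated by at most `d` elements. -/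
def HasParameters (gen : G → A) (k : Subfield ℂ) (d : ℕ) (M : Type) [AddCommGroup M] [Module ℂ M]
    [Module A M] : Prop :=
  ∃ Λ : Finset ℂ, Λ.card ≤ d ∧ ∃ (ι : Type) (_ : Fintype ι) (b : Module.Basis ι ℂ M),
    IsRatBasis gen (k.adj Λ) b

lemma hasParameters_of_indec {gen : G → A} {k : Subfield ℂ}
    (h : ∀ (M : Type) [AddCommGroup M] [Module ℂ M] [Module A M] [IsScalarTower ℂ A M]
      [FiniteDimensional ℂ M], Indec A M → HasParameters gen k 1 M) (d : ℕ) :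
    ∀ (M : Type) [AddCommGroup M] [Module ℂ M] [Module A M] [IsScalarTower ℂ A M]
      [FiniteDimensional ℂ M], Module.finrank ℂ M = d → HasParameters gen k d M := by
  induction d using Nat.strong_induction_on with
  | _ d ih =>
    intro M _ _ _ _ _ hd
    rcases subsingleton_or_nontrivial M with hM | hM
    · refine ⟨∅, by simp, Empty, inferInstance, Module.Basis.empty M, fun g i => i.elim⟩
    by_cases hI : Indec A M
    · obtain ⟨Λ, hΛ, h'⟩ := h M hI
      have : 0 < Module.finrank ℂ M := Module.finrank_pos
      exact ⟨Λ, by omega, h'⟩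
    · have : ∃ e : M →ₗ[A] M, e ∘ₗ e = e ∧ e ≠ 0 ∧ e ≠ LinearMap.id := by
        by_contra hcon
        push Not at hcon
        refine hI ⟨hM, fun e he => ?_⟩
        by_contra h0
        push Not at h0
        exact h0.2 (hcon e he h0.1)
      obtain ⟨e, he, he0, he1⟩ := this
      have hc : IsCompl (LinearMap.range e) (LinearMap.ker e) :=
        LinearMap.IsIdempotentElem.isCompl (f := e) he
      let E := Submodule.prodEquivOfIsCompl _ _ hc
      have hfr : Module.finrank ℂ (LinearMap.range e) + Module.finrank ℂ (LinearMap.ker e)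
          = Module.finrank ℂ M := by
        rw [← Module.finrank_prod, (E.restrictScalars ℂ).finrank_eq]
      have h1 : 0 < Module.finrank ℂ (LinearMap.range e) := by
        have : Nontrivial (LinearMap.range e) := by
          rw [Submodule.nontrivial_iff_ne_bot]
          exact fun h => he0 (LinearMap.range_eq_bot.1 h)
        exact Module.finrank_pos
      have h2 : 0 < Module.finrank ℂ (LinearMap.ker e) := by
        have : Nontrivial (LinearMap.ker e) := by
          rw [Submodule.nontrivial_iff_ne_bot]
          intro h
          apply he1
          ext x
          apply LinearMap.ker_eq_bot.1 h
          exact LinearMap.congr_fun he x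
        exact Module.finrank_pos
      obtain ⟨Λ₁, hΛ₁, ι₁, _, b₁, hb₁⟩ := ih _ (by omega) (LinearMap.range e) rfl
      obtain ⟨Λ₂, hΛ₂, ι₂, _, b₂, hb₂⟩ := ih _ (by omega) (LinearMap.ker e) rfl
      classical
      refine ⟨Λ₁ ∪ Λ₂, (Finset.card_union_le _ _).trans (by omega), ι₁ ⊕ ι₂, inferInstance,
        (b₁.prod b₂).map (E.restrictScalars ℂ), ?_⟩
      intro g i j
      have hsm : E.symm (gen g • E ((b₁.prod b₂) j)) = gen g • ((b₁.prod b₂) j) := by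
        rw [← map_smul, LinearEquiv.symm_apply_apply]
      have hred : ((b₁.prod b₂).map (E.restrictScalars ℂ)).repr
          (gen g • ((b₁.prod b₂).map (E.restrictScalars ℂ)) j) i =
          (b₁.prod b₂).repr (gen g • ((b₁.prod b₂) j)) i := by
        rw [← hsm]; rfl
      rw [hred]
      rcases i with i | i <;> rcases j with j | j
      · simpa using Subfield.adj_mono le_rfl Finset.subset_union_left (hb₁ g i j)
      · simp
      · simp
      · simpa using Subfield.adj_mono le_rfl Finset.subset_union_right (hb₂ g i j)


/-- A linear subspace of a family of maps that factors through the range of one map is small. -/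
lemma finrank_killed_le {N X Z : Type} [Fintype N] [AddCommGroup X] [Module ℂ X]
    [FiniteDimensional ℂ X] [AddCommGroup Z] [Module ℂ Z] [FiniteDimensional ℂ Z]
    (D : N → Z →ₗ[ℂ] X) (hD : ∀ t : N → ℂ, (∀ z, ∑ j, t j • D j z = 0) → t = 0)
    (φ : Z →ₗ[ℂ] X) (K : Submodule ℂ (N → ℂ))
    (hK : ∀ t ∈ K, ∀ z, ∑ j, t j • D j z ∈ LinearMap.range φ) :
    Module.finrank ℂ K ≤ Module.finrank ℂ Z * Module.finrank ℂ Z := by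
  obtain ⟨s, hs⟩ := φ.rangeRestrict.exists_rightInverse_of_surjective
    (LinearMap.range_rangeRestrict φ)
  obtain ⟨g, hg⟩ := s.exists_extend
  have hφg : ∀ x ∈ LinearMap.range φ, φ (g x) = x := by
    intro x hx
    have h1 : g x = s ⟨x, hx⟩ := LinearMap.congr_fun hg ⟨x, hx⟩
    rw [h1]
    exact congrArg Subtype.val (LinearMap.congr_fun hs ⟨x, hx⟩)
  let θ : (N → ℂ) →ₗ[ℂ] (Z →ₗ[ℂ] Z) := Fintype.linearCombination ℂ fun j => g ∘ₗ D j
  have hθ : ∀ t' z, θ t' z = g (∑ j, t' j • D j z) := by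
    intro t' z
    simp [θ, Fintype.linearCombination_apply, LinearMap.sum_apply]
  have hinj : Function.Injective (θ ∘ₗ K.subtype) := by
    rw [injective_iff_map_eq_zero]
    rintro ⟨t', ht'⟩ h0
    refine Subtype.ext (hD t' fun z => ?_)
    rw [← hφg _ (hK t' ht' z), ← hθ]
    have : θ t' z = 0 := LinearMap.congr_fun h0 z
    rw [this, map_zero]
  have h1 := LinearMap.finrank_le_finrank_of_injective hinj
  rwa [Module.finrank_linearMap] at h1

lemma finrank_hom_quotient_le {X Z ι : Type} [Fintype ι] [AddCommGroup X] [Module ℂ X] [Module A X]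
    [IsScalarTower ℂ A X] [FiniteDimensional ℂ X] [AddCommGroup Z] [Module ℂ Z] [Module A Z]
    [IsScalarTower ℂ A Z] [FiniteDimensional ℂ Z] (φ : Z →ₗ[A] X)
    (c : (X →ₗ[A] X) →ₗ[ℂ] (ι → ℂ)) (hc : ∀ Ψ, c Ψ = 0 → Ψ ∘ₗ φ = 0)
    (hlift : ∀ ψ : X →ₗ[A] X ⧸ LinearMap.range φ, ∃ Ψ : X →ₗ[A] X,
      (LinearMap.range φ).mkQ ∘ₗ Ψ = ψ) :
    Module.finrank ℂ (X →ₗ[A] X ⧸ LinearMap.range φ) ≤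
      Module.finrank ℂ ((X ⧸ LinearMap.range φ) →ₗ[A] X ⧸ LinearMap.range φ) +
        Fintype.card ι := by
  let π := (LinearMap.range φ).mkQ
  let comp : ((X ⧸ LinearMap.range φ) →ₗ[A] X ⧸ LinearMap.range φ) →ₗ[ℂ]
      (X →ₗ[A] X ⧸ LinearMap.range φ) :=
    { toFun := fun u => u ∘ₗ π
      map_add' := fun u v => LinearMap.add_comp _ _ _
      map_smul' := fun c u => LinearMap.ext fun x => rfl }
  let post : (X →ₗ[A] X) →ₗ[ℂ] (X →ₗ[A] X ⧸ LinearMap.range φ) :=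
    { toFun := fun u => π ∘ₗ u
      map_add' := fun u v => LinearMap.comp_add _ _ _
      map_smul' := fun c u => LinearMap.ext fun x => LinearMap.map_smul_of_tower π c (u x) }
  let E := LinearMap.range comp
  let Θ := E.mkQ ∘ₗ post
  have hΘ : Function.Surjective Θ := (Submodule.mkQ_surjective E).comp fun ψ => hlift ψ
  have hker : LinearMap.ker c ≤ LinearMap.ker Θ := by
    intro Ψ hΨ
    have h1 := hc Ψ hΨ
    refine (Submodule.Quotient.mk_eq_zero _).2 ⟨(LinearMap.range φ).liftQ (π ∘ₗ Ψ) ?_, ?_⟩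
    · rintro _ ⟨z, rfl⟩
      have : Ψ (φ z) = 0 := LinearMap.congr_fun h1 z
      simp [this]
    · exact LinearMap.ext fun x => rfl
  have e1 := Submodule.finrank_quotient_add_finrank E
  have e2 := LinearMap.finrank_range_add_finrank_ker Θ
  rw [LinearMap.range_eq_top.2 hΘ, finrank_top] at e2
  have e3 := LinearMap.finrank_range_add_finrank_ker c
  have e4 := Submodule.finrank_mono hker
  have e5 : Module.finrank ℂ (LinearMap.range c) ≤ Fintype.card ι := by
    refine (Submodule.finrank_le _).trans ?_
    simp
  have e6 := LinearMap.finrank_range_le comp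
  change Module.finrank ℂ E ≤ _ at e6
  omega

set_option maxHeartbeats 2000000 in
/-- A module with many orthogonal maps to it from a fixed module, along which extensions lift,
produces families with too many parameters. -/
lemma false_of_orthogonal_maps [Finite G] {gen : G → A}
    (hgen : Algebra.adjoin ℂ (Set.range gen) = ⊤) {k : Subfield ℂ} (hk : (k : Set ℂ).Countable)
    (hT : ∀ (M : Type) [AddCommGroup M] [Module ℂ M] [Module A M] [IsScalarTower ℂ A M]
      [FiniteDimensional ℂ M], HasParameters gen k (Module.finrank ℂ M) M)
    {b r : ℕ} (hr : r = 4 * b ^ 2 + 1)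
    (M : Fin r → Type) [∀ i, AddCommGroup (M i)] [∀ i, Module ℂ (M i)] [∀ i, Module A (M i)]
    [∀ i, IsScalarTower ℂ A (M i)] [∀ i, FiniteDimensional ℂ (M i)]
    {Z : Type} [AddCommGroup Z] [Module ℂ Z] [Module A Z] [IsScalarTower ℂ A Z]
    [FiniteDimensional ℂ Z] (hM : ∀ i, Module.finrank ℂ (M i) ≤ b) (hZ : Module.finrank ℂ Z ≤ b)
    (v : ∀ i, Z →ₗ[A] M i) (hv : ∀ i, v i ≠ 0)
    (hne : ∀ i j, i ≠ j → ∀ g : M i →ₗ[A] M j, g ∘ₗ v i = 0)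
    (hend : ∀ i, ∀ g : M i →ₗ[A] M i, ∃ c : ℂ, g ∘ₗ v i = c • v i)
    (hlift : ∀ (n m : ℕ) (φ : (Fin m → Z) →ₗ[A] (∀ q : Fin r × Fin n, M q.1))
      (ψ : (∀ q : Fin r × Fin n, M q.1) →ₗ[A] (∀ q : Fin r × Fin n, M q.1) ⧸ LinearMap.range φ),
      ∃ Ψ : (∀ q : Fin r × Fin n, M q.1) →ₗ[A] (∀ q : Fin r × Fin n, M q.1),
        (LinearMap.range φ).mkQ ∘ₗ Ψ = ψ) : False := by
  classical
  obtain ⟨n, hn⟩ : ∃ n, n = r * b + 1 := ⟨_, rfl⟩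
  obtain ⟨m, hm⟩ : ∃ m, m = 2 * n := ⟨_, rfl⟩
  let D : Fin r × Fin n × Fin m → (Fin m → Z) →ₗ[A] (∀ q : Fin r × Fin n, M q.1) := fun j =>
    LinearMap.single A (fun q : Fin r × Fin n => M q.1) (j.1, j.2.1) ∘ₗ v j.1 ∘ₗ
      LinearMap.proj j.2.2
  have hDapp : ∀ j z, D j z = Pi.single (j.1, j.2.1) (v j.1 (z j.2.2)) := fun j z => rfl
  clear_value D
  let bX := Module.finBasis ℂ (∀ q : Fin r × Fin n, M q.1)
  let bZ := Module.finBasis ℂ (Fin m → Z)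
  let L₀ : Subfield ℂ := Subfield.closure ((k : Set ℂ) ∪
    (Set.range fun q : G × _ × _ => bX.repr (gen q.1 • bX q.2.1) q.2.2) ∪
    (Set.range fun q : (Fin r × Fin n × Fin m) × _ × _ => bX.repr (D q.1 (bZ q.2.1)) q.2.2))
  have hL₀ : (L₀ : Set ℂ).Countable := countable_closure_subfield
    ((hk.union (Set.countable_range _)).union (Set.countable_range _))
  have hkL : k ≤ L₀ := fun x hx => Subfield.subset_closure (Or.inl (Or.inl hx))
  have hL1 : ∀ g i j, bX.repr (gen g • bX j) i ∈ L₀ := fun g i j =>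
    Subfield.subset_closure (Or.inl (Or.inr ⟨(g, j, i), rfl⟩))
  have hL2 : ∀ j z i, bX.repr (D j (bZ z)) i ∈ L₀ := fun j z i =>
    Subfield.subset_closure (Or.inr ⟨(j, z, i), rfl⟩)
  clear_value bX bZ L₀
  obtain ⟨t, ht⟩ := exists_algebraicIndependent (Fin r × Fin n × Fin m) hL₀
  let φ : (Fin m → Z) →ₗ[A] (∀ q : Fin r × Fin n, M q.1) := ∑ j, t j • D j
  have hφ : ∀ z, φ z = ∑ j, t j • D j z := fun z => by
    simp only [φ, LinearMap.sum_apply, LinearMap.smul_apply]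
  clear_value φ
  obtain ⟨Λ₀, hΛ₀, κ, _, bY, hbY⟩ := hT ((∀ q : Fin r × Fin n, M q.1) ⧸ LinearMap.range φ)
  let K : Submodule ℂ (Fin r × Fin n × Fin m → ℂ) :=
    LinearMap.ker (Fintype.linearCombination ℂ (fun j => (LinearMap.range φ).mkQ ∘ₗ D j))
  have hKmem : ∀ t', t' ∈ K ↔ ∀ z, (LinearMap.range φ).mkQ (∑ j, t' j • D j z) = 0 := by
    intro t'
    simp only [K, LinearMap.mem_ker, Fintype.linearCombination_apply, LinearMap.ext_iff]
    refine forall_congr' fun z => ?_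
    rw [map_sum, LinearMap.sum_apply]
    simp only [LinearMap.smul_apply, LinearMap.comp_apply, LinearMap.map_smul_of_tower,
      LinearMap.zero_apply]
  clear_value K
  obtain ⟨Λ₁, hΛ₁, htΛ⟩ := exists_generators_of_killed (L := L₀.adj Λ₀) hgen bX bY
    (fun g i j => L₀.le_adj _ (hL1 g i j))
    (hbY.mono (Subfield.adj_mono hkL subset_rfl)) bZ (fun j => (D j).restrictScalars ℂ)
    (fun j z i => L₀.le_adj _ (hL2 j z i))
    (LinearMap.range φ).mkQ (Submodule.mkQ_surjective _) K hKmem (t := t) (by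
      rw [hKmem]
      intro z
      rw [← hφ]
      exact (Submodule.Quotient.mk_eq_zero _).2 ⟨z, rfl⟩)
  have hN := card_le_card_of_algebraicIndependent L₀ ht (Λ := Λ₀ ∪ Λ₁)
    (fun j => L₀.adj_adj_le _ _ (htΛ j))
  have hNcard : Fintype.card (Fin r × Fin n × Fin m) = r * (n * m) := by simp
  have hX : Module.finrank ℂ (∀ q : Fin r × Fin n, M q.1) ≤ r * n * b := by
    rw [Module.finrank_pi_fintype]
    have h1 : ∀ q ∈ (Finset.univ : Finset (Fin r × Fin n)), Module.finrank ℂ (M q.1) ≤ b :=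
      fun q _ => hM q.1
    have h2 := Finset.sum_le_sum h1
    rwa [Finset.sum_const, Finset.card_univ, Fintype.card_prod, Fintype.card_fin,
      Fintype.card_fin, smul_eq_mul] at h2
  have hYX : Module.finrank ℂ ((∀ q : Fin r × Fin n, M q.1) ⧸ LinearMap.range φ) ≤
      Module.finrank ℂ (∀ q : Fin r × Fin n, M q.1) :=
    finrank_quot_le _
  have hZm : Module.finrank ℂ (Fin m → Z) ≤ m * b := by
    rw [Module.finrank_pi_fintype, Finset.sum_const, Finset.card_fin, smul_eq_mul]
    exact Nat.mul_le_mul_left m hZ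
  have hind : ∀ t' : Fin r × Fin n × Fin m → ℂ, (∀ z, ∑ j, t' j • D j z = 0) → t' = 0 := by
    intro t' h1
    ext ⟨i, a, c⟩
    obtain ⟨z₀, hz₀⟩ : ∃ z, v i z ≠ 0 := by
      by_contra hcon
      push Not at hcon
      exact hv i (LinearMap.ext hcon)
    have h3 := congrFun (h1 (Pi.single c z₀)) (i, a)
    simp only [hDapp] at h3
    rw [Finset.sum_apply, Finset.sum_eq_single (i, a, c)] at h3
    · simpa [hz₀] using h3
    · rintro ⟨i', a', c'⟩ - hne'
      rw [Pi.smul_apply]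
      by_cases hia : (i, a) = (i', a')
      · obtain ⟨rfl, rfl⟩ := Prod.ext_iff.1 hia
        have : c' ≠ c := fun h => hne' (by rw [h])
        simp [this]
      · rw [Pi.single_eq_of_ne hia, smul_zero]
    · simp
  have hkill : ∀ t' ∈ K, ∀ z, ∑ j, t' j • D j z ∈ LinearMap.range φ := by
    intro t' ht' z
    have := (hKmem t').1 ht' z
    rwa [Submodule.mkQ_apply, Submodule.Quotient.mk_eq_zero] at this
  have hKdim : Module.finrank ℂ K ≤ (m * b) * (m * b) :=
    (finrank_killed_le (fun j => (D j).restrictScalars ℂ) hind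
      (φ.restrictScalars ℂ) K hkill).trans (Nat.mul_le_mul hZm hZm)
  obtain ⟨c, hc⟩ : ∃ c : ((∀ q : Fin r × Fin n, M q.1) →ₗ[A] (∀ q : Fin r × Fin n, M q.1)) →ₗ[ℂ]
      (Fin r × Fin n × Fin n → ℂ), ∀ Ψ, c Ψ = 0 → Ψ ∘ₗ φ = 0 := by
    have hξ : ∀ i, ∃ ξ : Module.Dual ℂ (Z →ₗ[A] M i), ξ (v i) = 1 := by
      intro i
      have : ∃ ξ : Module.Dual ℂ (Z →ₗ[A] M i), ξ (v i) ≠ 0 := by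
        by_contra hcon
        push Not at hcon
        exact hv i ((Module.forall_dual_apply_eq_zero_iff ℂ _).1 hcon)
      obtain ⟨ξ, hξ⟩ := this
      exact ⟨(ξ (v i))⁻¹ • ξ, by simp [hξ]⟩
    choose ξ hξ using hξ
    let c : ((∀ q : Fin r × Fin n, M q.1) →ₗ[A] (∀ q : Fin r × Fin n, M q.1)) →ₗ[ℂ]
        (Fin r × Fin n × Fin n → ℂ) :=
      { toFun := fun Ψ q => ξ q.1 (
          (LinearMap.proj (φ := fun q : Fin r × Fin n => M q.1) (q.1, q.2.2)) ∘ₗ Ψ ∘ₗ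
            LinearMap.single A (fun q : Fin r × Fin n => M q.1) (q.1, q.2.1) ∘ₗ v q.1)
        map_add' := fun Ψ Ψ' => funext fun q => by
          exact (ξ q.1).map_add
            (LinearMap.proj (φ := fun q : Fin r × Fin n => M q.1) (q.1, q.2.2) ∘ₗ Ψ ∘ₗ
              LinearMap.single A (fun q : Fin r × Fin n => M q.1) (q.1, q.2.1) ∘ₗ v q.1)
            (LinearMap.proj (φ := fun q : Fin r × Fin n => M q.1) (q.1, q.2.2) ∘ₗ Ψ' ∘ₗ
              LinearMap.single A (fun q : Fin r × Fin n => M q.1) (q.1, q.2.1) ∘ₗ v q.1)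
        map_smul' := fun a Ψ => funext fun q => by
          exact (ξ q.1).map_smul a ((LinearMap.proj (φ := fun q : Fin r × Fin n => M q.1) (q.1, q.2.2))
            ∘ₗ Ψ ∘ₗ LinearMap.single A (fun q : Fin r × Fin n => M q.1) (q.1, q.2.1) ∘ₗ v q.1) }
    refine ⟨c, ?_⟩
    intro Ψ hΨ
    have h1 : ∀ (i : Fin r) (q : Fin n), Ψ ∘ₗ
        LinearMap.single A (fun q : Fin r × Fin n => M q.1) (i, q) ∘ₗ v i = 0 := by
      intro i q
      refine LinearMap.ext fun z => funext ?_
      rintro ⟨j, q'⟩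
      by_cases hij : i = j
      · subst hij
        obtain ⟨e, he⟩ := hend i ((LinearMap.proj (φ := fun q : Fin r × Fin n => M q.1) (i, q'))
          ∘ₗ Ψ ∘ₗ LinearMap.single A (fun q : Fin r × Fin n => M q.1) (i, q))
        have h3 : ξ i (((LinearMap.proj (φ := fun q : Fin r × Fin n => M q.1) (i, q'))
          ∘ₗ Ψ ∘ₗ LinearMap.single A (fun q : Fin r × Fin n => M q.1) (i, q)) ∘ₗ v i) = 0 :=
          congrFun hΨ (i, q, q')
        rw [he, map_smul, hξ, smul_eq_mul, mul_one] at h3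
        rw [h3, zero_smul] at he
        exact LinearMap.congr_fun he z
      · exact LinearMap.congr_fun (hne i j hij
          ((LinearMap.proj (φ := fun q : Fin r × Fin n => M q.1) (j, q'))
          ∘ₗ Ψ ∘ₗ LinearMap.single A (fun q : Fin r × Fin n => M q.1) (i, q))) z
    refine LinearMap.ext fun z => ?_
    rw [LinearMap.comp_apply, hφ, map_sum]
    refine Finset.sum_eq_zero fun j _ => ?_
    rw [LinearMap.map_smul_of_tower, hDapp]
    have : Ψ (Pi.single (j.1, j.2.1) (v j.1 (z j.2.2))) = 0 :=
      LinearMap.congr_fun (h1 j.1 j.2.1) (z j.2.2)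
    rw [this, smul_zero]
  have hHom := finrank_hom_quotient_le φ c hc (hlift n m φ)
  have hcard : Fintype.card (Fin r × Fin n × Fin n) = r * (n * n) := by simp
  have hU := Finset.card_union_le Λ₀ Λ₁
  have hfin : r * (n * m) ≤ r * n * b + r * (n * n) + (m * b) * (m * b) := by
    rw [← hNcard]
    have h1 := hΛ₀.trans (hYX.trans hX)
    omega
  rw [hm] at hfin
  have h6 : r * (n * n) = 4 * (b ^ 2 * (n * n)) + n * n := by rw [hr]; ring
  have h7 : r * (n * (2 * n)) = 2 * (r * (n * n)) := by ring
  have h8 : 2 * n * b * (2 * n * b) = 4 * (b ^ 2 * (n * n)) := by ring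
  have h9 : n * n = r * n * b + n := by
    conv_lhs => rw [hn]
    rw [hn]; ring
  omega

end Wild

section Family

set_option linter.unusedSectionVars false

variable {A : Type} [Ring A] [Algebra ℂ A]

/-- The lifting property against surjections of finite-dimensional modules. -/
def HasLifting (A P : Type) [Ring A] [Algebra ℂ A] [AddCommGroup P] [Module A P] : Prop :=
  ∀ (M N : Type) [AddCommGroup M] [Module ℂ M] [Module A M] [IsScalarTower ℂ A M]
    [FiniteDimensional ℂ M] [AddCommGroup N] [Module ℂ N] [Module A N] [IsScalarTower ℂ A N]
    [FiniteDimensional ℂ N] (g : M →ₗ[A] N), Function.Surjective g → ∀ f : P →ₗ[A] N,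
    ∃ h : P →ₗ[A] M, g ∘ₗ h = f

lemma exists_factor {P M X : Type} [AddCommGroup P] [Module A P] [AddCommGroup M] [Module A M]
    [AddCommGroup X] [Module A X] (p : P →ₗ[A] M) (hp : Function.Surjective p) (l : P →ₗ[A] X)
    (h : ∀ x, p x = 0 → l x = 0) : ∃ u : M →ₗ[A] X, u ∘ₗ p = l := by
  refine ⟨(LinearMap.ker p).liftQ l h ∘ₗ (p.quotKerEquivOfSurjective hp).symm.toLinearMap, ?_⟩
  ext x
  have : (p.quotKerEquivOfSurjective hp).symm (p x) = (LinearMap.ker p).mkQ x := by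
    rw [LinearEquiv.symm_apply_eq]; rfl
  simp only [LinearMap.comp_apply, LinearEquiv.coe_coe, this]
  rfl

lemma exists_lift_of_presentations {ι κ Z P₀ P₁ X : Type} [Fintype ι] [DecidableEq ι] [Fintype κ]
    [AddCommGroup P₀] [Module A P₀] [AddCommGroup P₁] [Module A P₁]
    [AddCommGroup Z] [Module ℂ Z] [Module A Z] [IsScalarTower ℂ A Z] [FiniteDimensional ℂ Z]
    [AddCommGroup X] [Module ℂ X] [Module A X] [IsScalarTower ℂ A X] [FiniteDimensional ℂ X]
    (hP₀ : HasLifting A P₀) (hP₁ : HasLifting A P₁)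
    (M : ι → Type) [∀ i, AddCommGroup (M i)] [∀ i, Module A (M i)]
    (f : ι → P₁ →ₗ[A] P₀) (p : ∀ i, P₀ →ₗ[A] M i) (hp : ∀ i, Function.Surjective (p i))
    (hfp : ∀ i x, p i x = 0 ↔ ∃ y, f i y = x)
    (hfac : ∀ i (u : P₁ →ₗ[A] Z), ∃ w : P₀ →ₗ[A] Z, w ∘ₗ f i = u)
    (φ : (κ → Z) →ₗ[A] X) (ψ : (∀ i, M i) →ₗ[A] X ⧸ LinearMap.range φ) :
    ∃ Ψ : (∀ i, M i) →ₗ[A] X, (LinearMap.range φ).mkQ ∘ₗ Ψ = ψ := by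
  have key : ∀ i, ∃ Ψ : M i →ₗ[A] X,
      (LinearMap.range φ).mkQ ∘ₗ Ψ = ψ ∘ₗ LinearMap.single A M i := by
    intro i
    obtain ⟨l, hl⟩ := hP₀ X (X ⧸ LinearMap.range φ) (LinearMap.range φ).mkQ
      (Submodule.mkQ_surjective _) (ψ ∘ₗ LinearMap.single A M i ∘ₗ p i)
    have hl' : ∀ y, l (f i y) ∈ LinearMap.range φ := by
      intro y
      rw [← Submodule.Quotient.mk_eq_zero]
      have h1 : p i (f i y) = 0 := (hfp i _).2 ⟨y, rfl⟩
      have h2 := LinearMap.congr_fun hl (f i y)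
      simp only [LinearMap.comp_apply, h1, map_zero] at h2
      exact h2
    obtain ⟨μ, hμ⟩ := hP₁ (κ → Z) (LinearMap.range φ) φ.rangeRestrict
      φ.surjective_rangeRestrict ((l ∘ₗ f i).codRestrict _ hl')
    choose ν hν using fun c => hfac i (LinearMap.proj c ∘ₗ μ)
    obtain ⟨Ψ, hΨ⟩ := exists_factor (p i) (hp i) (l - φ ∘ₗ LinearMap.pi ν) (by
      intro x hx
      obtain ⟨y, rfl⟩ := (hfp i x).1 hx
      have h1 : LinearMap.pi ν (f i y) = μ y := by
        ext c
        exact LinearMap.congr_fun (hν c) y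
      have h2 : φ (μ y) = l (f i y) := congrArg Subtype.val (LinearMap.congr_fun hμ y)
      simp [h1, h2])
    refine ⟨Ψ, LinearMap.ext fun x => ?_⟩
    obtain ⟨z, rfl⟩ := hp i x
    have h1 : Ψ (p i z) = l z - φ (LinearMap.pi ν z) := LinearMap.congr_fun hΨ z
    have h2 := LinearMap.congr_fun hl z
    simp only [LinearMap.comp_apply] at h2 ⊢
    rw [h1, map_sub, h2, sub_eq_self]
    exact (Submodule.Quotient.mk_eq_zero _).2 ⟨_, rfl⟩
  choose Ψ hΨ using key
  refine ⟨∑ i, Ψ i ∘ₗ LinearMap.proj i, ?_⟩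
  refine LinearMap.pi_ext' fun i => ?_
  rw [← hΨ i]
  refine LinearMap.ext fun x => ?_
  simp only [LinearMap.comp_apply, LinearMap.sum_apply, LinearMap.proj_apply]
  congr 1
  rw [Finset.sum_eq_single i]
  · simp
  · intro j _ hj
    simp [hj]
  · simp

variable {X Y Z : Type} [AddCommGroup X] [Module ℂ X] [Module A X] [IsScalarTower ℂ A X]
  [FiniteDimensional ℂ X] [AddCommGroup Y] [Module ℂ Y] [Module A Y] [IsScalarTower ℂ A Y]
  [FiniteDimensional ℂ Y] [AddCommGroup Z] [Module ℂ Z] [Module A Z] [IsScalarTower ℂ A Z]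
  [FiniteDimensional ℂ Z]

lemma Indec.eq_bot_or_eq_bot (hY : Indec A Y) {p q : Submodule A Y} (h : IsCompl p q) :
    p = ⊥ ∨ q = ⊥ := by
  have hfix : ∀ x : p, (p.projectionOnto q h x : Y) = x := fun x => by simp
  rcases hY.2 (p.subtype ∘ₗ p.projectionOnto q h) (by ext x; simp) with h0 | h1
  · left
    rw [Submodule.eq_bot_iff]
    intro x hx
    exact (hfix ⟨x, hx⟩).symm.trans (LinearMap.congr_fun h0 x)
  · right
    rw [Submodule.eq_bot_iff]
    intro x hx
    have h2 := LinearMap.congr_fun h1 x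
    rw [LinearMap.comp_apply, (Submodule.projectionOnto_apply_eq_zero_iff h).2 hx] at h2
    simpa using h2.symm

/-- The rank over `ℂ` of a homomorphism of modules. -/
def rk (f : X →ₗ[A] Y) : ℕ := Module.finrank ℂ (LinearMap.range (f.restrictScalars ℂ))

lemma rk_comp_le_left (u : Y →ₗ[A] Z) (f : X →ₗ[A] Y) : rk (u ∘ₗ f) ≤ rk u :=
  Submodule.finrank_mono (by rintro _ ⟨x, rfl⟩; exact ⟨f x, rfl⟩)

lemma rk_comp_le_right (u : Y →ₗ[A] Z) (f : X →ₗ[A] Y) : rk (u ∘ₗ f) ≤ rk f := by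
  unfold rk
  have : LinearMap.range ((u ∘ₗ f).restrictScalars ℂ) =
      (LinearMap.range (f.restrictScalars ℂ)).map (u.restrictScalars ℂ) := by
    rw [← LinearMap.range_comp]; rfl
  rw [this]
  exact Submodule.finrank_map_le _ _

lemma rk_le (f : X →ₗ[A] Y) : rk f ≤ Module.finrank ℂ X := LinearMap.finrank_range_le _

lemma eq_zero_of_rk_eq_zero {f : X →ₗ[A] Y} (h : rk f = 0) : f = 0 := by
  have := Submodule.finrank_eq_zero.1 h
  rw [LinearMap.range_eq_bot] at this
  exact LinearMap.ext fun x => LinearMap.congr_fun this x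

lemma Indec.injective_and_surjective (hY : Indec A Y) (f : X →ₗ[A] Y) (u : Y →ₗ[A] Z)
    (h0 : rk (u ∘ₗ f) ≠ 0) (h1 : rk (u ∘ₗ f) = rk f) (h2 : rk (u ∘ₗ f) = rk u) :
    Function.Injective u ∧ Function.Surjective f := by
  have hr : LinearMap.range ((u ∘ₗ f).restrictScalars ℂ) =
      LinearMap.range (u.restrictScalars ℂ) :=
    Submodule.eq_of_le_of_finrank_eq (by rintro _ ⟨x, rfl⟩; exact ⟨f x, rfl⟩) h2
  have hinj : ∀ x, u (f x) = 0 → f x = 0 := by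
    let w := (u.restrictScalars ℂ) ∘ₗ (LinearMap.range (f.restrictScalars ℂ)).subtype
    have hw : LinearMap.range w = LinearMap.range ((u ∘ₗ f).restrictScalars ℂ) := by
      rw [LinearMap.range_comp, Submodule.range_subtype, ← LinearMap.range_comp]; rfl
    have e := LinearMap.finrank_range_add_finrank_ker w
    rw [hw] at e
    unfold rk at h1
    have hk : LinearMap.ker w = ⊥ := Submodule.finrank_eq_zero.1 (by omega)
    intro x hx
    have : (⟨f x, ⟨x, rfl⟩⟩ : LinearMap.range (f.restrictScalars ℂ)) ∈ LinearMap.ker w := hx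
    rw [hk, Submodule.mem_bot] at this
    exact congrArg Subtype.val this
  have hc : IsCompl (LinearMap.range f) (LinearMap.ker u) := by
    constructor
    · rw [Submodule.disjoint_def]
      rintro _ ⟨x, rfl⟩ hx
      exact hinj x hx
    · rw [codisjoint_iff_le_sup]
      intro y _
      have : u y ∈ LinearMap.range ((u ∘ₗ f).restrictScalars ℂ) := by rw [hr]; exact ⟨y, rfl⟩
      obtain ⟨x, hx⟩ := this
      have hx' : u (f x) = u y := hx
      refine Submodule.mem_sup.2 ⟨f x, ⟨x, rfl⟩, y - f x, ?_, by abel⟩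
      rw [LinearMap.mem_ker, map_sub, hx', sub_self]
  rcases hY.eq_bot_or_eq_bot hc with h | h
  · exfalso
    apply h0
    have : u ∘ₗ f = 0 := by rw [LinearMap.range_eq_bot.1 h, LinearMap.comp_zero]
    rw [this]
    exact Submodule.finrank_eq_zero.2 (LinearMap.range_eq_bot.2 rfl)
  · refine ⟨LinearMap.ker_eq_bot.1 h, LinearMap.range_eq_top.1 ?_⟩
    have := hc.sup_eq_top
    rwa [h, sup_bot_eq] at this

variable {ι : Type} {M : ι → Type} [∀ i, AddCommGroup (M i)] [∀ i, Module ℂ (M i)]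
  [∀ i, Module A (M i)] [∀ i, IsScalarTower ℂ A (M i)] [∀ i, FiniteDimensional ℂ (M i)]

variable (A M) in
/-- Composites of `n` non-isomorphisms between members of a family of modules. -/
inductive Chain : ℕ → ∀ i j, (M i →ₗ[A] M j) → Prop
  | nil (i) : Chain 0 i i LinearMap.id
  | cons {n i j k} {g : M i →ₗ[A] M j} (hg : Chain n i j g) (h : M j →ₗ[A] M k)
      (hh : ¬ Function.Bijective h) : Chain (n + 1) i k (h ∘ₗ g)


lemma Chain.split {m n : ℕ} {i k : ι} {g : M i →ₗ[A] M k} (h : Chain A M (m + n) i k g) :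
    ∃ (j : ι) (g₁ : M i →ₗ[A] M j) (g₂ : M j →ₗ[A] M k),
      Chain A M m i j g₁ ∧ Chain A M n j k g₂ ∧ g = g₂ ∘ₗ g₁ := by
  induction n generalizing k with
  | zero => exact ⟨k, g, LinearMap.id, h, .nil k, rfl⟩
  | succ n ih =>
    cases h with
    | cons hg h hh =>
      obtain ⟨j, g₁, g₂, h₁, h₂, rfl⟩ := ih hg
      exact ⟨j, g₁, h ∘ₗ g₂, h₁, .cons h₂ h hh, rfl⟩

/-- The Harada–Sai bound on ranks of composites of non-isomorphisms. -/
lemma Chain.rk_eq_zero_or {b : ℕ} (hI : ∀ i, Indec A (M i))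
    (hb : ∀ i, Module.finrank ℂ (M i) ≤ b) (n : ℕ) :
    ∀ {i j : ι} {g : M i →ₗ[A] M j}, Chain A M (2 ^ n - 1) i j g → rk g = 0 ∨ rk g + n ≤ b := by
  induction n with
  | zero => exact fun {i j g} _ => Or.inr ((rk_le g).trans (hb i))
  | succ n ih =>
    intro i l g hg
    have hlen : 2 ^ (n + 1) - 1 = (2 ^ n - 1) + 1 + (2 ^ n - 1) := by
      have := Nat.one_le_two_pow (n := n)
      rw [pow_succ]; omega
    rw [hlen] at hg
    obtain ⟨k, fg, h, hfg, hh, rfl⟩ := hg.split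
    cases hfg with
    | @cons _ _ j _ f hf g hgb =>
      by_contra hcon
      push Not at hcon
      obtain ⟨h0, h1⟩ := hcon
      have e1 := ih hf
      have e2 := ih hh
      have l1 := rk_comp_le_right h (g ∘ₗ f)
      have l2 := rk_comp_le_left h (g ∘ₗ f)
      have l3 := rk_comp_le_right g f
      have l4 := rk_comp_le_left (h ∘ₗ g) f
      have l5 := rk_comp_le_left h g
      rw [LinearMap.comp_assoc] at l4
      have r1 := (hI j).injective_and_surjective f (h ∘ₗ g)
        (by rw [LinearMap.comp_assoc]; exact h0) (by rw [LinearMap.comp_assoc]; omega)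
        (by rw [LinearMap.comp_assoc]; omega)
      have r2 := (hI k).injective_and_surjective (g ∘ₗ f) h h0 (by omega) (by omega)
      exact hgb ⟨Function.Injective.of_comp (f := h) r1.1, Function.Surjective.of_comp (g := f) r2.2⟩

lemma Chain.eq_zero {b : ℕ} (hI : ∀ i, Indec A (M i)) (hb : ∀ i, Module.finrank ℂ (M i) ≤ b)
    {i j : ι} {g : M i →ₗ[A] M j} (h : Chain A M (2 ^ b - 1) i j g) : g = 0 := by
  apply eq_zero_of_rk_eq_zero
  have := h.rk_eq_zero_or hI hb
  omega

lemma exists_socle_or_chain [DecidableEq ι] (Z : Type) [AddCommGroup Z] [Module A Z] (r L : ℕ) :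
    ∀ T : Finset ι, r * L < T.card →
      (∃ S ⊆ T, r ≤ S.card ∧ ∀ i ∈ S, ∃ v : Z →ₗ[A] M i, v ≠ 0 ∧ ∀ j ∈ S, ∀ g : M i →ₗ[A] M j,
        ¬ Function.Bijective g → g ∘ₗ v = 0) ∨
      ∃ i ∈ T, ∀ v : Z →ₗ[A] M i, v ≠ 0 → ∃ j ∈ T, ∃ g : M i →ₗ[A] M j,
        Chain A M L i j g ∧ g ∘ₗ v ≠ 0 := by
  classical
  induction L with
  | zero =>
    intro T hT
    obtain ⟨i, hi⟩ := Finset.card_pos.1 (by simpa using hT)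
    exact Or.inr ⟨i, hi, fun v hv => ⟨i, hi, LinearMap.id, .nil i, hv⟩⟩
  | succ L ih =>
    intro T hT
    let S := T.filter fun i => ∃ v : Z →ₗ[A] M i, v ≠ 0 ∧ ∀ j ∈ T, ∀ g : M i →ₗ[A] M j,
      ¬ Function.Bijective g → g ∘ₗ v = 0
    by_cases hS : r ≤ S.card
    · refine Or.inl ⟨S, Finset.filter_subset _ _, hS, fun i hi => ?_⟩
      obtain ⟨v, hv, h⟩ := (Finset.mem_filter.1 hi).2
      exact ⟨v, hv, fun j hj => h j (Finset.mem_filter.1 hj).1⟩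
    · have hcard : (T \ S).card + S.card = T.card :=
        Finset.card_sdiff_add_card_eq_card (Finset.filter_subset _ T)
      rcases ih (T \ S) (by rw [Nat.mul_succ] at hT; omega) with ⟨S', hS', h⟩ | ⟨i, hi, h⟩
      · exact Or.inl ⟨S', hS'.trans Finset.sdiff_subset, h⟩
      · refine Or.inr ⟨i, (Finset.mem_sdiff.1 hi).1, fun v hv => ?_⟩
        obtain ⟨j, hj, g, hg, hgv⟩ := h v hv
        have hj' : ¬ ∀ k ∈ T, ∀ h : M j →ₗ[A] M k, ¬ Function.Bijective h →
            h ∘ₗ (g ∘ₗ v) = 0 := fun hcon =>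
          (Finset.mem_sdiff.1 hj).2 (Finset.mem_filter.2 ⟨(Finset.mem_sdiff.1 hj).1, _, hgv, hcon⟩)
        push Not at hj'
        obtain ⟨k, hk, u, hu, hne⟩ := hj'
        exact ⟨k, hk, u ∘ₗ g, .cons hg u hu, by rwa [LinearMap.comp_assoc]⟩

lemma exists_smul_of_socle {i : ι} (hI : Indec A (M i)) {W : Type} [AddCommGroup W] [Module A W]
    (v : W →ₗ[A] M i) (hv : ∀ g : M i →ₗ[A] M i, ¬ Function.Bijective g → g ∘ₗ v = 0)
    (g : M i →ₗ[A] M i) : ∃ c : ℂ, g ∘ₗ v = c • v := by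
  have := hI.1
  obtain ⟨c, hc⟩ := Module.End.exists_eigenvalue (g.restrictScalars ℂ : Module.End ℂ (M i))
  obtain ⟨x, hx⟩ := hc.exists_hasEigenvector
  refine ⟨c, ?_⟩
  have h := hv (g - c • LinearMap.id) (fun hb => hx.2 (hb.1 ?_))
  · refine LinearMap.ext fun z => ?_
    have := LinearMap.congr_fun h z
    simpa [sub_eq_zero] using this
  · have := hx.apply_eq_smul
    simpa [sub_eq_zero] using this

/-- A tame algebra has no large families of indecomposable modules of bounded dimension
admitting presentations by fixed projectives, together with a module `Z` mapping nontrivially to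
all of them and having no extensions with them. -/
lemma false_of_family {G : Type} [Finite G] {gen : G → A}
    (hgen : Algebra.adjoin ℂ (Set.range gen) = ⊤) {k : Subfield ℂ} (hk : (k : Set ℂ).Countable)
    (hT : ∀ (M : Type) [AddCommGroup M] [Module ℂ M] [Module A M] [IsScalarTower ℂ A M]
      [FiniteDimensional ℂ M], HasParameters gen k (Module.finrank ℂ M) M)
    {b : ℕ} [Fintype ι] (hcard : (4 * b ^ 2 + 1) * (2 ^ b - 1) < Fintype.card ι)
    (hI : ∀ i, Indec A (M i)) (hb : ∀ i, Module.finrank ℂ (M i) ≤ b)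
    (hiso : ∀ i j, i ≠ j → ∀ g : M i →ₗ[A] M j, ¬ Function.Bijective g)
    (hZ : Module.finrank ℂ Z ≤ b) (hhom : ∀ i, ∃ v : Z →ₗ[A] M i, v ≠ 0)
    {P₀ P₁ : Type} [AddCommGroup P₀] [Module A P₀] [AddCommGroup P₁] [Module A P₁]
    (hP₀ : HasLifting A P₀) (hP₁ : HasLifting A P₁)
    (f : ι → P₁ →ₗ[A] P₀) (p : ∀ i, P₀ →ₗ[A] M i) (hp : ∀ i, Function.Surjective (p i))
    (hfp : ∀ i x, p i x = 0 ↔ ∃ y, f i y = x)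
    (hfac : ∀ i (u : P₁ →ₗ[A] Z), ∃ w : P₀ →ₗ[A] Z, w ∘ₗ f i = u) : False := by
  classical
  rcases exists_socle_or_chain (A := A) (M := M) Z (4 * b ^ 2 + 1) (2 ^ b - 1) Finset.univ hcard
    with ⟨S, -, hS, h⟩ | ⟨i, -, h⟩
  · obtain ⟨e⟩ : Nonempty (Fin (4 * b ^ 2 + 1) ↪ S) :=
      Function.Embedding.nonempty_of_card_le (by simpa using hS)
    choose v hv hv' using fun x : S => h x.1 x.2
    refine false_of_orthogonal_maps hgen hk hT rfl (fun x => M (e x).1) (fun x => hb _) hZ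
      (fun x => v (e x)) (fun x => hv _) (fun x y hxy g => hv' _ _ (e y).2 g ?_)
      (fun x g => exists_smul_of_socle (hI _) _ (fun g hg => hv' _ _ (e x).2 g hg) g)
      (fun n m φ ψ => exists_lift_of_presentations hP₀ hP₁ _ (fun q => f (e q.1).1)
        (fun q => p (e q.1).1) (fun q => hp _) (fun q => hfp _) (fun q => hfac _) φ ψ)
    exact hiso _ _ (fun hcon => hxy (e.injective (Subtype.ext hcon))) g
  · obtain ⟨v, hv⟩ := hhom i
    obtain ⟨j, -, g, hg, hne⟩ := h v hv
    exact hne (by rw [hg.eq_zero hI hb, LinearMap.zero_comp])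

end Family

section PolyMap

set_option linter.unusedSectionVars false

variable {X : Type} {E F G : Type} [AddCommGroup E] [Module ℂ E] [AddCommGroup F] [Module ℂ F]
  [AddCommGroup G] [Module ℂ G]

/-- A vector-valued function all of whose coordinates lie in a given algebra of functions. -/
def PolyMap (𝒪 : Subalgebra ℂ (X → ℂ)) (v : X → E) : Prop :=
  ∀ l : E →ₗ[ℂ] ℂ, (fun w => l (v w)) ∈ 𝒪

variable {𝒪 : Subalgebra ℂ (X → ℂ)}

lemma PolyMap.of_mem {g : X → ℂ} (h : g ∈ 𝒪) : PolyMap 𝒪 g := by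
  intro l
  have : (fun w => l (g w)) = l 1 • g := by
    funext w
    have := l.map_smul (g w) 1
    simp only [smul_eq_mul, mul_one] at this
    simp [this, mul_comm]
  rw [this]
  exact 𝒪.smul_mem h _

lemma PolyMap.linear {v : X → E} (hv : PolyMap 𝒪 v) (u : E →ₗ[ℂ] F) :
    PolyMap 𝒪 fun w => u (v w) := fun l => hv (l ∘ₗ u)

lemma PolyMap.const (e : E) : PolyMap 𝒪 fun _ : X => e := fun l => 𝒪.algebraMap_mem (l e)

lemma PolyMap.add {u v : X → E} (hu : PolyMap 𝒪 u) (hv : PolyMap 𝒪 v) :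
    PolyMap 𝒪 fun w => u w + v w := by
  intro l
  simp only [map_add]
  exact 𝒪.add_mem (hu l) (hv l)

lemma PolyMap.sub {u v : X → E} (hu : PolyMap 𝒪 u) (hv : PolyMap 𝒪 v) :
    PolyMap 𝒪 fun w => u w - v w := by
  intro l
  simp only [map_sub]
  exact 𝒪.sub_mem (hu l) (hv l)

lemma PolyMap.sum {ι : Type} (s : Finset ι) {u : ι → X → E} (hu : ∀ i ∈ s, PolyMap 𝒪 (u i)) :
    PolyMap 𝒪 fun w => ∑ i ∈ s, u i w := by
  intro l
  simp only [map_sum]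
  have : (fun w => ∑ i ∈ s, l (u i w)) = ∑ i ∈ s, fun w => l (u i w) := by
    funext w; simp
  rw [this]
  exact 𝒪.sum_mem fun i hi => hu i hi l

lemma PolyMap.smul {g : X → ℂ} {v : X → E} (hg : g ∈ 𝒪) (hv : PolyMap 𝒪 v) :
    PolyMap 𝒪 fun w => g w • v w := by
  intro l
  simp only [map_smul]
  exact 𝒪.mul_mem hg (hv l)

lemma PolyMap.pi {ι : Type} [Finite ι] {E : ι → Type} [∀ i, AddCommGroup (E i)]
    [∀ i, Module ℂ (E i)] {v : X → ∀ i, E i} (hv : ∀ i, PolyMap 𝒪 fun w => v w i) :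
    PolyMap 𝒪 v := by
  classical
  have := Fintype.ofFinite ι
  have h : v = fun w => ∑ i, LinearMap.single ℂ E i (v w i) := by
    funext w
    exact (LinearMap.sum_single_apply E (v w)).symm
  rw [h]
  exact PolyMap.sum _ fun i _ => (hv i).linear _

lemma PolyMap.matrix {m n : Type} [Finite m] [Finite n] {v : X → Matrix m n ℂ}
    (hv : ∀ i j, (fun w => v w i j) ∈ 𝒪) : PolyMap 𝒪 v :=
  PolyMap.pi (E := fun _ => n → ℂ) fun i => PolyMap.pi fun j => PolyMap.of_mem (hv i j)

lemma PolyMap.entry {m n : Type} {v : X → Matrix m n ℂ} (hv : PolyMap 𝒪 v) (i : m) (j : n) :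
    (fun w => v w i j) ∈ 𝒪 := hv (Matrix.entryLinearMap ℂ ℂ i j)

lemma PolyMap.mul {m n o : Type} [Finite m] [Fintype n] [Finite o] {u : X → Matrix m n ℂ}
    {v : X → Matrix n o ℂ} (hu : PolyMap 𝒪 u) (hv : PolyMap 𝒪 v) :
    PolyMap 𝒪 fun w => u w * v w := by
  refine PolyMap.matrix fun i j => ?_
  have : (fun w => (u w * v w) i j) = ∑ k, (fun w => u w i k) * fun w => v w k j := by
    funext w
    simp [Matrix.mul_apply]
  rw [this]
  exact 𝒪.sum_mem fun k _ => 𝒪.mul_mem (hu.entry i k) (hv.entry k j)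

lemma PolyMap.det {n : Type} [Fintype n] [DecidableEq n] {v : X → Matrix n n ℂ}
    (hv : PolyMap 𝒪 v) : (fun w => (v w).det) ∈ 𝒪 := by
  have : (fun w => (v w).det) = ∑ σ : Equiv.Perm n, (Equiv.Perm.sign σ : ℤ) •
      ∏ i, fun w => v w (σ i) i := by
    funext w
    simp [Matrix.det_apply, Units.smul_def]
  rw [this]
  exact 𝒪.sum_mem fun σ _ => zsmul_mem (𝒪.prod_mem fun i _ => hv.entry _ _) _

lemma PolyMap.adjugate {n : Type} [Fintype n] [DecidableEq n] {v : X → Matrix n n ℂ}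
    (hv : PolyMap 𝒪 v) : PolyMap 𝒪 fun w => (v w).adjugate := by
  refine PolyMap.matrix fun i j => ?_
  simp only [Matrix.adjugate_apply]
  refine PolyMap.det (PolyMap.matrix fun k l => ?_)
  by_cases hk : k = j
  · subst hk
    simp only [Matrix.updateRow_self]
    exact 𝒪.algebraMap_mem _
  · simpa [Matrix.updateRow_ne hk] using hv.entry k l

/-- An element of the kernel of one member of a polynomial family of linear maps extends, after
inverting a function, to a polynomial family of elements of the kernels, as long as the dimension
of the kernel does not drop. -/
lemma PolyMap.exists_ker_extension [FiniteDimensional ℂ E] [FiniteDimensional ℂ F]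
    {R : X → E →ₗ[ℂ] F} (hR : PolyMap 𝒪 R) (w₀ : X) (v₀ : E) (h₀ : R w₀ v₀ = 0) :
    ∃ d ∈ 𝒪, ∃ v : X → E, PolyMap 𝒪 v ∧ d w₀ ≠ 0 ∧ v w₀ = v₀ ∧ ∀ w, d w ≠ 0 →
      Module.finrank ℂ (LinearMap.ker (R w₀)) ≤ Module.finrank ℂ (LinearMap.ker (R w)) →
      R w (v w) = 0 := by
  classical
  obtain ⟨q, hq⟩ := (LinearMap.ker (R w₀)).exists_isCompl
  let T : E →ₗ[ℂ] E := (LinearMap.ker (R w₀)).subtype ∘ₗ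
    (LinearMap.ker (R w₀)).projectionOnto q hq
  have hTk : ∀ x ∈ LinearMap.ker (R w₀), T x = x := fun x hx => by
    exact congrArg Subtype.val (Submodule.projectionOnto_apply_left hq ⟨x, hx⟩)
  have hTm : ∀ x, T x ∈ LinearMap.ker (R w₀) := fun x => Subtype.property _
  obtain ⟨S, hS⟩ : ∃ S : F →ₗ[ℂ] E, S ∘ₗ R w₀ = LinearMap.id - T := by
    obtain ⟨S, hS⟩ := ((LinearMap.ker (R w₀)).liftQ (LinearMap.id - T) (fun x hx => by
      simp [hTk x hx]) ∘ₗ (R w₀).quotKerEquivRange.symm.toLinearMap).exists_extend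
    refine ⟨S, LinearMap.ext fun x => ?_⟩
    have := LinearMap.congr_fun hS ⟨R w₀ x, x, rfl⟩
    have e : (R w₀).quotKerEquivRange.symm ⟨R w₀ x, x, rfl⟩ = (LinearMap.ker (R w₀)).mkQ x := by
      rw [LinearEquiv.symm_apply_eq]; rfl
    simp only [LinearMap.comp_apply, LinearEquiv.coe_coe, e] at this
    exact this
  let b := Module.finBasis ℂ E
  let B : X → E →ₗ[ℂ] E := fun w => S ∘ₗ R w + T
  have hB : PolyMap 𝒪 B := (hR.linear (LinearMap.compRight ℂ S)).add (.const T)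
  have hBM : PolyMap 𝒪 fun w => LinearMap.toMatrix b b (B w) :=
    hB.linear (LinearMap.toMatrix b b).toLinearMap
  have hB0 : B w₀ = LinearMap.id := by simp [B, hS]
  let v : X → E := fun w => Matrix.toLin b b (LinearMap.toMatrix b b (B w)).adjugate v₀
  refine ⟨fun w => (LinearMap.toMatrix b b (B w)).det, hBM.det, v, ?_, ?_, ?_, ?_⟩
  · exact hBM.adjugate.linear ((LinearMap.applyₗ v₀) ∘ₗ (Matrix.toLin b b).toLinearMap)
  · simp [hB0]
  · simp [v, hB0]
  · intro w hw hfin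
    have hadj : ∀ x, Matrix.toLin b b (LinearMap.toMatrix b b (B w)).adjugate (B w x) =
        (LinearMap.toMatrix b b (B w)).det • x := by
      intro x
      have : B w x = Matrix.toLin b b (LinearMap.toMatrix b b (B w)) x := by
        rw [Matrix.toLin_toMatrix]
      rw [this, ← Matrix.toLin_mul_apply, Matrix.adjugate_mul, map_smul, Matrix.toLin_one]
      rfl
    have hinj : Function.Injective (B w) := by
      rw [← LinearMap.ker_eq_bot, LinearMap.ker_eq_bot']
      intro x hx
      have := hadj x
      rw [hx, map_zero] at this
      exact (smul_eq_zero.1 this.symm).resolve_left hw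
    have hle : (LinearMap.ker (R w)).map (B w) ≤ LinearMap.ker (R w₀) := by
      rintro _ ⟨x, hx, rfl⟩
      have : R w x = 0 := hx
      simpa [B, this] using hTm x
    have heq : (LinearMap.ker (R w)).map (B w) = LinearMap.ker (R w₀) := by
      refine Submodule.eq_of_le_of_finrank_le hle ?_
      rwa [(Submodule.equivMapOfInjective (B w) hinj _).symm.finrank_eq]
    obtain ⟨u, hu, rfl⟩ : v₀ ∈ (LinearMap.ker (R w)).map (B w) := by rw [heq]; exact h₀
    have hu' : R w u = 0 := hu
    simp [v, hadj, hu']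

/-- The algebra of functions on `X` which become fractions with powers of `Δ` as denominators
where `Δ` does not vanish. -/
def localizedFun (𝒪 : Subalgebra ℂ (X → ℂ)) {Δ : X → ℂ} (hΔ : Δ ∈ 𝒪) : Subalgebra ℂ (X → ℂ) where
  carrier := {g | ∃ (k : ℕ), ∃ n ∈ 𝒪, ∀ w, Δ w ≠ 0 → g w * Δ w ^ k = n w}
  mul_mem' := by
    rintro g g' ⟨k, n, hn, h⟩ ⟨k', n', hn', h'⟩
    refine ⟨k + k', n * n', 𝒪.mul_mem hn hn', fun w hw => ?_⟩
    rw [Pi.mul_apply, Pi.mul_apply, ← h w hw, ← h' w hw, pow_add]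
    ring
  add_mem' := by
    rintro g g' ⟨k, n, hn, h⟩ ⟨k', n', hn', h'⟩
    refine ⟨k + k', n * Δ ^ k' + n' * Δ ^ k, 𝒪.add_mem (𝒪.mul_mem hn (𝒪.pow_mem hΔ _))
      (𝒪.mul_mem hn' (𝒪.pow_mem hΔ _)), fun w hw => ?_⟩
    simp only [Pi.add_apply, Pi.mul_apply, Pi.pow_apply, ← h w hw, ← h' w hw, pow_add]
    ring
  algebraMap_mem' := fun c => ⟨0, algebraMap ℂ _ c, 𝒪.algebraMap_mem c, fun w _ => by simp⟩

lemma le_localizedFun {Δ : X → ℂ} (hΔ : Δ ∈ 𝒪) : 𝒪 ≤ localizedFun 𝒪 hΔ := fun g hg =>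
  ⟨0, g, hg, fun w _ => by simp⟩

lemma inv_mem_localizedFun {Δ g : X → ℂ} (hΔ : Δ ∈ 𝒪) (hg : ∃ n ∈ 𝒪, ∀ w, g w * n w = Δ w) :
    (fun w => (g w)⁻¹) ∈ localizedFun 𝒪 hΔ := by
  obtain ⟨n, hn, h⟩ := hg
  refine ⟨1, n, hn, fun w hw => ?_⟩
  have : g w ≠ 0 := fun h0 => hw (by rw [← h w, h0, zero_mul])
  rw [pow_one, ← h w]
  field_simp

lemma PolyMap.mono {𝒪' : Subalgebra ℂ (X → ℂ)} (h : 𝒪 ≤ 𝒪') {v : X → E} (hv : PolyMap 𝒪 v) :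
    PolyMap 𝒪' v := fun l => h (hv l)

/-- The polynomial functions on affine space composed with a coordinate map. -/
def polyFun {ι : Type} (c : X → ι → ℂ) : Subalgebra ℂ (X → ℂ) :=
  (MvPolynomial.aeval (fun i w => c w i) : MvPolynomial ι ℂ →ₐ[ℂ] (X → ℂ)).range

lemma mem_polyFun {ι : Type} {c : X → ι → ℂ} {g : X → ℂ} :
    g ∈ polyFun c ↔ ∃ p : MvPolynomial ι ℂ, ∀ w, g w = MvPolynomial.eval (c w) p := by
  have key : ∀ (p : MvPolynomial ι ℂ) (w : X),
      MvPolynomial.aeval (fun i w => c w i) p w = MvPolynomial.eval (c w) p := by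
    intro p w
    induction p using MvPolynomial.induction_on with
    | C a => simp
    | add p q hp hq => simp [hp, hq]
    | mul_X p i hp => simp [hp]
  constructor
  · rintro ⟨p, rfl⟩
    exact ⟨p, fun w => key p w⟩
  · rintro ⟨p, hp⟩
    exact ⟨p, funext fun w => (key p w).trans (hp w).symm⟩

lemma coord_mem_polyFun {ι : Type} (c : X → ι → ℂ) (i : ι) : (fun w => c w i) ∈ polyFun c :=
  mem_polyFun.2 ⟨MvPolynomial.X i, fun w => by simp⟩

/-- Polynomial functions pull back along maps with polynomial coordinates. -/
lemma comp_mem_of_mem_polyFun {Y ι : Type} {c : Y → ι → ℂ} {φ : X → Y}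
    (h : ∀ i, (fun w => c (φ w) i) ∈ 𝒪) {g : Y → ℂ} (hg : g ∈ polyFun c) : g ∘ φ ∈ 𝒪 := by
  obtain ⟨p, hp⟩ := mem_polyFun.1 hg
  have : g ∘ φ = fun w => MvPolynomial.eval (c (φ w)) p := funext fun w => hp _
  rw [this]
  clear this hp
  induction p using MvPolynomial.induction_on with
  | C a =>
    simp only [MvPolynomial.eval_C]
    exact 𝒪.algebraMap_mem a
  | add p q hp hq =>
    simp only [map_add]
    exact 𝒪.add_mem hp hq
  | mul_X p i hp =>
    simp only [map_mul, MvPolynomial.eval_X]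
    exact 𝒪.mul_mem hp (h i)

end PolyMap

section Bridge

set_option linter.unusedSectionVars false

variable {Q : Quiv}

/-- The element of the free algebra on vertices and arrows attached to a path. -/
def pathEl : ∀ {x y : Q.V}, Quiver.Path x y → FreeAlgebra ℂ (Q.V ⊕ Q.A)
  | x, _, Quiver.Path.nil => FreeAlgebra.ι ℂ (Sum.inl x)
  | _, _, Quiver.Path.cons p e => FreeAlgebra.ι ℂ (Sum.inr e.1) * pathEl p

/-- The defining relations of a bound quiver algebra. -/
inductive BqRel (R : Set (FormalRel Q)) :
    FreeAlgebra ℂ (Q.V ⊕ Q.A) → FreeAlgebra ℂ (Q.V ⊕ Q.A) → Prop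
  | orth {x y : Q.V} (h : x ≠ y) :
      BqRel R (FreeAlgebra.ι ℂ (Sum.inl x) * FreeAlgebra.ι ℂ (Sum.inl y)) 0
  | idem (x : Q.V) : BqRel R (FreeAlgebra.ι ℂ (Sum.inl x) * FreeAlgebra.ι ℂ (Sum.inl x))
      (FreeAlgebra.ι ℂ (Sum.inl x))
  | one : BqRel R (∑ x, FreeAlgebra.ι ℂ (Sum.inl x)) 1
  | arrow (a : Q.A) : BqRel R (FreeAlgebra.ι ℂ (Sum.inl (Q.h a)) *
      (FreeAlgebra.ι ℂ (Sum.inr a) * FreeAlgebra.ι ℂ (Sum.inl (Q.t a))))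
      (FreeAlgebra.ι ℂ (Sum.inr a))
  | rel {r : FormalRel Q} (h : r ∈ R) : BqRel R (r.2.2.sum fun p k => k • pathEl p) 0

/-- The bound quiver algebra. -/
def BqAlg (R : Set (FormalRel Q)) : Type := RingQuot (BqRel R)

instance (R : Set (FormalRel Q)) : Ring (BqAlg R) := inferInstanceAs (Ring (RingQuot (BqRel R)))

instance (R : Set (FormalRel Q)) : Algebra ℂ (BqAlg R) :=
  inferInstanceAs (Algebra ℂ (RingQuot (BqRel R)))

/-- The projection from the free algebra to a bound quiver algebra. -/
def bqMk (R : Set (FormalRel Q)) : FreeAlgebra ℂ (Q.V ⊕ Q.A) →ₐ[ℂ] BqAlg R :=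
  RingQuot.mkAlgHom ℂ (BqRel R)

/-- The generators of a bound quiver algebra: vertex idempotents and arrows. -/
def bqGen (R : Set (FormalRel Q)) (g : Q.V ⊕ Q.A) : BqAlg R :=
  bqMk R (FreeAlgebra.ι ℂ g)

lemma adjoin_bqGen (R : Set (FormalRel Q)) :
    Algebra.adjoin ℂ (Set.range (bqGen R)) = ⊤ := by
  have : Set.range (bqGen R) = bqMk R '' Set.range (FreeAlgebra.ι ℂ) := by
    rw [← Set.range_comp]; rfl
  rw [this, ← AlgHom.map_adjoin, FreeAlgebra.adjoin_range_ι, Algebra.map_top,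
    AlgHom.range_eq_top]
  exact RingQuot.mkAlgHom_surjective ℂ _

variable {R : Set (FormalRel Q)} {α β γ : Q.V → ℕ}

lemma castM_rfl {m n : ℕ} (M : Matrix (Fin m) (Fin n) ℂ) : castM rfl rfl M = M := rfl

/-- The action of the generators on the total space of a representation. -/
def genAct (W : QRep Q β) : Q.V ⊕ Q.A → Module.End ℂ (∀ x, Fin (β x) → ℂ)
  | Sum.inl x => LinearMap.single ℂ _ x ∘ₗ LinearMap.proj x
  | Sum.inr a => LinearMap.single ℂ (fun x => Fin (β x) → ℂ) (Q.h a) ∘ₗ (W a).mulVecLin ∘ₗ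
      LinearMap.proj (Q.t a)

lemma lift_genAct_pathEl (W : QRep Q β) {x y : Q.V} (p : Quiver.Path x y) :
    FreeAlgebra.lift ℂ (genAct W) (pathEl p) =
      LinearMap.single ℂ (fun x => Fin (β x) → ℂ) y ∘ₗ (evalPath W p).mulVecLin ∘ₗ
        LinearMap.proj x := by
  induction p with
  | nil => simp [pathEl, genAct, evalPath]
  | cons p e ih =>
    obtain ⟨a, rfl, rfl⟩ := e
    rw [pathEl, map_mul, ih, FreeAlgebra.lift_ι_apply, evalPath, castM_rfl]
    refine LinearMap.ext fun v => ?_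
    simp [genAct, Module.End.mul_apply]

/-- The representation of the bound quiver algebra on the total space of a representation. -/
def totHom (W : modSet R β) : BqAlg R →ₐ[ℂ] Module.End ℂ (∀ x, Fin (β x) → ℂ) :=
  RingQuot.liftAlgHom ℂ ⟨FreeAlgebra.lift ℂ (genAct W.1), by
    intro a b h
    induction h with
    | @orth x y h =>
      refine LinearMap.ext fun v => ?_
      simp [genAct, Module.End.mul_apply, Pi.single_eq_of_ne h]
    | idem x =>
      refine LinearMap.ext fun v => ?_
      simp [genAct, Module.End.mul_apply]
    | one =>
      refine LinearMap.ext fun v => ?_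
      simp only [map_sum, FreeAlgebra.lift_ι_apply, map_one, LinearMap.sum_apply]
      exact LinearMap.sum_single_apply _ v
    | arrow a =>
      refine LinearMap.ext fun v => ?_
      simp [genAct, Module.End.mul_apply]
    | @rel r h =>
      have h0 : (r.2.2.sum fun p k => k • evalPath W.1 p) = 0 := W.2 r h
      rw [Finsupp.sum, map_sum, map_zero]
      refine LinearMap.ext fun v => ?_
      have := congrArg (fun M => Pi.single (M := fun x => Fin (β x) → ℂ) r.2.1 (M *ᵥ v r.1)) h0
      simp only [Finsupp.sum, Matrix.sum_mulVec, Matrix.zero_mulVec, Pi.single_zero] at this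
      rw [LinearMap.zero_apply, ← this, LinearMap.sum_apply]
      simp only [map_smul, lift_genAct_pathEl]
      rw [← LinearMap.single_apply ℂ (φ := fun x => Fin (β x) → ℂ), map_sum]
      refine Finset.sum_congr rfl fun p _ => ?_
      simp [Matrix.smul_mulVec]⟩

/-- The total space of a representation, as a module over the bound quiver algebra. -/
def TotM (W : modSet R β) : Type := (fun _ => ∀ x, Fin (β x) → ℂ) W

instance (W : modSet R β) : AddCommGroup (TotM W) :=
  inferInstanceAs (AddCommGroup (∀ x, Fin (β x) → ℂ))

instance (W : modSet R β) : Module ℂ (TotM W) :=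
  inferInstanceAs (Module ℂ (∀ x, Fin (β x) → ℂ))

instance (W : modSet R β) : FiniteDimensional ℂ (TotM W) :=
  inferInstanceAs (FiniteDimensional ℂ (∀ x, Fin (β x) → ℂ))

instance (W : modSet R β) : Module (Module.End ℂ (∀ x, Fin (β x) → ℂ)) (TotM W) :=
  inferInstanceAs (Module (Module.End ℂ (∀ x, Fin (β x) → ℂ)) (∀ x, Fin (β x) → ℂ))

instance (W : modSet R β) : Module (BqAlg R) (TotM W) :=
  Module.compHom _ (totHom W).toRingHom

lemma smul_totM (W : modSet R β) (a : BqAlg R) (v : TotM W) : a • v = totHom W a v := rfl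

instance (W : modSet R β) : IsScalarTower ℂ (BqAlg R) (TotM W) where
  smul_assoc c a v := by rw [smul_totM, map_smul]; rfl

/-- The component of a vector of the total space at a vertex. -/
def TotM.coord (W : modSet R β) (x : Q.V) : TotM W →ₗ[ℂ] (Fin (β x) → ℂ) :=
  (LinearMap.proj x : (∀ x, Fin (β x) → ℂ) →ₗ[ℂ] (Fin (β x) → ℂ))

/-- The inclusion of the component at a vertex into the total space. -/
def TotM.single (W : modSet R β) (x : Q.V) : (Fin (β x) → ℂ) →ₗ[ℂ] TotM W :=
  LinearMap.single ℂ (fun x => Fin (β x) → ℂ) x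

/-- The vector of the total space with given components. -/
def TotM.mk (W : modSet R β) (v : ∀ x, Fin (β x) → ℂ) : TotM W := v

lemma TotM.ext {W : modSet R β} {v w : TotM W}
    (h : ∀ x, TotM.coord W x v = TotM.coord W x w) : v = w := funext h

lemma TotM.coord_single_same (W : modSet R β) (x : Q.V) (v : Fin (β x) → ℂ) :
    TotM.coord W x (TotM.single W x v) = v :=
  Pi.single_eq_same (M := fun x => Fin (β x) → ℂ) x v

lemma TotM.coord_single_of_ne (W : modSet R β) {x y : Q.V} (h : y ≠ x) (v : Fin (β x) → ℂ) :
    TotM.coord W y (TotM.single W x v) = 0 :=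
  Pi.single_eq_of_ne (M := fun x => Fin (β x) → ℂ) h v

lemma bqGen_smul (W : modSet R β) (g : Q.V ⊕ Q.A) (v : TotM W) :
    bqGen R g • v = (genAct W.1 g : TotM W → TotM W) v := by
  have h : totHom W (bqGen R g) = FreeAlgebra.lift ℂ (genAct W.1) (FreeAlgebra.ι ℂ g) :=
    RingQuot.liftAlgHom_mkAlgHom_apply ..
  rw [smul_totM, h, FreeAlgebra.lift_ι_apply]

lemma vertex_smul (W : modSet R β) (x : Q.V) (v : TotM W) :
    bqGen R (Sum.inl x) • v = TotM.single W x (TotM.coord W x v) := bqGen_smul ..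

lemma arrow_smul (W : modSet R β) (a : Q.A) (v : TotM W) :
    bqGen R (Sum.inr a) • v =
      TotM.single W (Q.h a) (W.1 a *ᵥ TotM.coord W (Q.t a) v) := bqGen_smul ..

lemma finrank_totM (W : modSet R β) : Module.finrank ℂ (TotM W) = ∑ x, β x := by
  refine (Module.finrank_pi_fintype ℂ).trans ?_
  simp

/-- The map of total spaces induced by a family of matrices. -/
def totLin (V : modSet R α) (W : modSet R β) (φ : ∀ x, Matrix (Fin (β x)) (Fin (α x)) ℂ) :
    TotM V →ₗ[ℂ] TotM W :=
  ∑ x, TotM.single W x ∘ₗ (φ x).mulVecLin ∘ₗ TotM.coord V x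

lemma coord_sum_single (W : modSet R β) (v : ∀ x, Fin (β x) → ℂ) (x : Q.V) :
    TotM.coord W x (∑ y, TotM.single W y (v y)) = v x := by
  rw [map_sum, Finset.sum_eq_single x]
  · rw [TotM.coord_single_same]
  · intro y _ hy
    rw [TotM.coord_single_of_ne W hy.symm]
  · simp

lemma coord_totLin (V : modSet R α) (W : modSet R β)
    (φ : ∀ x, Matrix (Fin (β x)) (Fin (α x)) ℂ) (v : TotM V) (x : Q.V) :
    TotM.coord W x (totLin V W φ v) = φ x *ᵥ TotM.coord V x v := by
  rw [totLin, LinearMap.sum_apply]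
  exact coord_sum_single W (fun x => φ x *ᵥ TotM.coord V x v) x

lemma totLin_single (V : modSet R α) (W : modSet R β)
    (φ : ∀ x, Matrix (Fin (β x)) (Fin (α x)) ℂ) (x : Q.V) (v : Fin (α x) → ℂ) :
    totLin V W φ (TotM.single V x v) = TotM.single W x (φ x *ᵥ v) := by
  refine TotM.ext fun y => ?_
  rw [coord_totLin]
  by_cases hy : y = x
  · subst hy
    rw [TotM.coord_single_same, TotM.coord_single_same]
  · rw [TotM.coord_single_of_ne _ hy, TotM.coord_single_of_ne _ hy, Matrix.mulVec_zero]

lemma totLin_smul {V : modSet R α} {W : modSet R β}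
    {φ : ∀ x, Matrix (Fin (β x)) (Fin (α x)) ℂ} (h : φ ∈ HomS V.1 W.1) (g : Q.V ⊕ Q.A)
    (v : TotM V) : totLin V W φ (bqGen R g • v) = bqGen R g • totLin V W φ v := by
  cases g with
  | inl x => rw [vertex_smul, vertex_smul, totLin_single, coord_totLin]
  | inr a =>
    rw [arrow_smul, arrow_smul, totLin_single, coord_totLin, Matrix.mulVec_mulVec, h a,
      ← Matrix.mulVec_mulVec]

lemma hom_single {V : modSet R α} {W : modSet R β} (f : TotM V →ₗ[BqAlg R] TotM W)
    (v : TotM V) (x : Q.V) :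
    f (TotM.single V x (TotM.coord V x v)) = TotM.single W x (TotM.coord W x (f v)) := by
  rw [← vertex_smul, map_smul, vertex_smul]

/-- The matrices of a homomorphism between total spaces. -/
def matOf {V : modSet R α} {W : modSet R β} (f : TotM V →ₗ[BqAlg R] TotM W) (x : Q.V) :
    Matrix (Fin (β x)) (Fin (α x)) ℂ :=
  LinearMap.toMatrix' (TotM.coord W x ∘ₗ f.restrictScalars ℂ ∘ₗ TotM.single V x)

lemma matOf_mulVec {V : modSet R α} {W : modSet R β} (f : TotM V →ₗ[BqAlg R] TotM W)
    (v : TotM V) (x : Q.V) : matOf f x *ᵥ TotM.coord V x v = TotM.coord W x (f v) := by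
  rw [matOf, LinearMap.toMatrix'_mulVec]
  simp only [LinearMap.comp_apply, LinearMap.restrictScalars_apply]
  rw [hom_single, TotM.coord_single_same]

lemma totLin_matOf {V : modSet R α} {W : modSet R β} (f : TotM V →ₗ[BqAlg R] TotM W)
    (v : TotM V) : totLin V W (matOf f) v = f v :=
  TotM.ext fun x => by rw [coord_totLin, matOf_mulVec]

lemma matOf_mem {V : modSet R α} {W : modSet R β} (f : TotM V →ₗ[BqAlg R] TotM W) :
    matOf f ∈ HomS V.1 W.1 := by
  intro a
  refine Matrix.mulVec_injective (funext fun v => ?_)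
  have h := congrArg (TotM.coord W (Q.h a))
    (f.map_smul (bqGen R (Sum.inr a)) (TotM.single V (Q.t a) v))
  rwa [arrow_smul, arrow_smul, ← totLin_matOf f, ← totLin_matOf f, totLin_single, totLin_single,
    TotM.coord_single_same, TotM.coord_single_same, TotM.coord_single_same,
    TotM.coord_single_same, Matrix.mulVec_mulVec, Matrix.mulVec_mulVec] at h

lemma matOf_totLin {V : modSet R α} {W : modSet R β} (f : TotM V →ₗ[BqAlg R] TotM W)
    {φ : ∀ x, Matrix (Fin (β x)) (Fin (α x)) ℂ} (h : ∀ v, f v = totLin V W φ v) :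
    matOf f = φ := by
  funext x
  refine Matrix.mulVec_injective (funext fun v => ?_)
  have := matOf_mulVec f (TotM.single V x v) x
  rwa [h, coord_totLin, TotM.coord_single_same] at this

/-- Morphisms of representations are homomorphisms of modules. -/
def homEquiv (V : modSet R α) (W : modSet R β) :
    HomS V.1 W.1 ≃ₗ[ℂ] (TotM V →ₗ[BqAlg R] TotM W) where
  toFun φ := homOfGens (adjoin_bqGen R) (totLin V W φ.1) (totLin_smul φ.2)
  invFun f := ⟨matOf f, matOf_mem f⟩
  map_add' φ ψ := by
    refine LinearMap.ext fun v => TotM.ext fun x => ?_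
    rw [LinearMap.add_apply, map_add]
    simp only [homOfGens_apply, coord_totLin]
    exact Matrix.add_mulVec _ _ _
  map_smul' c φ := by
    refine LinearMap.ext fun v => TotM.ext fun x => ?_
    rw [LinearMap.smul_apply, map_smul]
    simp only [homOfGens_apply, coord_totLin]
    exact Matrix.smul_mulVec c (φ.1 x) _
  left_inv φ := Subtype.ext (matOf_totLin _ fun v => rfl)
  right_inv f := LinearMap.ext fun v => totLin_matOf f v

lemma coord_homEquiv {V : modSet R α} {W : modSet R β} (φ : HomS V.1 W.1) (v : TotM V)
    (x : Q.V) : TotM.coord W x (homEquiv V W φ v) = φ.1 x *ᵥ TotM.coord V x v :=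
  coord_totLin V W φ.1 v x

lemma matOf_homEquiv {V : modSet R α} {W : modSet R β} (φ : HomS V.1 W.1) :
    matOf (homEquiv V W φ) = φ.1 := matOf_totLin _ fun _ => rfl

lemma homEquiv_single {V : modSet R α} {W : modSet R β} (φ : HomS V.1 W.1) (x : Q.V)
    (v : Fin (α x) → ℂ) :
    homEquiv V W φ (TotM.single V x v) = TotM.single W x (φ.1 x *ᵥ v) :=
  totLin_single V W φ.1 x v

lemma surjective_homEquiv {V : modSet R α} {W : modSet R β} {φ : HomS V.1 W.1} :
    Function.Surjective (homEquiv V W φ) ↔ MorSurj φ.1 := by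
  constructor
  · intro h x w
    obtain ⟨v, hv⟩ := h (TotM.single W x w)
    refine ⟨TotM.coord V x v, ?_⟩
    rw [Matrix.mulVecLin_apply, ← coord_homEquiv, hv, TotM.coord_single_same]
  · intro h w
    choose v hv using fun x => h x (TotM.coord W x w)
    exact ⟨TotM.mk V v, TotM.ext fun x => by rw [coord_homEquiv]; exact hv x⟩

lemma injective_homEquiv {V : modSet R α} {W : modSet R β} {φ : HomS V.1 W.1} :
    Function.Injective (homEquiv V W φ) ↔ MorInj φ.1 := by
  constructor
  · intro h x
    rw [← LinearMap.ker_eq_bot, LinearMap.ker_eq_bot']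
    intro v hv
    rw [Matrix.mulVecLin_apply] at hv
    have : TotM.single V x v = 0 := by
      apply h
      rw [map_zero, homEquiv_single, hv, map_zero]
    rw [← TotM.coord_single_same V x v, this, map_zero]
  · intro h v w hvw
    refine TotM.ext fun x => h x ?_
    rw [Matrix.mulVecLin_apply, Matrix.mulVecLin_apply, ← coord_homEquiv, hvw, coord_homEquiv]

/-- An isomorphism of representations induces an isomorphism of modules. -/
lemma exists_equiv_of_rIso {V : modSet R α} {W : modSet R β} (h : RIso V.1 W.1) :
    Nonempty (TotM V ≃ₗ[BqAlg R] TotM W) := by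
  obtain ⟨u, hu⟩ := h
  let φ : ∀ x, Matrix (Fin (β x)) (Fin (α x)) ℂ := fun x => LinearMap.toMatrix' (u x).toLinearMap
  have hφ : φ ∈ HomS V.1 W.1 := by
    intro a
    refine Matrix.mulVec_injective (funext fun v => ?_)
    have := LinearMap.congr_fun (hu a) v
    simp only [φ, ← Matrix.mulVec_mulVec, LinearMap.toMatrix'_mulVec]
    exact this
  have hu' : ∀ x, (φ x).mulVecLin = (u x).toLinearMap := fun x => by
    rw [← Matrix.toLin'_apply']; simp [φ]
  refine ⟨LinearEquiv.ofBijective (homEquiv V W ⟨φ, hφ⟩)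
    ⟨injective_homEquiv.2 fun x => ?_, surjective_homEquiv.2 fun x => ?_⟩⟩
  · rw [hu']; exact (u x).injective
  · rw [hu']; exact (u x).surjective

lemma matOf_comp {U : modSet R α} {V : modSet R β} {W : modSet R γ}
    (g : TotM V →ₗ[BqAlg R] TotM W) (f : TotM U →ₗ[BqAlg R] TotM V) (x : Q.V) :
    matOf (g ∘ₗ f) x = matOf g x * matOf f x := by
  refine Matrix.mulVec_injective (funext fun v => ?_)
  have := matOf_mulVec (g ∘ₗ f) (TotM.single U x v) x
  rw [TotM.coord_single_same] at this
  rw [this, LinearMap.comp_apply, ← matOf_mulVec, ← matOf_mulVec, TotM.coord_single_same,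
    Matrix.mulVec_mulVec]

lemma indec_iff {V : modSet R α} : Indec (BqAlg R) (TotM V) ↔ IsIndecRep V.1 := by
  have hnt : Nontrivial (TotM V) ↔ ∃ x, α x ≠ 0 := by
    rw [← Module.finrank_pos_iff (R := ℂ), finrank_totM, Finset.sum_pos_iff]
    simp [Nat.pos_iff_ne_zero]
  have hid : matOf (LinearMap.id : TotM V →ₗ[BqAlg R] TotM V) = fun x => 1 :=
    matOf_totLin _ fun v => TotM.ext fun x => by simp [coord_totLin]
  have inj : ∀ f g : TotM V →ₗ[BqAlg R] TotM V, matOf f = matOf g → f = g := fun f g h =>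
    (homEquiv V V).symm.injective (Subtype.ext h)
  have hzero : matOf (0 : TotM V →ₗ[BqAlg R] TotM V) = 0 :=
    matOf_totLin _ fun v => TotM.ext fun x => by simp [coord_totLin]
  unfold Indec IsIndecRep
  rw [hnt]
  refine and_congr_right fun _ => ⟨fun h φ hφ he => ?_, fun h e he => ?_⟩
  · have h1 : _ = φ := matOf_homEquiv (V := V) (W := V) ⟨φ, hφ⟩
    rcases h (homEquiv V V ⟨φ, hφ⟩) (inj _ _ (funext fun x => by
      rw [matOf_comp, h1, he])) with h0 | h0
    · left; rw [← h1, h0, hzero]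
    · right; rw [← h1, h0, hid]
  · rcases h (matOf e) (matOf_mem e) (fun x => by rw [← matOf_comp, he]) with h0 | h0
    · left; exact inj _ _ (h0.trans hzero.symm)
    · right; exact inj _ _ (h0.trans hid.symm)

lemma bq_eq {a b : FreeAlgebra ℂ (Q.V ⊕ Q.A)} (h : BqRel R a b) :
    bqMk R a = bqMk R b :=
  RingQuot.mkAlgHom_rel ℂ h

lemma vertex_mul_of_ne {x y : Q.V} (h : x ≠ y) :
    bqGen R (Sum.inl x) * bqGen R (Sum.inl y) = 0 := by
  simpa [bqGen] using bq_eq (R := R) (.orth h)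

lemma vertex_mul_self (x : Q.V) :
    bqGen R (Sum.inl x) * bqGen R (Sum.inl x) = bqGen R (Sum.inl x) := by
  simpa [bqGen] using bq_eq (R := R) (.idem x)

lemma sum_vertex : ∑ x : Q.V, bqGen R (Sum.inl x) = 1 := by
  simpa [bqGen] using bq_eq (R := R) .one

lemma vertex_mul_arrow (a : Q.A) :
    bqGen R (Sum.inl (Q.h a)) * (bqGen R (Sum.inr a) * bqGen R (Sum.inl (Q.t a))) =
      bqGen R (Sum.inr a) := by
  simpa [bqGen] using bq_eq (R := R) (.arrow a)

/-- Every finite-dimensional module is the total space of a representation. -/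
lemma exists_totM_equiv (M : Type) [AddCommGroup M] [Module ℂ M] [Module (BqAlg R) M]
    [IsScalarTower ℂ (BqAlg R) M] [FiniteDimensional ℂ M] :
    ∃ (β : Q.V → ℕ) (V : modSet R β), Nonempty (TotM V ≃ₗ[BqAlg R] M) := by
  let e : Q.V → M →ₗ[ℂ] M := fun x => Algebra.lsmul ℂ ℂ M (bqGen R (Sum.inl x))
  have he : ∀ x m, e x m = bqGen R (Sum.inl x) • m := fun x m => rfl
  let β : Q.V → ℕ := fun x => Module.finrank ℂ (LinearMap.range (e x))
  let b : ∀ x, (LinearMap.range (e x)) ≃ₗ[ℂ] (Fin (β x) → ℂ) := fun x =>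
    (Module.finBasis ℂ (LinearMap.range (e x))).equivFun
  let ι : ∀ x, (Fin (β x) → ℂ) →ₗ[ℂ] M := fun x =>
    (LinearMap.range (e x)).subtype ∘ₗ (b x).symm.toLinearMap
  have hιinj : ∀ x, Function.Injective (ι x) := fun x =>
    Subtype.val_injective.comp (b x).symm.injective
  have hιrange : ∀ x m, ∃ v, ι x v = bqGen R (Sum.inl x) • m := fun x m =>
    ⟨b x ⟨e x m, m, rfl⟩, by simp [ι, he]⟩
  have hιe : ∀ x v, bqGen R (Sum.inl x) • ι x v = ι x v := by
    intro x v
    obtain ⟨m, hm⟩ := ((b x).symm v).2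
    have : ι x v = bqGen R (Sum.inl x) • m := hm.symm
    rw [this, ← mul_smul, vertex_mul_self]
  have hιne : ∀ x y v, x ≠ y → bqGen R (Sum.inl x) • ι y v = 0 := by
    intro x y v h
    rw [← hιe, ← mul_smul, vertex_mul_of_ne h, zero_smul]
  have harr : ∀ (a : Q.A) (m : M), bqGen R (Sum.inr a) • m =
      bqGen R (Sum.inl (Q.h a)) • bqGen R (Sum.inr a) • bqGen R (Sum.inl (Q.t a)) • m := by
    intro a m
    rw [← mul_smul, ← mul_smul, mul_assoc, vertex_mul_arrow]
  let ρ : ∀ a : Q.A, M →ₗ[ℂ] M := fun a => Algebra.lsmul ℂ ℂ M (bqGen R (Sum.inr a))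
  have hρ : ∀ a m, ρ a m = bqGen R (Sum.inr a) • m := fun a m => rfl
  let V : QRep Q β := fun a => LinearMap.toMatrix'
    ((b (Q.h a)).toLinearMap ∘ₗ (e (Q.h a)).rangeRestrict ∘ₗ ρ a ∘ₗ ι (Q.t a))
  have hV : ∀ a v, ι (Q.h a) (V a *ᵥ v) = bqGen R (Sum.inr a) • ι (Q.t a) v := by
    intro a v
    have : ι (Q.h a) (V a *ᵥ v) = bqGen R (Sum.inl (Q.h a)) • bqGen R (Sum.inr a) • ι (Q.t a) v := by
      simp [V, ι, LinearMap.toMatrix'_mulVec, he, hρ]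
    rw [this, harr a (ι (Q.t a) v), ← mul_smul, vertex_mul_self]
  have hpath : ∀ {x y : Q.V} (p : Quiver.Path x y) (v), ι y (evalPath V p *ᵥ v) =
      bqMk R (pathEl p) • ι x v := by
    intro x y p
    induction p with
    | nil =>
      intro v
      rw [evalPath, pathEl, Matrix.one_mulVec]
      exact (hιe x v).symm
    | cons p a ih =>
      obtain ⟨a, rfl, rfl⟩ := a
      intro v
      rw [evalPath, castM_rfl, ← Matrix.mulVec_mulVec, hV, ih, pathEl, map_mul, mul_smul]
      rfl
  have hmod : V ∈ modSet R β := by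
    intro r hr
    refine Matrix.mulVec_injective (funext fun v => hιinj _ ?_)
    have h0 := bq_eq (R := R) (.rel hr)
    rw [Finsupp.sum, map_sum, map_zero] at h0
    simp only [map_smul] at h0
    rw [evalLin, Finsupp.sum, Matrix.sum_mulVec, map_sum, Matrix.zero_mulVec, map_zero,
      ← zero_smul (BqAlg R) (ι r.1 v), ← h0, Finset.sum_smul]
    refine Finset.sum_congr rfl fun p _ => ?_
    rw [Matrix.smul_mulVec, map_smul, hpath, smul_assoc]
  let u : TotM (⟨V, hmod⟩ : modSet R β) →ₗ[ℂ] M := ∑ x, ι x ∘ₗ TotM.coord _ x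
  have hu : ∀ v, u v = ∑ x, ι x (TotM.coord _ x v) := fun v => by simp [u]
  have hus : ∀ x v, u (TotM.single _ x v) = ι x v := by
    intro x v
    rw [hu, Finset.sum_eq_single x]
    · rw [TotM.coord_single_same]
    · intro y _ hy
      rw [TotM.coord_single_of_ne _ hy, map_zero]
    · simp
  have hue : ∀ x v, bqGen R (Sum.inl x) • u v = ι x (TotM.coord _ x v) := by
    intro x v
    rw [hu, Finset.smul_sum, Finset.sum_eq_single x]
    · rw [hιe]
    · intro y _ hy
      rw [hιne _ _ _ hy.symm]
    · simp
  refine ⟨β, ⟨V, hmod⟩, ⟨LinearEquiv.ofBijective (homOfGens (adjoin_bqGen R) u ?_) ⟨?_, ?_⟩⟩⟩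
  · rintro (x | a) v
    · rw [vertex_smul, hus, hue]
    · rw [arrow_smul, hus, harr, hue, hV, harr]
      simp only [← mul_smul]
      congr 1
      rw [← mul_assoc (bqGen R (Sum.inl (Q.h a))) (bqGen R (Sum.inl (Q.h a))), vertex_mul_self]
  · intro v w h
    refine TotM.ext fun x => hιinj x ?_
    rw [← hue, ← hue]
    exact congrArg _ h
  · intro m
    choose v hv using fun x => hιrange x m
    refine ⟨∑ x, TotM.single _ x (v x), ?_⟩
    rw [homOfGens_apply, map_sum]
    simp only [hus, hv]
    rw [← Finset.sum_smul, sum_vertex, one_smul]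

lemma hasLifting_of_isProjRep (P : modSet R γ) (hP : IsProjRep R P.1) :
    HasLifting (BqAlg R) (TotM P) := by
  intro M N _ _ _ _ _ _ _ _ _ _ g hg f
  obtain ⟨δ, M', ⟨u⟩⟩ := exists_totM_equiv (R := R) M
  obtain ⟨ε, N', ⟨v⟩⟩ := exists_totM_equiv (R := R) N
  let g' : TotM M' →ₗ[BqAlg R] TotM N' := v.symm.toLinearMap ∘ₗ g ∘ₗ u.toLinearMap
  let f' : TotM P →ₗ[BqAlg R] TotM N' := v.symm.toLinearMap ∘ₗ f
  have hg' : Function.Surjective g' := v.symm.surjective.comp (hg.comp u.surjective)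
  have hs : MorSurj (matOf g') := by
    have := surjective_homEquiv (φ := (homEquiv M' N').symm g')
    rw [LinearEquiv.apply_symm_apply] at this
    exact this.1 hg'
  obtain ⟨h, hh, hgh⟩ := hP δ ε M'.1 N'.1 M'.2 N'.2 (matOf g') (matOf_mem g') hs (matOf f')
    (matOf_mem f')
  refine ⟨u.toLinearMap ∘ₗ homEquiv P M' ⟨h, hh⟩, ?_⟩
  have key : g' ∘ₗ homEquiv P M' ⟨h, hh⟩ = f' := by
    apply (homEquiv P N').symm.injective
    apply Subtype.ext
    funext x
    change matOf _ x = matOf f' x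
    rw [matOf_comp, matOf_homEquiv, hgh]
  refine LinearMap.ext fun z => v.symm.injective ?_
  exact LinearMap.congr_fun key z

end Bridge

section Parameters

set_option linter.unusedSectionVars false

variable {Q : Quiv} {R : Set (FormalRel Q)} {α β γ : Q.V → ℕ}

lemma hom_evalPath {V : QRep Q α} {W : QRep Q β} {φ : ∀ x, Matrix (Fin (β x)) (Fin (α x)) ℂ}
    (h : φ ∈ HomS V W) {x y : Q.V} (p : Quiver.Path x y) :
    φ y * evalPath V p = evalPath W p * φ x := by
  induction p with
  | nil => simp [evalPath]
  | cons p a ih =>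
    obtain ⟨a, rfl, rfl⟩ := a
    rw [evalPath, evalPath, castM_rfl, castM_rfl, ← Matrix.mul_assoc, h a, Matrix.mul_assoc, ih,
      Matrix.mul_assoc]

lemma hom_evalLin {V : QRep Q α} {W : QRep Q β} {φ : ∀ x, Matrix (Fin (β x)) (Fin (α x)) ℂ}
    (h : φ ∈ HomS V W) {x y : Q.V} (c : Quiver.Path x y →₀ ℂ) :
    φ y * evalLin V c = evalLin W c * φ x := by
  rw [evalLin, evalLin, Finsupp.sum, Finsupp.sum, Matrix.mul_sum, Matrix.sum_mul]
  refine Finset.sum_congr rfl fun p _ => ?_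
  rw [Matrix.mul_smul, Matrix.smul_mul, hom_evalPath h]

lemma mem_modSet_of_surj {V : QRep Q α} {W : QRep Q β}
    {φ : ∀ x, Matrix (Fin (β x)) (Fin (α x)) ℂ} (h : φ ∈ HomS V W) (hs : MorSurj φ)
    (hV : V ∈ modSet R α) : W ∈ modSet R β := by
  intro r hr
  refine Matrix.mulVec_injective (funext fun w => ?_)
  obtain ⟨v, rfl⟩ := hs _ w
  rw [Matrix.mulVecLin_apply, Matrix.mulVec_mulVec, ← hom_evalLin h, hV r hr]
  simp

lemma mem_modSet_of_inj {V : QRep Q α} {W : QRep Q β}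
    {φ : ∀ x, Matrix (Fin (β x)) (Fin (α x)) ℂ} (h : φ ∈ HomS V W) (hs : MorInj φ)
    (hW : W ∈ modSet R β) : V ∈ modSet R α := by
  intro r hr
  refine Matrix.mulVec_injective (funext fun v => hs _ ?_)
  rw [Matrix.mulVecLin_apply, Matrix.mulVecLin_apply, Matrix.mulVec_mulVec, hom_evalLin h,
    hW r hr]
  simp

lemma mem_modSet_of_rIso {V : QRep Q α} {W : QRep Q β} (h : RIso V W) (hW : W ∈ modSet R β) :
    V ∈ modSet R α := by
  obtain ⟨u, hu⟩ := h
  have hm : ∀ x v, LinearMap.toMatrix' (u x).toLinearMap *ᵥ v = u x v := fun x v => by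
    rw [LinearMap.toMatrix'_mulVec]; rfl
  refine mem_modSet_of_inj (φ := fun x => LinearMap.toMatrix' (u x).toLinearMap) ?_ ?_ hW
  · intro a
    refine Matrix.mulVec_injective (funext fun v => ?_)
    rw [← Matrix.mulVec_mulVec, ← Matrix.mulVec_mulVec, hm, hm]
    exact LinearMap.congr_fun (hu a) v
  · intro x v w hvw
    rw [Matrix.mulVecLin_apply, Matrix.mulVecLin_apply, hm, hm] at hvw
    exact (u x).injective hvw

/-- The coordinates of a vector of the total space. -/
def TotM.equivFun (W : modSet R β) : TotM W ≃ₗ[ℂ] ((Σ x, Fin (β x)) → ℂ) where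
  toFun v s := TotM.coord W s.1 v s.2
  invFun f := TotM.mk W fun x i => f ⟨x, i⟩
  map_add' v w := by funext s; simp
  map_smul' c v := by funext s; simp
  left_inv v := TotM.ext fun x => rfl
  right_inv f := rfl

/-- The standard basis of the total space. -/
def TotM.basis (W : modSet R β) : Module.Basis (Σ x, Fin (β x)) ℂ (TotM W) :=
  .ofEquivFun (TotM.equivFun W)

lemma TotM.basis_repr (W : modSet R β) (v : TotM W) (s : Σ x, Fin (β x)) :
    (TotM.basis W).repr v s = TotM.coord W s.1 v s.2 := rfl

lemma TotM.coord_basis_mem (W : modSet R β) (L : Subfield ℂ) (s : Σ x, Fin (β x)) (x : Q.V)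
    (i : Fin (β x)) : TotM.coord W x (TotM.basis W s) i ∈ L := by
  rw [← TotM.basis_repr W _ ⟨x, i⟩, Module.Basis.repr_self, Finsupp.single_apply]
  split_ifs
  exacts [L.one_mem, L.zero_mem]

lemma TotM.coord_single_mem (W : modSet R β) {L : Subfield ℂ} {x : Q.V} {v : Fin (β x) → ℂ}
    (hv : ∀ i, v i ∈ L) (y : Q.V) (i : Fin (β y)) :
    TotM.coord W y (TotM.single W x v) i ∈ L := by
  by_cases h : y = x
  · subst h
    rw [TotM.coord_single_same]
    exact hv i
  · rw [TotM.coord_single_of_ne W h]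
    exact L.zero_mem

lemma Subfield.mulVec_mem {L : Subfield ℂ} {m n : Type} [Fintype n] {M : Matrix m n ℂ}
    (hM : ∀ i j, M i j ∈ L) {v : n → ℂ} (hv : ∀ j, v j ∈ L) (i : m) : (M *ᵥ v) i ∈ L :=
  L.sum_mem fun j _ => L.mul_mem (hM i j) (hv j)

lemma isRatBasis_basis (W : modSet R β) {L : Subfield ℂ} (hW : ∀ a i j, W.1 a i j ∈ L) :
    IsRatBasis (bqGen R) L (TotM.basis W) := by
  rintro (x | a) s t
  · rw [TotM.basis_repr, vertex_smul]
    exact TotM.coord_single_mem W (TotM.coord_basis_mem W L t x) _ _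
  · rw [TotM.basis_repr, arrow_smul]
    exact TotM.coord_single_mem W
      (fun i => Subfield.mulVec_mem (hW a) (TotM.coord_basis_mem W L t _) i) _ _

lemma HasParameters.of_equiv {A G : Type} [Ring A] [Algebra ℂ A] {gen : G → A} {k : Subfield ℂ}
    {d : ℕ} {M N : Type} [AddCommGroup M] [Module ℂ M] [Module A M] [IsScalarTower ℂ A M]
    [AddCommGroup N] [Module ℂ N] [Module A N] [IsScalarTower ℂ A N]
    (h : HasParameters gen k d M) (e : M ≃ₗ[A] N) : HasParameters gen k d N := by
  obtain ⟨Λ, hΛ, ι, hι, b, hb⟩ := h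
  refine ⟨Λ, hΛ, ι, hι, b.map (e.restrictScalars ℂ), fun g i j => ?_⟩
  have : b.repr (e.symm (gen g • e (b j))) i = b.repr (gen g • b j) i := by
    rw [map_smul, e.symm_apply_apply]
  rw [Module.Basis.map_apply, Module.Basis.map_repr]
  exact this ▸ hb g i j

lemma Subfield.eval_mem {L : Subfield ℂ} {p : Polynomial ℂ} (hp : ∀ n, p.coeff n ∈ L) {x : ℂ}
    (hx : x ∈ L) : p.eval x ∈ L := by
  rw [Polynomial.eval_eq_sum_range]
  exact L.sum_mem fun n _ => L.mul_mem (hp n) (L.pow_mem hx n)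

lemma exists_parameters_of_isTame [Finite Q.A] (h : IsTame R) :
    ∃ s : Set ℂ, s.Countable ∧ ∀ k : Subfield ℂ, s ⊆ k →
      ∀ (M : Type) [AddCommGroup M] [Module ℂ M] [Module (BqAlg R) M]
        [IsScalarTower ℂ (BqAlg R) M] [FiniteDimensional ℂ M],
        Indec (BqAlg R) M → HasParameters (bqGen R) k 1 M := by
  choose s γs M hM t βs E hE using h
  refine ⟨(⋃ d, ⋃ i, ⋃ a, ⋃ r, ⋃ c, Set.range fun n => (M d i a r c).coeff n) ∪
    (⋃ d, ⋃ i, ⋃ a, ⋃ r, Set.range fun c => E d i a r c), ?_, ?_⟩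
  · refine Set.Countable.union ?_ ?_
    · refine Set.countable_iUnion fun d => Set.countable_iUnion fun i =>
        Set.countable_iUnion fun a => Set.countable_iUnion fun r =>
        Set.countable_iUnion fun c => Set.countable_range _
    · refine Set.countable_iUnion fun d => Set.countable_iUnion fun i =>
        Set.countable_iUnion fun a => Set.countable_iUnion fun r => Set.countable_range _
  · intro k hk N _ _ _ _ _ hN
    obtain ⟨β, V, ⟨e⟩⟩ := exists_totM_equiv (R := R) N
    have hV : IsIndecRep V.1 := by
      refine indec_iff.1 ⟨e.toEquiv.nontrivial_congr.2 hN.1, fun f hf => ?_⟩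
      have h1 := hN.2 (e.toLinearMap ∘ₗ f ∘ₗ e.symm.toLinearMap) (by
        ext x
        simpa using congrArg e (LinearMap.congr_fun hf (e.symm x)))
      rcases h1 with h1 | h1
      · left
        ext x
        simpa using LinearMap.congr_fun h1 (e x)
      · right
        ext x
        simpa using congrArg e.symm (LinearMap.congr_fun h1 (e x))
    rcases hE _ β V.1 V.2 rfl hV with ⟨i, hi⟩ | ⟨i, lam, hi⟩
    · obtain ⟨u⟩ := exists_equiv_of_rIso (V := ⟨_, mem_modSet_of_rIso hi V.2⟩) (W := V) hi
      refine HasParameters.of_equiv ?_ (u.trans e)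
      refine ⟨∅, by simp, _, inferInstance, TotM.basis _, isRatBasis_basis _ fun a r c => ?_⟩
      refine k.le_adj _ (hk (Or.inr ?_))
      simp only [Set.mem_iUnion]
      exact ⟨_, i, a, r, c, rfl⟩
    · obtain ⟨u⟩ := exists_equiv_of_rIso (V := ⟨_, mem_modSet_of_rIso hi V.2⟩) (W := V) hi
      refine HasParameters.of_equiv ?_ (u.trans e)
      refine ⟨{lam}, by simp, _, inferInstance, TotM.basis _, isRatBasis_basis _ fun a r c => ?_⟩
      refine Subfield.eval_mem (fun n => k.le_adj _ (hk (Or.inl ?_)))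
        (k.mem_adj_of_mem (Finset.mem_singleton_self _))
      simp only [Set.mem_iUnion]
      exact ⟨_, i, a, r, c, n, rfl⟩

end Parameters

section Exactness

variable {A : Type} [Ring A] [Algebra ℂ A] {G : Type} {gen : G → A}

/-- A subspace stable under the generators of `A` is a submodule. -/
def submoduleOfGens {X : Type} [AddCommGroup X] [Module ℂ X] [Module A X] [IsScalarTower ℂ A X]
    (hgen : Algebra.adjoin ℂ (Set.range gen) = ⊤) (p : Submodule ℂ X)
    (h : ∀ g, ∀ x ∈ p, gen g • x ∈ p) : Submodule A X where
  __ := p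
  smul_mem' a x hx := by
    have ha : a ∈ Algebra.adjoin ℂ (Set.range gen) := by rw [hgen]; trivial
    change x ∈ p at hx
    change a • x ∈ p
    induction ha using Algebra.adjoin_induction generalizing x with
    | mem a ha => obtain ⟨g, rfl⟩ := ha; exact h g x hx
    | algebraMap r => rw [algebraMap_smul]; exact p.smul_mem r hx
    | add a b _ _ ha hb => rw [add_smul]; exact p.add_mem (ha x hx) (hb x hx)
    | mul a b _ _ ha hb => rw [mul_smul]; exact ha _ (hb x hx)

lemma finrank_hom_of_exact {P K M L : Type} [AddCommGroup P] [Module ℂ P] [Module A P]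
    [IsScalarTower ℂ A P] [FiniteDimensional ℂ P] [AddCommGroup K] [Module ℂ K] [Module A K]
    [IsScalarTower ℂ A K] [AddCommGroup M] [Module ℂ M] [Module A M]
    [IsScalarTower ℂ A M] [FiniteDimensional ℂ M] [AddCommGroup L] [Module ℂ L] [Module A L]
    [IsScalarTower ℂ A L] [FiniteDimensional ℂ L] (hP : HasLifting A P) (i : K →ₗ[A] M)
    (hi : Function.Injective i) (q : M →ₗ[A] L) (hq : Function.Surjective q)
    (h : ∀ x, q x = 0 ↔ ∃ y, i y = x) :
    Module.finrank ℂ (P →ₗ[A] M) = Module.finrank ℂ (P →ₗ[A] K) + Module.finrank ℂ (P →ₗ[A] L) := by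
  let Φ : (P →ₗ[A] M) →ₗ[ℂ] (P →ₗ[A] L) := LinearMap.compRight ℂ q
  let Ψ : (P →ₗ[A] K) →ₗ[ℂ] (P →ₗ[A] M) := LinearMap.compRight ℂ i
  have hΦ : Function.Surjective Φ := fun f => hP M L q hq f
  have hΨ : Function.Injective Ψ := fun f g hfg => by
    ext x
    exact hi (LinearMap.congr_fun hfg x)
  have hker : LinearMap.range Ψ = LinearMap.ker Φ := by
    ext f
    constructor
    · rintro ⟨g, rfl⟩
      refine LinearMap.mem_ker.2 (LinearMap.ext fun x => ?_)
      exact (h _).2 ⟨g x, rfl⟩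
    · intro hf
      have hf' : ∀ x, f x ∈ LinearMap.range i := fun x => (h _).1 (LinearMap.congr_fun hf x)
      refine ⟨(LinearEquiv.ofInjective i hi).symm.toLinearMap ∘ₗ f.codRestrict _ hf', ?_⟩
      ext x
      have := LinearEquiv.apply_symm_apply (LinearEquiv.ofInjective i hi) (f.codRestrict _ hf' x)
      exact congrArg Subtype.val this
  rw [← LinearMap.finrank_range_add_finrank_ker Φ, ← hker, LinearMap.finrank_range_of_inj hΨ,
    LinearMap.range_eq_top.2 hΦ, finrank_top, add_comm]

end Exactness

section Projectives

set_option linter.unusedSectionVars false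

variable {Q : Quiv} {R : Set (FormalRel Q)} {α β γ : Q.V → ℕ}

lemma zero_mem_modSet (hR : AdmissibleRels R) (β : Q.V → ℕ) :
    (fun _ => 0 : QRep Q β) ∈ modSet R β := by
  have key : ∀ (W : QRep Q β), (∀ a, W a = 0) → ∀ {x y : Q.V} (p : Quiver.Path x y),
      2 ≤ p.length → evalPath W p = 0 := by
    intro W hW x y p hp
    cases p with
    | nil => simp at hp
    | cons p a =>
      obtain ⟨a, rfl, rfl⟩ := a
      rw [evalPath, castM_rfl, hW, Matrix.zero_mul]
  intro r hr
  obtain ⟨x, y, c⟩ := r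
  change c.sum _ = 0
  rw [Finsupp.sum]
  refine Finset.sum_eq_zero fun p hp => ?_
  rw [key _ (fun _ => rfl) p (hR _ hr p hp), smul_zero]

lemma exists_source (hQ : QAcyclic Q) {T : Set Q.V} (hT : T.Nonempty) :
    ∃ x ∈ T, ∀ a, Q.t a ∈ T → Q.h a ≠ x := by
  let r : Q.V → Q.V → Prop := fun x y => ∃ p : Quiver.Path x y, 0 < p.length
  have hirr : ∀ x, ¬ r x x := by
    rintro x ⟨p, hp⟩
    rw [hQ x p] at hp
    simp at hp
  have htr : ∀ x y z, r x y → r y z → r x z := by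
    rintro x y z ⟨p, hp⟩ ⟨q, hq⟩
    exact ⟨p.comp q, by rw [Quiver.Path.length_comp]; omega⟩
  have : Std.Irrefl r := ⟨hirr⟩
  have : IsTrans Q.V r := ⟨htr⟩
  have wf := Finite.wellFounded_of_trans_of_irrefl r
  refine ⟨wf.min T hT, wf.min_mem T hT, fun a ha hx => ?_⟩
  refine wf.not_lt_min T ha ?_
  rw [← hx]
  let e : Q.t a ⟶ Q.h a := ⟨a, rfl, rfl⟩
  exact ⟨Quiver.Path.nil.cons e, by simp⟩

/-- The submodule of the total space supported at a set of vertices closed under arrows. -/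
def TotM.supported (W : modSet R β) (T : Set Q.V)
    (hT : ∀ a, Q.t a ∈ T → Q.h a ∉ T → W.1 a = 0) : Submodule (BqAlg R) (TotM W) :=
  submoduleOfGens (adjoin_bqGen R) (⨅ y : {y // y ∉ T}, LinearMap.ker (TotM.coord W y.1)) (by
    rintro g v hv
    simp only [Submodule.mem_iInf, LinearMap.mem_ker, Subtype.forall] at hv ⊢
    intro y hy
    cases g with
    | inl x =>
      rw [vertex_smul]
      by_cases h : y = x
      · subst h
        rw [TotM.coord_single_same, hv y hy]
      · rw [TotM.coord_single_of_ne W h]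
    | inr a =>
      rw [arrow_smul]
      by_cases h : y = Q.h a
      · subst h
        rw [TotM.coord_single_same]
        by_cases ha : Q.t a ∈ T
        · rw [hT a ha hy, Matrix.zero_mulVec]
        · rw [hv _ ha, Matrix.mulVec_zero]
      · rw [TotM.coord_single_of_ne W h])

lemma TotM.mem_supported {W : modSet R β} {T : Set Q.V}
    {hT : ∀ a, Q.t a ∈ T → Q.h a ∉ T → W.1 a = 0} {v : TotM W} :
    v ∈ TotM.supported W T hT ↔ ∀ y, y ∉ T → TotM.coord W y v = 0 := by
  change v ∈ (⨅ y : {y // y ∉ T}, LinearMap.ker (TotM.coord W y.1)) ↔ _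
  simp

lemma finrank_hom_supported (hQ : QAcyclic Q) (hR : AdmissibleRels R) {P : Type}
    [AddCommGroup P] [Module ℂ P] [Module (BqAlg R) P] [IsScalarTower ℂ (BqAlg R) P]
    [FiniteDimensional ℂ P] (hP : HasLifting (BqAlg R) P) (n : ℕ) :
    ∀ (T : Set Q.V) (hT : ∀ a, Q.t a ∈ T → Q.h a ∈ T), T.ncard = n → ∀ W W' : modSet R β,
      Module.finrank ℂ (P →ₗ[BqAlg R] TotM.supported W T fun a h h' => absurd (hT a h) h') =
      Module.finrank ℂ (P →ₗ[BqAlg R] TotM.supported W' T fun a h h' => absurd (hT a h) h') := by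
  classical
  induction n with
  | zero =>
    intro T hT hn W W'
    have key : ∀ W : modSet R β, Module.finrank ℂ
        (P →ₗ[BqAlg R] TotM.supported W T fun a h h' => absurd (hT a h) h') = 0 := by
      intro W
      have : Subsingleton (TotM.supported W T fun a h h' => absurd (hT a h) h') := by
        refine ⟨fun v w => Subtype.ext (TotM.ext fun x => ?_)⟩
        have hx : x ∉ T := by rw [(Set.ncard_eq_zero T.toFinite).1 hn]; simp
        rw [TotM.mem_supported.1 v.2 x hx, TotM.mem_supported.1 w.2 x hx]
      have : Subsingleton (P →ₗ[BqAlg R] TotM.supported W T fun a h h' => absurd (hT a h) h') :=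
        ⟨fun f g => LinearMap.ext fun x => Subsingleton.elim _ _⟩
      exact Module.finrank_zero_of_subsingleton
    rw [key, key]
  | succ n ih =>
    intro T hT hn
    have hne : T.Nonempty := Set.nonempty_of_ncard_ne_zero (by omega)
    obtain ⟨x, hxT, hx⟩ := exists_source hQ hne
    have hT' : ∀ a, Q.t a ∈ T \ {x} → Q.h a ∈ T \ {x} := fun a ha => ⟨hT a ha.1, hx a ha.1⟩
    have hn' : (T \ {x}).ncard = n := by
      rw [Set.ncard_sdiff_singleton_of_mem hxT]; omega
    let O : modSet R β := ⟨_, zero_mem_modSet hR β⟩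
    have key : ∀ W : modSet R β, Module.finrank ℂ
        (P →ₗ[BqAlg R] TotM.supported W T fun a h h' => absurd (hT a h) h') =
        Module.finrank ℂ
          (P →ₗ[BqAlg R] TotM.supported W (T \ {x}) fun a h h' => absurd (hT' a h) h') +
        Module.finrank ℂ (P →ₗ[BqAlg R] TotM.supported O {x} fun a h h' => rfl) := by
      intro W
      let F := TotM.supported W T fun a h h' => absurd (hT a h) h'
      let F' := TotM.supported W (T \ {x}) fun a h h' => absurd (hT' a h) h'
      have hF : ∀ (v : F) y, y ∉ T → TotM.coord W y v.1 = 0 := fun v => TotM.mem_supported.1 v.2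
      have hle : F' ≤ F := fun v hv => TotM.mem_supported.2 fun y hy =>
        TotM.mem_supported.1 hv y fun h => hy h.1
      let q₀ : F →ₗ[ℂ] TotM O :=
        TotM.single O x ∘ₗ TotM.coord W x ∘ₗ (F.subtype.restrictScalars ℂ)
      have hq₀ : ∀ v : F, q₀ v = TotM.single O x (TotM.coord W x v.1) := fun v => rfl
      have hlin : ∀ (g : Q.V ⊕ Q.A) (v : F), q₀ (bqGen R g • v) = bqGen R g • q₀ v := by
        intro g v
        rw [hq₀, hq₀, Submodule.coe_smul]
        cases g with
        | inl y =>
          rw [vertex_smul, vertex_smul]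
          by_cases h : x = y
          · subst h
            rw [TotM.coord_single_same, TotM.coord_single_same]
          · rw [TotM.coord_single_of_ne W h, TotM.coord_single_of_ne O (Ne.symm h), map_zero,
              map_zero]
        | inr a =>
          rw [arrow_smul, arrow_smul, show O.1 a = 0 from rfl, Matrix.zero_mulVec, map_zero]
          by_cases h : x = Q.h a
          · have : Q.t a ∉ T := fun h' => hx a h' h.symm
            rw [hF v _ this, Matrix.mulVec_zero, map_zero, map_zero, map_zero]
          · rw [TotM.coord_single_of_ne W h, map_zero]
      let q₁ : F →ₗ[BqAlg R] TotM O := homOfGens (adjoin_bqGen R) q₀ hlin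
      have hq₁ : ∀ v : F, q₁ v = TotM.single O x (TotM.coord W x v.1) := fun v => rfl
      have hcod : ∀ v, q₁ v ∈ TotM.supported O {x} fun a h h' => rfl := fun v =>
        TotM.mem_supported.2 fun y hy => by rw [hq₁, TotM.coord_single_of_ne O hy]
      refine finrank_hom_of_exact hP (Submodule.inclusion hle) (Submodule.inclusion_injective hle)
        (q₁.codRestrict _ hcod) ?_ ?_
      · intro w
        have hmem : TotM.single W x (TotM.coord O x w.1) ∈ F :=
          TotM.mem_supported.2 fun y hy =>
            TotM.coord_single_of_ne W (fun h => hy (by rw [h]; exact hxT)) _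
        refine ⟨⟨_, hmem⟩, Subtype.ext (TotM.ext fun y => ?_)⟩
        change TotM.coord O y (q₁ _) = _
        rw [hq₁, TotM.coord_single_same]
        by_cases h : y = x
        · subst h
          rw [TotM.coord_single_same]
        · rw [TotM.coord_single_of_ne O h, TotM.mem_supported.1 w.2 y h]
      · intro v
        have h0 : q₁.codRestrict _ hcod v = 0 ↔ TotM.coord W x v.1 = 0 := by
          rw [← Subtype.coe_inj]
          change q₁ v = 0 ↔ _
          rw [hq₁]
          refine ⟨fun h => ?_, fun h => by rw [h, map_zero]⟩
          rw [← TotM.coord_single_same O x (TotM.coord W x v.1), h, map_zero]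
        rw [h0]
        constructor
        · intro h
          refine ⟨⟨v.1, TotM.mem_supported.2 fun y hy => ?_⟩, rfl⟩
          by_cases hyx : y = x
          · rw [hyx, h]
          · exact hF v y fun h' => hy ⟨h', hyx⟩
        · rintro ⟨w, rfl⟩
          exact TotM.mem_supported.1 w.2 x (by simp)
    intro W W'
    rw [key, key, ih _ hT' hn' W W']

lemma finrank_hom_eq (hQ : QAcyclic Q) (hR : AdmissibleRels R) {P : Type}
    [AddCommGroup P] [Module ℂ P] [Module (BqAlg R) P] [IsScalarTower ℂ (BqAlg R) P]
    [FiniteDimensional ℂ P] (hP : HasLifting (BqAlg R) P) (W W' : modSet R β) :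
    Module.finrank ℂ (P →ₗ[BqAlg R] TotM W) = Module.finrank ℂ (P →ₗ[BqAlg R] TotM W') := by
  have key : ∀ W : modSet R β, Module.finrank ℂ (P →ₗ[BqAlg R] TotM W) = Module.finrank ℂ
      (P →ₗ[BqAlg R] TotM.supported W Set.univ fun a h h' => absurd (Set.mem_univ _) h') := by
    intro W
    have h0 := finrank_hom_of_exact (L := PUnit) hP
      (TotM.supported W Set.univ fun a h h' => absurd (Set.mem_univ _) h').subtype
      (Submodule.injective_subtype _) (0 : TotM W →ₗ[BqAlg R] PUnit)
      (fun x => ⟨0, Subsingleton.elim _ _⟩) fun x => by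
        refine ⟨fun _ => ⟨⟨x, TotM.mem_supported.2 fun y hy => absurd (Set.mem_univ _) hy⟩, rfl⟩,
          fun _ => rfl⟩
    have : Subsingleton (P →ₗ[BqAlg R] PUnit.{1}) :=
      ⟨fun f g => LinearMap.ext fun x => Subsingleton.elim _ _⟩
    rw [h0, Module.finrank_zero_of_subsingleton (M := P →ₗ[BqAlg R] PUnit.{1}), add_zero]
  rw [key, key]
  exact finrank_hom_supported hQ hR hP _ _ (fun a _ => Set.mem_univ _) rfl W W'

end Projectives

section Split

variable {m n k : ℕ}

/-- Matrices `f : n → k` and `p : k → m` forming a short exact sequence. -/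
def MatExact (f : Matrix (Fin k) (Fin n) ℂ) (p : Matrix (Fin m) (Fin k) ℂ) : Prop :=
  Function.Injective f.mulVecLin ∧ Function.Surjective p.mulVecLin ∧
    LinearMap.range f.mulVecLin = LinearMap.ker p.mulVecLin

variable {f : Matrix (Fin k) (Fin n) ℂ} {p : Matrix (Fin m) (Fin k) ℂ}

lemma exists_right_inv_of_surj (h : Function.Surjective p.mulVecLin) :
    ∃ s : Matrix (Fin k) (Fin m) ℂ, p * s = 1 :=
  Matrix.mulVec_surjective_iff_exists_right_inverse.1 h

lemma surj_of_right_inv {s : Matrix (Fin k) (Fin m) ℂ} (h : p * s = 1) :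
    Function.Surjective p.mulVecLin :=
  Matrix.mulVec_surjective_iff_exists_right_inverse.2 ⟨s, h⟩

lemma inj_of_left_inv {l : Matrix (Fin n) (Fin k) ℂ} (h : l * f = 1) :
    Function.Injective f.mulVecLin := by
  intro v w hvw
  rw [Matrix.mulVecLin_apply, Matrix.mulVecLin_apply] at hvw
  rw [← Matrix.one_mulVec v, ← Matrix.one_mulVec w, ← h, ← Matrix.mulVec_mulVec, hvw,
    Matrix.mulVec_mulVec]

lemma exists_left_inv_of_inj (h : Function.Injective f.mulVecLin) :
    ∃ l : Matrix (Fin n) (Fin k) ℂ, l * f = 1 := by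
  obtain ⟨g, hg⟩ := f.mulVecLin.exists_leftInverse_of_injective (LinearMap.ker_eq_bot.2 h)
  refine ⟨LinearMap.toMatrix' g, ?_⟩
  have := congrArg LinearMap.toMatrix' hg
  rwa [LinearMap.toMatrix'_comp, LinearMap.toMatrix'_id, ← Matrix.toLin'_apply',
    LinearMap.toMatrix'_toLin'] at this

lemma MatExact.mul_eq_zero (h : MatExact f p) : p * f = 0 := by
  refine Matrix.mulVec_injective (funext fun v => ?_)
  have : f.mulVecLin v ∈ LinearMap.ker p.mulVecLin := by rw [← h.2.2]; exact ⟨v, rfl⟩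
  rw [← Matrix.mulVec_mulVec, Matrix.zero_mulVec]
  exact this

lemma MatExact.exists_split (h : MatExact f p) :
    ∃ (s : Matrix (Fin k) (Fin m) ℂ) (l : Matrix (Fin n) (Fin k) ℂ),
      p * s = 1 ∧ l * f = 1 ∧ l * s = 0 ∧ s * p + f * l = 1 := by
  obtain ⟨s₀, hs⟩ := exists_right_inv_of_surj h.2.1
  obtain ⟨l, hl⟩ := exists_left_inv_of_inj h.1
  have hpf := h.mul_eq_zero
  have hls : l * (s₀ - f * (l * s₀)) = 0 := by
    rw [Matrix.mul_sub, ← Matrix.mul_assoc, hl, Matrix.one_mul, sub_self]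
  have hps : p * (s₀ - f * (l * s₀)) = 1 := by
    rw [Matrix.mul_sub, ← Matrix.mul_assoc, hpf, Matrix.zero_mul, sub_zero, hs]
  generalize s₀ - f * (l * s₀) = s at hls hps
  refine ⟨s, l, hps, hl, hls, ?_⟩
  refine Matrix.mulVec_injective (funext fun v => ?_)
  have hv : v - s *ᵥ p *ᵥ v ∈ LinearMap.ker p.mulVecLin := by
    rw [LinearMap.mem_ker, Matrix.mulVecLin_apply, Matrix.mulVec_sub, Matrix.mulVec_mulVec, hps,
      Matrix.one_mulVec, sub_self]
  rw [← h.2.2] at hv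
  obtain ⟨u, hu⟩ := hv
  rw [Matrix.mulVecLin_apply] at hu
  have hlu : u = l *ᵥ v := by
    have := congrArg (l *ᵥ ·) hu
    simpa [Matrix.mulVec_mulVec, hl, Matrix.mulVec_sub, hls, ← Matrix.mul_assoc] using this
  rw [Matrix.add_mulVec, ← Matrix.mulVec_mulVec, ← Matrix.mulVec_mulVec, ← hlu, hu,
    Matrix.one_mulVec]
  abel

lemma MatExact.of_split {s : Matrix (Fin k) (Fin m) ℂ} {l : Matrix (Fin n) (Fin k) ℂ}
    (hps : p * s = 1) (hlf : l * f = 1) (hpf : p * f = 0) (h : s * p + f * l = 1) :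
    MatExact f p := by
  refine ⟨inj_of_left_inv hlf, surj_of_right_inv hps, le_antisymm ?_ ?_⟩
  · rintro _ ⟨v, rfl⟩
    simp [Matrix.mulVec_mulVec, hpf]
  · intro v hv
    refine ⟨l *ᵥ v, ?_⟩
    rw [LinearMap.mem_ker, Matrix.mulVecLin_apply] at hv
    have : (s * p + f * l) *ᵥ v = v := by rw [h, Matrix.one_mulVec]
    rw [Matrix.add_mulVec, ← Matrix.mulVec_mulVec, hv, Matrix.mulVec_zero, zero_add] at this
    rw [Matrix.mulVecLin_apply, Matrix.mulVec_mulVec, this]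

lemma MatExact.dim (h : MatExact f p) : n + m = k := by
  have h1 := LinearMap.finrank_range_add_finrank_ker p.mulVecLin
  rw [← h.2.2, LinearMap.finrank_range_of_inj h.1, LinearMap.range_eq_top.2 h.2.1, finrank_top] at h1
  simp only [Module.finrank_fin_fun] at h1
  omega

lemma MatExact.of_dim (hdim : n + m = k) (hf : Function.Injective f.mulVecLin)
    (hp : Function.Surjective p.mulVecLin) (hpf : p * f = 0) : MatExact f p := by
  refine ⟨hf, hp, Submodule.eq_of_le_of_finrank_eq ?_ ?_⟩
  · rintro _ ⟨v, rfl⟩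
    simp [Matrix.mulVec_mulVec, hpf]
  · have h1 := LinearMap.finrank_range_add_finrank_ker p.mulVecLin
    rw [LinearMap.range_eq_top.2 hp, finrank_top] at h1
    rw [LinearMap.finrank_range_of_inj hf]
    simp only [Module.finrank_fin_fun] at h1 ⊢
    omega

lemma surj_of_det_ne_zero {s : Matrix (Fin k) (Fin m) ℂ} (h : (p * s).det ≠ 0) :
    Function.Surjective p.mulVecLin := by
  refine surj_of_right_inv (s := s * (p * s)⁻¹) ?_
  rw [← Matrix.mul_assoc, Matrix.mul_nonsing_inv _ (isUnit_iff_ne_zero.2 h)]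

lemma inj_of_det_ne_zero {l : Matrix (Fin n) (Fin k) ℂ} (h : (l * f).det ≠ 0) :
    Function.Injective f.mulVecLin := by
  refine inj_of_left_inv (l := (l * f)⁻¹ * l) ?_
  rw [Matrix.mul_assoc, Matrix.nonsing_inv_mul _ (isUnit_iff_ne_zero.2 h)]

/-- A short exact sequence deforms with its first map. -/
lemma MatExact.deform {s : Matrix (Fin k) (Fin m) ℂ} {l : Matrix (Fin n) (Fin k) ℂ}
    (hps : p * s = 1) (hls : l * s = 0) (h : s * p + f * l = 1)
    {g : Matrix (Fin k) (Fin n) ℂ} (hg : (l * g).det ≠ 0) :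
    MatExact g (p - p * g * (l * g)⁻¹ * l) ∧ (p - p * g * (l * g)⁻¹ * l) * s = 1 ∧
      s * (p - p * g * (l * g)⁻¹ * l) + g * ((l * g)⁻¹ * l) = 1 := by
  have hu : IsUnit (l * g).det := isUnit_iff_ne_zero.2 hg
  have h1 : (l * g)⁻¹ * l * g = 1 := by rw [Matrix.mul_assoc, Matrix.nonsing_inv_mul _ hu]
  have h2 : l * (g * ((l * g)⁻¹ * l)) = l := by
    rw [← Matrix.mul_assoc, ← Matrix.mul_assoc, Matrix.mul_nonsing_inv _ hu, Matrix.one_mul]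
  have h3 : (p - p * g * (l * g)⁻¹ * l) * s = 1 := by
    rw [Matrix.sub_mul, Matrix.mul_assoc _ l, hls, Matrix.mul_zero, hps, sub_zero]
  have h4 : s * (p - p * g * (l * g)⁻¹ * l) + g * ((l * g)⁻¹ * l) = 1 := by
    have e : p - p * g * (l * g)⁻¹ * l = p * (1 - g * ((l * g)⁻¹ * l)) := by
      rw [Matrix.mul_sub, Matrix.mul_one]; simp only [Matrix.mul_assoc]
    rw [e, ← Matrix.mul_assoc, eq_sub_of_add_eq h, Matrix.sub_mul, Matrix.one_mul,
      Matrix.mul_assoc f, Matrix.mul_sub, h2, Matrix.mul_one, sub_self, Matrix.mul_zero]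
    abel
  refine ⟨MatExact.of_split h3 h1 ?_ h4, h3, h4⟩
  rw [Matrix.sub_mul, Matrix.mul_assoc _ l g, Matrix.mul_assoc (p * g),
    Matrix.nonsing_inv_mul _ hu, Matrix.mul_one, sub_self]

end Split

section Presentation

set_option linter.unusedSectionVars false

variable {Q : Quiv} {R : Set (FormalRel Q)} {α β γ δ : Q.V → ℕ}

lemma ker_d0map (V : QRep Q α) (W : QRep Q β) : LinearMap.ker (d0map V W) = HomS V W := by
  ext φ
  rw [LinearMap.mem_ker]
  constructor
  · intro h a
    exact sub_eq_zero.1 (congrFun h a)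
  · intro h
    exact funext fun a => sub_eq_zero.2 (h a)

lemma finrank_homS_eq (hQ : QAcyclic Q) (hR : AdmissibleRels R) {P : QRep Q γ}
    (hPm : P ∈ modSet R γ) (hP : IsProjRep R P) {W W' : QRep Q β} (hW : W ∈ modSet R β)
    (hW' : W' ∈ modSet R β) :
    Module.finrank ℂ (HomS P W) = Module.finrank ℂ (HomS P W') := by
  rw [(homEquiv ⟨P, hPm⟩ ⟨W, hW⟩).finrank_eq, (homEquiv ⟨P, hPm⟩ ⟨W', hW'⟩).finrank_eq]
  exact finrank_hom_eq hQ hR (hasLifting_of_isProjRep ⟨P, hPm⟩ hP) _ _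

/-- Componentwise multiplication of families of matrices. -/
def mulFam {I : Type} (a b c : I → ℕ) :
    (∀ x, Matrix (Fin (c x)) (Fin (b x)) ℂ) →ₗ[ℂ] (∀ x, Matrix (Fin (b x)) (Fin (a x)) ℂ) →ₗ[ℂ]
      (∀ x, Matrix (Fin (c x)) (Fin (a x)) ℂ) :=
  LinearMap.mk₂ ℂ (fun f g x => f x * g x)
    (fun f f' g => by funext x; exact Matrix.add_mul (f x) (f' x) (g x))
    (fun c f g => by funext x; exact Matrix.smul_mul c (f x) (g x))
    (fun f g g' => by funext x; exact Matrix.mul_add (f x) (g x) (g' x))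
    (fun c f g => by funext x; exact Matrix.mul_smul (f x) c (g x))

/-- Reindexing of families of matrices from vertices to tails of arrows. -/
def tailFam (β γ : Q.V → ℕ) : (∀ x, Matrix (Fin (β x)) (Fin (γ x)) ℂ) →ₗ[ℂ]
    (∀ a : Q.A, Matrix (Fin (β (Q.t a))) (Fin (γ (Q.t a))) ℂ) where
  toFun f := fun a => f (Q.t a)
  map_add' _ _ := rfl
  map_smul' _ _ := rfl

lemma polyMap_id [Finite Q.A] :
    PolyMap (E := ∀ a : Q.A, Matrix (Fin (β (Q.h a))) (Fin (β (Q.t a))) ℂ)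
      (polyFun (repCoords (β := β))) fun W => W :=
  PolyMap.pi fun a => PolyMap.matrix fun i j => coord_mem_polyFun repCoords ⟨a, i, j⟩

lemma polyMap_d0map [Finite Q.A] (P : QRep Q γ) :
    PolyMap (polyFun (repCoords (β := β))) fun W : QRep Q β => d0map P W := by
  have h : (fun W : QRep Q β => d0map P W) = fun W : QRep Q β => d0map P (fun _ => 0 : QRep Q β) -
      ((LinearMap.lcomp ℂ _ (tailFam β γ)) ∘ₗ
        (mulFam (fun a => γ (Q.t a)) (fun a => β (Q.t a)) (fun a => β (Q.h a))))
        (W : ∀ a : Q.A, Matrix (Fin (β (Q.h a))) (Fin (β (Q.t a))) ℂ) := by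
    funext W
    refine LinearMap.ext fun f => funext fun a => ?_
    change f (Q.h a) * P a - W a * f (Q.t a) = (f (Q.h a) * P a -
      (0 : Matrix (Fin (β (Q.h a))) (Fin (β (Q.t a))) ℂ) * f (Q.t a)) - W a * f (Q.t a)
    rw [Matrix.zero_mul, sub_zero]
  rw [h]
  exact (PolyMap.const _).sub (PolyMap.linear polyMap_id _)

lemma finrank_ker_prod {P₁ : QRep Q δ} {P₀ : QRep Q γ} {W : QRep Q β}
    (hP₁ : IsProjRep R P₁) (hP₀m : P₀ ∈ modSet R γ) (hW : W ∈ modSet R β)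
    {ψ : ∀ x, Matrix (Fin (β x)) (Fin (γ x)) ℂ} (hψ : ψ ∈ HomS P₀ W) (hs : MorSurj ψ) :
    Module.finrank ℂ (LinearMap.ker ((d0map P₁ P₀).prod (mulFam δ γ β ψ))) +
      Module.finrank ℂ (HomS P₁ W) = Module.finrank ℂ (HomS P₁ P₀) := by
  have hmem : ∀ f ∈ HomS P₁ P₀, mulFam δ γ β ψ f ∈ HomS P₁ W := by
    intro f hf a
    change ψ (Q.h a) * f (Q.h a) * P₁ a = W a * (ψ (Q.t a) * f (Q.t a))
    rw [Matrix.mul_assoc, hf a, ← Matrix.mul_assoc, hψ a, Matrix.mul_assoc]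
  let B := (mulFam δ γ β ψ).restrict hmem
  have hB : LinearMap.range B = ⊤ := by
    rw [LinearMap.range_eq_top]
    rintro ⟨f, hf⟩
    obtain ⟨g, hg, hgf⟩ := hP₁ _ _ _ _ hP₀m hW ψ hψ hs f hf
    exact ⟨⟨g, hg⟩, Subtype.ext (funext hgf)⟩
  have h1 := LinearMap.finrank_range_add_finrank_ker B
  have h2 : (LinearMap.ker B).map (HomS P₁ P₀).subtype =
      LinearMap.ker ((d0map P₁ P₀).prod (mulFam δ γ β ψ)) := by
    rw [LinearMap.ker_prod, ker_d0map]
    ext f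
    constructor
    · rintro ⟨⟨f, hf⟩, h, rfl⟩
      exact ⟨hf, congrArg Subtype.val h⟩
    · rintro ⟨hf, h⟩
      exact ⟨⟨f, hf⟩, Subtype.ext h, rfl⟩
  rw [← h2, ((LinearMap.ker B).equivMapOfInjective _ (HomS P₁ P₀).injective_subtype).finrank_eq.symm,
    ← h1, hB, finrank_top, add_comm]

/-- Modules near a module with a given projective presentation have presentations by the same
projectives. -/
lemma exists_presentation_near [Finite Q.A] (hQ : QAcyclic Q) (hR : AdmissibleRels R)
    {P₁ : QRep Q δ} {P₀ : QRep Q γ} {V : QRep Q α} (hP₁m : P₁ ∈ modSet R δ)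
    (hP₀m : P₀ ∈ modSet R γ) (hV : V ∈ modSet R α) (hP₁ : IsProjRep R P₁) (hP₀ : IsProjRep R P₀)
    {i : ∀ x, Matrix (Fin (γ x)) (Fin (δ x)) ℂ} (hi : i ∈ HomS P₁ P₀)
    {p : ∀ x, Matrix (Fin (α x)) (Fin (γ x)) ℂ} (hp : p ∈ HomS P₀ V)
    (hex : ∀ x, MatExact (i x) (p x)) :
    ∃ G ∈ polyFun (repCoords (β := α)), G V ≠ 0 ∧ ∀ W ∈ modSet R α, G W ≠ 0 →
      ∃ f ∈ HomS P₁ P₀, ∃ ψ ∈ HomS P₀ W, ∀ x, MatExact (f x) (ψ x) := by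
  obtain ⟨d₁, hd₁, ψ, hψ, hd₁V, hψV, hψW⟩ := PolyMap.exists_ker_extension
    (polyMap_d0map (β := α) P₀) V p (by rw [← LinearMap.mem_ker, ker_d0map]; exact hp)
  have hR₂ : PolyMap (polyFun (repCoords (β := α)))
      fun W => (d0map P₁ P₀).prod (mulFam δ γ α (ψ W)) := by
    have h : (fun W => (d0map P₁ P₀).prod (mulFam δ γ α (ψ W))) = fun W =>
        LinearMap.inl ℂ (C1sp (Q := Q) δ γ) (∀ x, Matrix (Fin (α x)) (Fin (δ x)) ℂ) ∘ₗ d0map P₁ P₀ +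
          (LinearMap.compRight ℂ (LinearMap.inr ℂ (C1sp (Q := Q) δ γ) _) ∘ₗ mulFam δ γ α) (ψ W) := by
      funext W
      exact LinearMap.ext fun f => by simp
    rw [h]
    exact (PolyMap.const _).add (hψ.linear _)
  obtain ⟨d₂, hd₂, f, hf, hd₂V, hfV, hfW⟩ := PolyMap.exists_ker_extension hR₂ V i (by
    rw [← LinearMap.mem_ker, LinearMap.ker_prod, ker_d0map]
    refine ⟨hi, funext fun x => ?_⟩
    change ψ V x * i x = 0
    rw [hψV, (hex x).mul_eq_zero])
  choose s l hps hlf _ _ using fun x => (hex x).exists_split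
  have hψx : ∀ x, PolyMap (polyFun (repCoords (β := α))) fun W => ψ W x * s x := fun x =>
    (hψ.linear (LinearMap.proj x)).mul (PolyMap.const (s x))
  have hfx : ∀ x, PolyMap (polyFun (repCoords (β := α))) fun W => l x * f W x := fun x =>
    (PolyMap.const (l x)).mul (hf.linear (LinearMap.proj x))
  refine ⟨d₁ * (∏ x, fun W => (ψ W x * s x).det) * (d₂ * ∏ x, fun W => (l x * f W x).det),
    mul_mem (mul_mem hd₁ (prod_mem fun x _ => (hψx x).det))
      (mul_mem hd₂ (prod_mem fun x _ => (hfx x).det)), ?_, ?_⟩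
  · simp only [Pi.mul_apply, Finset.prod_apply, hψV, hfV, hps, hlf, Matrix.det_one,
      Finset.prod_const_one, mul_one]
    exact mul_ne_zero hd₁V hd₂V
  · intro W hW hG
    simp only [Pi.mul_apply, Finset.prod_apply, mul_ne_zero_iff, Finset.prod_ne_zero_iff,
      Finset.mem_univ, true_imp_iff] at hG
    obtain ⟨⟨h1, h2⟩, h3, h4⟩ := hG
    have hψH : ψ W ∈ HomS P₀ W := by
      rw [← ker_d0map]
      refine hψW W h1 ?_
      rw [ker_d0map, ker_d0map]
      exact (finrank_homS_eq hQ hR hP₀m hP₀ hV hW).le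
    have hψs : MorSurj (ψ W) := fun x => surj_of_det_ne_zero (h2 x)
    have hfk : f W ∈ LinearMap.ker ((d0map P₁ P₀).prod (mulFam δ γ α (ψ W))) := by
      refine hfW W h3 ?_
      have e1 := finrank_ker_prod hP₁ hP₀m hV (ψ := ψ V) (by rwa [hψV])
        (by rw [hψV]; exact fun x => (hex x).2.1)
      have e2 := finrank_ker_prod hP₁ hP₀m hW hψH hψs
      have e3 := finrank_homS_eq hQ hR hP₁m hP₁ hV hW
      omega
    rw [LinearMap.ker_prod, ker_d0map] at hfk
    exact ⟨f W, hfk.1, ψ W, hψH, fun x => MatExact.of_dim (hex x).dim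
      (inj_of_det_ne_zero (h4 x)) (hψs x) (congrFun hfk.2 x)⟩

end Presentation

section Deformation

set_option linter.unusedSectionVars false

variable {Q : Quiv} {R : Set (FormalRel Q)} {α β γ δ : Q.V → ℕ}

lemma PolyMap.inv {X : Type} {𝒪 : Subalgebra ℂ (X → ℂ)} {n : Type} [Fintype n] [DecidableEq n]
    {v : X → Matrix n n ℂ} (hv : PolyMap 𝒪 v) (h : (fun w => ((v w).det)⁻¹) ∈ 𝒪) :
    PolyMap 𝒪 fun w => (v w)⁻¹ := by
  simp only [Matrix.inv_def, Ring.inverse_eq_inv']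
  exact PolyMap.smul h hv.adjugate

/-- Cokernels can be deformed along with a map having a given cokernel. -/
lemma exists_deformation [Finite Q.A] {N : Type} [Fintype N] {P₁ : QRep Q δ} {P₀ : QRep Q γ}
    {W : QRep Q α} {D : N → ∀ x, Matrix (Fin (γ x)) (Fin (δ x)) ℂ} (hD : ∀ j, D j ∈ HomS P₁ P₀)
    {t' : N → ℂ} {p' : ∀ x, Matrix (Fin (α x)) (Fin (γ x)) ℂ} (hp' : p' ∈ HomS P₀ W)
    (hex : ∀ x, MatExact ((∑ j, t' j • D j) x) (p' x)) {F : QRep Q α → ℂ}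
    (hF : F ∈ polyFun repCoords) (hFW : F W ≠ 0) :
    ∃ Φ : MvPolynomial N ℂ, MvPolynomial.eval t' Φ ≠ 0 ∧ ∀ t, MvPolynomial.eval t Φ ≠ 0 →
      ∃ V : QRep Q α, F V ≠ 0 ∧ ∃ p ∈ HomS P₀ V, ∀ x, MatExact ((∑ j, t j • D j) x) (p x) := by
  let 𝒪 := polyFun (id : (N → ℂ) → N → ℂ)
  let f : (N → ℂ) → ∀ x, Matrix (Fin (γ x)) (Fin (δ x)) ℂ := fun t => ∑ j, t j • D j
  have hf : PolyMap 𝒪 f := PolyMap.sum _ fun j _ =>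
    PolyMap.smul (coord_mem_polyFun id j) (PolyMap.const (D j))
  have hfH : ∀ t, f t ∈ HomS P₁ P₀ := fun t =>
    Submodule.sum_mem _ fun j _ => Submodule.smul_mem _ _ (hD j)
  change ∀ x, MatExact (f t' x) (p' x) at hex
  change ∃ Φ : MvPolynomial N ℂ, MvPolynomial.eval t' Φ ≠ 0 ∧ ∀ t, MvPolynomial.eval t Φ ≠ 0 →
      ∃ V : QRep Q α, F V ≠ 0 ∧ ∃ p ∈ HomS P₀ V, ∀ x, MatExact (f t x) (p x)
  clear_value f
  choose s l hps hlf hls hsp using fun x => (hex x).exists_split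
  have hlfx : ∀ x, PolyMap 𝒪 fun t => l x * f t x := fun x =>
    (PolyMap.const (l x)).mul (hf.linear (LinearMap.proj x))
  have hΔ : (fun t => ∏ x, (l x * f t x).det) ∈ 𝒪 := by
    have : (fun t => ∏ x, (l x * f t x).det) = ∏ x, fun t => (l x * f t x).det := by
      funext t; simp
    rw [this]
    exact prod_mem fun x _ => (hlfx x).det
  have hfx : ∀ x, PolyMap (localizedFun 𝒪 hΔ) fun t => f t x := fun x =>
    (hf.linear (LinearMap.proj x)).mono (le_localizedFun hΔ)
  have hinv : ∀ x, PolyMap (localizedFun 𝒪 hΔ) fun t => (l x * f t x)⁻¹ := by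
    intro x
    refine ((hlfx x).mono (le_localizedFun hΔ)).inv (inv_mem_localizedFun hΔ ?_)
    refine ⟨∏ y ∈ Finset.univ.erase x, fun t => (l y * f t y).det,
      prod_mem fun y _ => (hlfx y).det, fun t => ?_⟩
    rw [Finset.prod_apply]
    exact Finset.mul_prod_erase Finset.univ (fun y => (l y * f t y).det) (Finset.mem_univ x)
  let p : (N → ℂ) → ∀ x, Matrix (Fin (α x)) (Fin (γ x)) ℂ := fun t x =>
    p' x - p' x * f t x * (l x * f t x)⁻¹ * l x
  have hpp : ∀ x, PolyMap (localizedFun 𝒪 hΔ) fun t => p t x := fun x =>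
    (PolyMap.const (p' x)).sub ((((PolyMap.const (p' x)).mul (hfx x)).mul (hinv x)).mul
      (PolyMap.const (l x)))
  let V : (N → ℂ) → QRep Q α := fun t a => p t (Q.h a) * P₀ a * s (Q.t a)
  have hV : F ∘ V ∈ localizedFun 𝒪 hΔ := comp_mem_of_mem_polyFun (fun c =>
    (((hpp (Q.h c.1)).mul (PolyMap.const (P₀ c.1))).mul (PolyMap.const (s (Q.t c.1)))).entry
      c.2.1 c.2.2) hF
  obtain ⟨k, n, hn, hnV⟩ := hV
  obtain ⟨Φ, hΦ⟩ := mem_polyFun.1 (mul_mem hn hΔ)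
  have hpt' : p t' = p' := by
    funext x
    simp only [p]
    rw [(hex x).mul_eq_zero, Matrix.zero_mul, Matrix.zero_mul, sub_zero]
  have hVt' : V t' = W := by
    funext a
    change p t' (Q.h a) * P₀ a * s (Q.t a) = W a
    rw [hpt', hp' a, Matrix.mul_assoc, hps, Matrix.mul_one]
  refine ⟨Φ, ?_, fun t ht => ?_⟩
  · have hΔ' : (fun t => ∏ x, (l x * f t x).det) t' ≠ 0 := by
      simp only [hlf, Matrix.det_one, Finset.prod_const_one]
      exact one_ne_zero
    have h1 := hΦ t'
    rw [Pi.mul_apply, ← hnV t' hΔ', Function.comp_apply, hVt'] at h1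
    change MvPolynomial.eval t' Φ ≠ 0
    rw [id] at h1
    rw [← h1]
    exact mul_ne_zero (mul_ne_zero hFW (pow_ne_zero _ hΔ')) hΔ'
  · have h1 := hΦ t
    rw [id] at h1
    rw [← h1, Pi.mul_apply, mul_ne_zero_iff] at ht
    obtain ⟨h2, h3⟩ := ht
    rw [← hnV t h3, mul_ne_zero_iff] at h2
    have hdet : ∀ x, (l x * f t x).det ≠ 0 := fun x =>
      Finset.prod_ne_zero_iff.1 h3 x (Finset.mem_univ x)
    have hdef := fun x => MatExact.deform (hps x) (hls x) (hsp x) (hdet x)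
    change ∀ x, MatExact (f t x) (p t x) ∧ p t x * s x = 1 ∧
      s x * p t x + f t x * ((l x * f t x)⁻¹ * l x) = 1 at hdef
    refine ⟨V t, h2.1, p t, fun a => ?_, fun x => (hdef x).1⟩
    change p t (Q.h a) * P₀ a = p t (Q.h a) * P₀ a * s (Q.t a) * p t (Q.t a)
    have h4 : p t (Q.h a) * P₀ a * f t (Q.t a) = 0 := by
      rw [Matrix.mul_assoc, ← hfH t a, ← Matrix.mul_assoc, (hdef _).1.mul_eq_zero, Matrix.zero_mul]
    conv_lhs => rw [← Matrix.mul_one (p t (Q.h a) * P₀ a), ← (hdef (Q.t a)).2.2]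
    rw [Matrix.mul_add, ← Matrix.mul_assoc _ (f t (Q.t a)), h4, Matrix.zero_mul, add_zero,
      ← Matrix.mul_assoc]

end Deformation

section ZariskiFacts

set_option linter.unusedSectionVars false

variable {Q : Quiv} {α : Q.V → ℕ}

lemma zIsOpen_ne_zero {F : QRep Q α → ℂ} (hF : F ∈ polyFun repCoords) :
    zIsOpen {W | F W ≠ 0} := by
  obtain ⟨p, hp⟩ := mem_polyFun.1 hF
  refine (@isOpen_induced_iff _ _ (zarPi _) _ _).2 ⟨{w | MvPolynomial.eval w p ≠ 0},
    TopologicalSpace.isOpen_generateFrom_of_mem ⟨p, rfl⟩, ?_⟩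
  ext W
  simp [hp]

lemma exists_ne_zero_of_zIsOpen {U : Set (QRep Q α)} (hU : zIsOpen U) {V : QRep Q α}
    (hV : V ∈ U) : ∃ F ∈ polyFun (repCoords (β := α)), F V ≠ 0 ∧ ∀ W, F W ≠ 0 → W ∈ U := by
  obtain ⟨O, hO, rfl⟩ := (@isOpen_induced_iff _ _ (zarPi _) _ _).1 hU
  suffices ∃ p : MvPolynomial (RepCoord (Q := Q) α) ℂ, MvPolynomial.eval (repCoords V) p ≠ 0 ∧
      ∀ w, MvPolynomial.eval w p ≠ 0 → w ∈ O by
    obtain ⟨p, hp, h⟩ := this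
    exact ⟨fun W => MvPolynomial.eval (repCoords W) p, mem_polyFun.2 ⟨p, fun _ => rfl⟩, hp,
      fun W hW => h _ hW⟩
  replace hV : repCoords V ∈ O := hV
  generalize repCoords V = v at hV
  clear hU
  induction hO with
  | basic s hs =>
    obtain ⟨p, rfl⟩ := hs
    exact ⟨p, hV, fun _ h => h⟩
  | univ => exact ⟨1, by simp, fun _ _ => trivial⟩
  | inter s t _ _ hs ht =>
    obtain ⟨p, hp, h⟩ := hs hV.1
    obtain ⟨p', hp', h'⟩ := ht hV.2
    refine ⟨p * p', by rw [map_mul]; exact mul_ne_zero hp hp', fun w hw => ?_⟩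
    rw [map_mul, mul_ne_zero_iff] at hw
    exact ⟨h w hw.1, h' w hw.2⟩
  | sUnion S _ hS =>
    obtain ⟨s, hs, hvs⟩ := hV
    obtain ⟨p, hp, h⟩ := hS s hs hvs
    exact ⟨p, hp, fun w hw => ⟨s, hs, h w hw⟩⟩

lemma zclosure_inter_nonempty {S U : Set (QRep Q α)} (hU : zIsOpen U)
    (h : (zclosure S ∩ U).Nonempty) : (S ∩ U).Nonempty := by
  let _ : TopologicalSpace (QRep Q α) := zarTop α
  obtain ⟨V, hV, hVU⟩ := h
  rw [Set.inter_comm]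
  exact mem_closure_iff.1 hV U hU hVU

/-- Finitely many functions, none of which vanishes on an irreducible set, have a common point of
non-vanishing. -/
lemma exists_forall_ne_zero_of_zIrred {C : Set (QRep Q α)} (hC : zIrred C) {ι : Type}
    (s : Finset ι) {F : ι → QRep Q α → ℂ} (hF : ∀ i ∈ s, F i ∈ polyFun repCoords)
    (hFC : ∀ i ∈ s, ∃ V ∈ C, F i V ≠ 0) : ∃ V ∈ C, ∀ i ∈ s, F i V ≠ 0 := by
  classical
  induction s using Finset.induction_on with
  | empty =>
    obtain ⟨V, hV⟩ := hC.1
    exact ⟨V, hV, by simp⟩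
  | insert i s hi ih =>
    obtain ⟨V, hV, h⟩ := ih (fun j hj => hF j (Finset.mem_insert_of_mem hj))
      (fun j hj => hFC j (Finset.mem_insert_of_mem hj))
    obtain ⟨V', hV', h'⟩ := hFC i (Finset.mem_insert_self i s)
    have hprod : (∏ j ∈ s, F j) ∈ polyFun (repCoords (β := α)) :=
      prod_mem fun j hj => hF j (Finset.mem_insert_of_mem hj)
    obtain ⟨W, hW, h1, h2⟩ := hC.2 _ _ (zIsOpen_ne_zero (hF i (Finset.mem_insert_self i s)))
      (zIsOpen_ne_zero hprod) ⟨V', hV', h'⟩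
      ⟨V, hV, by simpa [Finset.prod_apply, Finset.prod_eq_zero_iff] using h⟩
    refine ⟨W, hW, fun j hj => ?_⟩
    rcases Finset.mem_insert.1 hj with rfl | hj
    · exact h1
    · have h2' : (∏ j ∈ s, F j) W ≠ 0 := h2
      rw [Finset.prod_apply] at h2'
      exact Finset.prod_ne_zero_iff.1 h2' j hj

lemma subset_zclosure (S : Set (QRep Q α)) : S ⊆ zclosure S := by
  let _ : TopologicalSpace (QRep Q α) := zarTop α
  exact subset_closure

end ZariskiFacts

section GenericModule

set_option linter.unusedSectionVars false

variable {A : Type} [Ring A] [Algebra ℂ A]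
variable {X Y Z : Type} [AddCommGroup X] [Module ℂ X] [Module A X] [IsScalarTower ℂ A X]
  [FiniteDimensional ℂ X] [AddCommGroup Y] [Module ℂ Y] [Module A Y] [IsScalarTower ℂ A Y]
  [FiniteDimensional ℂ Y] [AddCommGroup Z] [Module ℂ Z] [Module A Z] [IsScalarTower ℂ A Z]
  [FiniteDimensional ℂ Z]

/-- Composition of homomorphisms as a bilinear map. -/
def compHom (A X Y Z : Type) [Ring A] [Algebra ℂ A] [AddCommGroup X] [Module ℂ X] [Module A X]
    [IsScalarTower ℂ A X] [AddCommGroup Y] [Module ℂ Y] [Module A Y] [IsScalarTower ℂ A Y]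
    [AddCommGroup Z] [Module ℂ Z] [Module A Z] [IsScalarTower ℂ A Z] :
    (X →ₗ[A] Y) →ₗ[ℂ] (Z →ₗ[A] X) →ₗ[ℂ] (Z →ₗ[A] Y) :=
  LinearMap.mk₂ ℂ (fun k f => k ∘ₗ f) (fun _ _ _ => rfl) (fun _ _ _ => rfl)
    (fun k f g => LinearMap.ext fun z => k.map_add (f z) (g z))
    (fun c k f => LinearMap.ext fun z => (k.restrictScalars ℂ).map_smul c (f z))

variable {N : Type} [Fintype N] {D : N → Z →ₗ[A] X}

/-- The endomorphism ring of the cokernel of a generic map between projectives is small. -/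
lemma finrank_end_add_le {G : Type} {gen : G → A}
    (hgen : Algebra.adjoin ℂ (Set.range gen) = ⊤) {k : Subfield ℂ} (hZ : HasLifting A Z)
    {ι ζ : Type} [Fintype ι] [Fintype ζ] (bX : Module.Basis ι ℂ X) (bZ : Module.Basis ζ ℂ Z)
    (hX : IsRatBasis gen k bX) (hD : ∀ j z i, bX.repr (D j (bZ z)) i ∈ k)
    (hspan : ∀ f : Z →ₗ[A] X, ∃ t : N → ℂ, ∑ j, t j • D j = f)
    (hY : HasParameters gen k 1 Y) {t : N → ℂ} (ht : AlgebraicIndependent k t)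
    {p : X →ₗ[A] Y} (hp : Function.Surjective p) (hpt : p ∘ₗ (∑ j, t j • D j) = 0) :
    Module.finrank ℂ (Y →ₗ[A] Y) + Module.finrank ℂ (Z →ₗ[A] Y) ≤
      1 + Module.finrank ℂ (X →ₗ[A] Y) := by
  classical
  obtain ⟨Λ₀, hΛ₀, κ, _, bY, hbY⟩ := hY
  let T : (N → ℂ) →ₗ[ℂ] (Z →ₗ[A] Y) := compHom A X Y Z p ∘ₗ Fintype.linearCombination ℂ D
  have hT : ∀ t, T t = p ∘ₗ (∑ j, t j • D j) := fun _ => rfl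
  have hTs : Function.Surjective T := by
    intro u
    obtain ⟨f, hf⟩ := hZ X Y p hp u
    obtain ⟨s, hs⟩ := hspan f
    exact ⟨s, by rw [hT, hs, hf]⟩
  have hdim := LinearMap.finrank_range_add_finrank_ker T
  rw [LinearMap.range_eq_top.2 hTs, finrank_top, Module.finrank_fintype_fun_eq_card] at hdim
  obtain ⟨Λ, hΛ, hmem⟩ := exists_generators_of_killed hgen (L := k.adj Λ₀) bX bY
    (hX.mono (k.le_adj _)) hbY bZ (fun j => (D j).restrictScalars ℂ)
    (fun j z i => k.le_adj _ (hD j z i)) p hp (LinearMap.ker T) (t := t) (fun s => by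
      rw [LinearMap.mem_ker, hT, LinearMap.ext_iff]
      simp) (by rw [LinearMap.mem_ker, hT, hpt])
  have hcard := card_le_card_of_algebraicIndependent k ht
    fun j => Subfield.adj_adj_le k Λ₀ Λ (hmem j)
  have := Finset.card_union_le Λ₀ Λ
  omega

/-- If the endomorphism ring of the cokernel `Y` of a map between projectives is small, then there
are no extensions of the cokernels of generic maps by `Y`. -/
lemma exists_poly_factor {t₀ : N → ℂ} {p₀ : X →ₗ[A] Y} (hp₀ : Function.Surjective p₀)
    (hex : ∀ x, p₀ x = 0 ↔ ∃ y, (∑ j, t₀ j • D j) y = x)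
    (hend : Module.finrank ℂ (Y →ₗ[A] Y) + Module.finrank ℂ (Z →ₗ[A] Y) ≤
      1 + Module.finrank ℂ (X →ₗ[A] Y)) :
    ∃ Θ : MvPolynomial N ℂ, Θ ≠ 0 ∧ ∀ t, MvPolynomial.eval t Θ ≠ 0 →
      ∀ (M : Type) [AddCommGroup M] [Module ℂ M] [Module A M] [IsScalarTower ℂ A M]
        [FiniteDimensional ℂ M] (p : X →ₗ[A] M), Function.Surjective p →
        (∀ x, p x = 0 ↔ ∃ y, (∑ j, t j • D j) y = x) →
        Module.finrank ℂ M = Module.finrank ℂ Y → (¬ Nonempty (M ≃ₗ[A] Y)) →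
        ∀ u : Z →ₗ[A] Y, ∃ w : X →ₗ[A] Y, w ∘ₗ (∑ j, t j • D j) = u := by
  let 𝒪 := polyFun (id : (N → ℂ) → N → ℂ)
  let f : (N → ℂ) → Z →ₗ[A] X := fun t => ∑ j, t j • D j
  have hf : PolyMap 𝒪 f := PolyMap.sum _ fun j _ =>
    PolyMap.smul (coord_mem_polyFun id j) (PolyMap.const (D j))
  change ∀ x, p₀ x = 0 ↔ ∃ y, f t₀ y = x at hex
  let r : (N → ℂ) → (X →ₗ[A] Y) →ₗ[ℂ] (Z →ₗ[A] Y) := fun t => (compHom A X Y Z).flip (f t)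
  have hr : PolyMap 𝒪 r := hf.linear (compHom A X Y Z).flip
  have hrt : ∀ t k, r t k = k ∘ₗ f t := fun _ _ => rfl
  obtain ⟨d, hd, v, hv, hd₀, hv₀, hvt⟩ := PolyMap.exists_ker_extension hr t₀ p₀
    (LinearMap.ext fun z => (hex _).2 ⟨z, rfl⟩)
  obtain ⟨s, hs⟩ := (p₀.restrictScalars ℂ).exists_rightInverse_of_surjective
    (LinearMap.range_eq_top.2 hp₀)
  let b := Module.finBasis ℂ Y
  let m : (N → ℂ) → Matrix _ _ ℂ := fun t =>
    LinearMap.toMatrix b b ((v t).restrictScalars ℂ ∘ₗ s)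
  have hm : PolyMap 𝒪 m := hv.linear ((LinearMap.toMatrix b b).toLinearMap ∘ₗ
    LinearMap.lcomp ℂ Y s ∘ₗ LinearMap.restrictScalarsₗ ℂ A X Y ℂ)
  obtain ⟨Θ, hΘ⟩ := mem_polyFun.1 (mul_mem hd hm.det)
  have hker₀ : Module.finrank ℂ (LinearMap.ker (r t₀)) ≤ Module.finrank ℂ (Y →ₗ[A] Y) := by
    have hle : LinearMap.ker (r t₀) ≤ LinearMap.range ((compHom A Y Y X).flip p₀) := by
      intro k hk
      rw [LinearMap.mem_ker, hrt] at hk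
      obtain ⟨u, hu⟩ := exists_factor p₀ hp₀ k fun x hx => by
        obtain ⟨y, rfl⟩ := (hex x).1 hx
        exact LinearMap.congr_fun hk y
      exact ⟨u, hu⟩
    exact (Submodule.finrank_mono hle).trans (LinearMap.finrank_range_le _)
  refine ⟨Θ, ?_, ?_⟩
  · rintro rfl
    have h := hΘ t₀
    simp only [map_zero, Pi.mul_apply, m, hv₀, hs, LinearMap.toMatrix_id, Matrix.det_one,
      mul_one] at h
    exact hd₀ h
  · intro t ht M _ _ _ _ _ p hp hpf hdim hiso
    change ∀ x, p x = 0 ↔ ∃ y, f t y = x at hpf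
    change ∀ u : Z →ₗ[A] Y, ∃ w : X →ₗ[A] Y, w ∘ₗ f t = u
    have h := hΘ t
    rw [id] at h
    rw [← h, Pi.mul_apply, mul_ne_zero_iff] at ht
    suffices hsurj : Function.Surjective (r t) from hsurj
    by_contra hns
    rw [← LinearMap.range_eq_top] at hns
    have h1 := LinearMap.finrank_range_add_finrank_ker (r t)
    have h2 := Submodule.finrank_lt hns
    have h3 := hvt t ht.1 (by omega)
    obtain ⟨u, hu⟩ := exists_factor p hp (v t) fun x hx => by
      obtain ⟨y, rfl⟩ := (hpf x).1 hx
      exact LinearMap.congr_fun h3 y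
    have hvs : Function.Surjective (v t) := by
      intro y
      have hunit := (isUnit_iff_ne_zero.2 ht.2 : IsUnit (m t).det)
      refine ⟨s (Matrix.toLin b b (m t)⁻¹ y), ?_⟩
      have e : ((v t).restrictScalars ℂ ∘ₗ s) ∘ₗ Matrix.toLin b b (m t)⁻¹ = LinearMap.id := by
        rw [← Matrix.toLin_toMatrix b b ((v t).restrictScalars ℂ ∘ₗ s), ← Matrix.toLin_mul,
          Matrix.mul_nonsing_inv _ hunit, Matrix.toLin_one]
      exact LinearMap.congr_fun e y
    have hus : Function.Surjective (u.restrictScalars ℂ) := by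
      intro y
      obtain ⟨x, rfl⟩ := hvs y
      exact ⟨p x, LinearMap.congr_fun hu x⟩
    have hui := (LinearMap.injective_iff_surjective_of_finrank_eq_finrank hdim).2 hus
    exact hiso ⟨LinearEquiv.ofBijective u ⟨hui, hus⟩⟩

/-- A dimension count for the existence of homomorphisms from a cokernel. -/
lemma exists_hom_ne_zero {M : Type} [AddCommGroup M] [Module ℂ M] [Module A M]
    [IsScalarTower ℂ A M] [FiniteDimensional ℂ M] {f : Z →ₗ[A] X} {p : X →ₗ[A] Y}
    (hp : Function.Surjective p) (hex : ∀ x, p x = 0 ↔ ∃ y, f y = x)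
    (h : Module.finrank ℂ (Z →ₗ[A] M) < Module.finrank ℂ (X →ₗ[A] M)) :
    ∃ v : Y →ₗ[A] M, v ≠ 0 := by
  obtain ⟨k, hk, hk0⟩ := Submodule.exists_mem_ne_zero_of_ne_bot
    (LinearMap.ker_ne_bot_of_finrank_lt (f := (compHom A X M Z).flip f) h)
  obtain ⟨u, hu⟩ := exists_factor p hp k fun x hx => by
    obtain ⟨y, rfl⟩ := (hex x).1 hx
    exact LinearMap.congr_fun hk y
  exact ⟨u, fun h0 => hk0 (by rw [← hu, h0, LinearMap.zero_comp])⟩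

end GenericModule

section SchurRepresentations

set_option linter.unusedSectionVars false

variable {Q : Quiv} {R : Set (FormalRel Q)} {α β γ δ : Q.V → ℕ}

lemma homEquiv_exact {P₁ : modSet R δ} {P₀ : modSet R γ} {V : modSet R α} {f : HomS P₁.1 P₀.1}
    {p : HomS P₀.1 V.1} (h : ∀ x, MatExact (f.1 x) (p.1 x)) :
    Function.Surjective (homEquiv P₀ V p) ∧
      ∀ v, homEquiv P₀ V p v = 0 ↔ ∃ y, homEquiv P₁ P₀ f y = v := by
  refine ⟨surjective_homEquiv.2 fun x => (h x).2.1, fun v => ⟨fun hv => ?_, ?_⟩⟩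
  · have hx : ∀ x, ∃ y, (f.1 x).mulVecLin y = TotM.coord P₀ x v := by
      intro x
      have : TotM.coord P₀ x v ∈ LinearMap.ker (p.1 x).mulVecLin := by
        rw [LinearMap.mem_ker, Matrix.mulVecLin_apply, ← coord_homEquiv, hv, map_zero]
      rwa [← (h x).2.2] at this
    choose y hy using hx
    exact ⟨TotM.mk P₁ y, TotM.ext fun x => by rw [coord_homEquiv]; exact hy x⟩
  · rintro ⟨y, rfl⟩
    refine TotM.ext fun x => ?_
    rw [coord_homEquiv, coord_homEquiv, map_zero]
    have : (f.1 x).mulVecLin (TotM.coord P₁ x y) ∈ LinearMap.ker (p.1 x).mulVecLin := by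
      rw [← (h x).2.2]
      exact ⟨_, rfl⟩
    exact this

lemma matOf_id (V : modSet R α) (x : Q.V) :
    matOf (LinearMap.id : TotM V →ₗ[BqAlg R] TotM V) x = 1 :=
  congrFun (matOf_totLin (φ := fun x => 1) _ fun v => TotM.ext fun x => by simp [coord_totLin]) x

lemma mem_orbitOf_of_equiv {V W : modSet R α} (e : TotM V ≃ₗ[BqAlg R] TotM W) :
    W.1 ∈ orbitOf V.1 := by
  have h1 : ∀ x, matOf e.toLinearMap x * matOf e.symm.toLinearMap x = 1 := fun x => by
    rw [← matOf_comp, e.comp_symm, matOf_id]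
  have h2 : ∀ x, matOf e.symm.toLinearMap x * matOf e.toLinearMap x = 1 := fun x => by
    rw [← matOf_comp, e.symm_comp, matOf_id]
  refine ⟨fun x => ⟨matOf e.toLinearMap x, matOf e.symm.toLinearMap x, h1 x, h2 x⟩,
    funext fun a => ?_⟩
  change matOf e.toLinearMap (Q.h a) * V.1 a * matOf e.symm.toLinearMap (Q.t a) = W.1 a
  rw [matOf_mem e.toLinearMap a, Matrix.mul_assoc, h1, Matrix.mul_one]

lemma orbitOf_subset_PAset {E : QRep Q α} (hE : E ∈ PAset R α) : orbitOf E ⊆ PAset R α := by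
  rintro _ ⟨g, rfl⟩
  obtain ⟨hEm, γ₀, γ₁, P₀, P₁, hm₀, hm₁, hP₀, hP₁, i, hi, p, hp, hinj, hsurj, hex⟩ := hE
  have hinv : ∀ x, ((g x)⁻¹).val * (g x).val = 1 := fun x => (g x).inv_mul
  have hinv' : ∀ x, (g x).val * ((g x)⁻¹).val = 1 := fun x => (g x).mul_inv
  have hg : (fun x => (g x).val) ∈ HomS E (gAct g E) := fun a => by
    change (g (Q.h a)).val * E a = (g (Q.h a)).val * E a * ((g (Q.t a))⁻¹).val * (g (Q.t a)).val
    rw [Matrix.mul_assoc _ ((g (Q.t a))⁻¹).val, hinv, Matrix.mul_one]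
  have hgs : ∀ x, Function.Surjective (g x).val.mulVecLin := fun x v =>
    ⟨((g x)⁻¹).val *ᵥ v, by rw [Matrix.mulVecLin_apply, Matrix.mulVec_mulVec, hinv',
      Matrix.one_mulVec]⟩
  have hgi : ∀ x, LinearMap.ker (g x).val.mulVecLin = ⊥ := fun x => by
    refine LinearMap.ker_eq_bot'.2 fun v hv => ?_
    rw [← Matrix.one_mulVec v, ← hinv, ← Matrix.mulVec_mulVec]
    rw [Matrix.mulVecLin_apply] at hv
    rw [hv, Matrix.mulVec_zero]
  refine ⟨mem_modSet_of_surj hg hgs hEm, γ₀, γ₁, P₀, P₁, hm₀, hm₁, hP₀, hP₁, i, hi,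
    fun x => (g x).val * p x, fun a => ?_, hinj, fun x => ?_, fun x => ?_⟩
  · rw [Matrix.mul_assoc, hp a, ← Matrix.mul_assoc, hg a, Matrix.mul_assoc]
  · rw [Matrix.mulVecLin_mul]
    exact (hgs x).comp (hsurj x)
  · rw [Matrix.mulVecLin_mul, LinearMap.ker_comp, hgi, Submodule.comap_bot]
    exact hex x

lemma exists_avoiding (hirr : zIrred (Cset R α)) (hnot : ¬ IsOrbitClosure R (Cset R α))
    {U : Set (QRep Q α)} (hU : zIsOpen U) (hCU : (Cset R α ∩ U).Nonempty) {E : QRep Q α}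
    (hE : E ∈ PAset R α) :
    ∃ F ∈ polyFun (repCoords (β := α)), (∃ V ∈ Cset R α, F V ≠ 0) ∧
      ∀ W, F W ≠ 0 → W ∈ U ∧ W ∉ orbitOf E := by
  let _ : TopologicalSpace (QRep Q α) := zarTop α
  have hsub : ¬ Cset R α ⊆ zclosure (orbitOf E) := fun h => hnot ⟨E, hE.1,
    h.antisymm (closure_mono (orbitOf_subset_PAset hE))⟩
  obtain ⟨V, hV, hVE⟩ := Set.not_subset.1 hsub
  have hO : zIsOpen (zclosure (orbitOf E))ᶜ := isClosed_closure.isOpen_compl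
  obtain ⟨W, hWC, hWU, hWE⟩ := hirr.2 U _ hU hO hCU ⟨V, hV, hVE⟩
  obtain ⟨F, hF, hFW, h⟩ := exists_ne_zero_of_zIsOpen (IsOpen.inter hU hO : zIsOpen _) ⟨hWU, hWE⟩
  exact ⟨F, hF, ⟨W, hWC, hFW⟩, fun X hX => ⟨(h X hX).1, fun hXE =>
    (h X hX).2 (subset_zclosure _ hXE)⟩⟩

/-- The cokernels of generic maps between the terms of a projective presentation are generic. -/
lemma exists_generic_cokernel [Finite Q.A] (hQ : QAcyclic Q) (hR : AdmissibleRels R)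
    {P₁ : modSet R δ} {P₀ : modSet R γ} (hP₁ : IsProjRep R P₁.1) (hP₀ : IsProjRep R P₀.1)
    {C : Set (QRep Q α)} (hC : zIrred C) (hCm : C ⊆ modSet R α) {V₀ : QRep Q α} (hV₀ : V₀ ∈ C)
    {i : ∀ x, Matrix (Fin (γ x)) (Fin (δ x)) ℂ} (hi : i ∈ HomS P₁.1 P₀.1)
    {p : ∀ x, Matrix (Fin (α x)) (Fin (γ x)) ℂ} (hp : p ∈ HomS P₀.1 V₀)
    (hex : ∀ x, MatExact (i x) (p x)) {N : Type} [Fintype N] {D : N → HomS P₁.1 P₀.1}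
    (hD : ∀ f, ∃ t : N → ℂ, ∑ j, t j • D j = f) {ι : Type} (s : Finset ι)
    {F : ι → QRep Q α → ℂ} (hF : ∀ i ∈ s, F i ∈ polyFun repCoords)
    (hFC : ∀ i ∈ s, ∃ V ∈ C, F i V ≠ 0) :
    ∃ Φ : MvPolynomial N ℂ, Φ ≠ 0 ∧ ∀ t, MvPolynomial.eval t Φ ≠ 0 →
      ∃ V : modSet R α, V.1 ∈ PAset R α ∧ (∀ i ∈ s, F i V.1 ≠ 0) ∧
        ∃ p : TotM P₀ →ₗ[BqAlg R] TotM V, Function.Surjective p ∧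
          ∀ x, p x = 0 ↔ ∃ y, (∑ j, t j • homEquiv P₁ P₀ (D j)) y = x := by
  obtain ⟨G, hG, hGV, hGW⟩ :=
    exists_presentation_near hQ hR P₁.2 P₀.2 (hCm hV₀) hP₁ hP₀ hi hp hex
  obtain ⟨W, hWC, hW⟩ := exists_forall_ne_zero_of_zIrred hC (Finset.insertNone s)
    (F := fun o => o.elim G F) (Finset.forall_mem_insertNone.2 ⟨hG, hF⟩)
    (Finset.forall_mem_insertNone.2 ⟨⟨V₀, hV₀, hGV⟩, hFC⟩)
  obtain ⟨hGW', hFW⟩ := Finset.forall_mem_insertNone.1 hW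
  obtain ⟨f, hf, ψ, hψ, hfψ⟩ := hGW W (hCm hWC) hGW'
  obtain ⟨t', ht'⟩ := hD ⟨f, hf⟩
  have hcoe : ∀ t : N → ℂ, ((∑ j, t j • D j : HomS P₁.1 P₀.1) :
      ∀ x, Matrix (Fin (γ x)) (Fin (δ x)) ℂ) = ∑ j, t j • (D j).1 := fun t => by simp
  have hfe : ∑ j, t' j • (D j).1 = f := by rw [← hcoe, ht']
  obtain ⟨Φ, hΦ, h⟩ := exists_deformation (F := ∏ i ∈ s, F i) (fun j => (D j).2) hψ
    (by rw [hfe]; exact hfψ) (prod_mem hF)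
    (by rw [Finset.prod_apply]; exact Finset.prod_ne_zero_iff.2 hFW)
  refine ⟨Φ, fun h0 => hΦ (by rw [h0, map_zero]), fun t ht => ?_⟩
  obtain ⟨V, hFV, q, hq, hqe⟩ := h t ht
  have hVm : V ∈ modSet R α := mem_modSet_of_surj hq (fun x => (hqe x).2.1) P₀.2
  rw [Finset.prod_apply] at hFV
  rw [← hcoe] at hqe
  have := homEquiv_exact (P₁ := P₁) (P₀ := P₀) (V := ⟨V, hVm⟩) (f := ∑ j, t j • D j)
    (p := ⟨q, hq⟩) hqe
  simp only [map_sum, map_smul] at this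
  exact ⟨⟨V, hVm⟩, ⟨hVm, γ, δ, P₀.1, P₁.1, P₀.2, P₁.2, hP₀, hP₁, _, (∑ j, t j • D j).2, q, hq,
    fun x => (hqe x).1, fun x => (hqe x).2.1, fun x => (hqe x).2.2⟩,
    Finset.prod_ne_zero_iff.1 hFV, _, this⟩

lemma eval_ne_zero_of_algebraicIndependent {N : Type} {k : Subfield ℂ} {t : N → ℂ}
    (ht : AlgebraicIndependent k t) {Φ : MvPolynomial N ℂ} (hΦ : Φ ≠ 0)
    (hk : ∀ m, Φ.coeff m ∈ k) : MvPolynomial.eval t Φ ≠ 0 := by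
  obtain ⟨Ψ, rfl⟩ : Φ ∈ Set.range (MvPolynomial.map k.subtype) := by
    rw [MvPolynomial.mem_range_map_iff_coeffs_subset]
    intro c hc
    obtain ⟨m, -, rfl⟩ := MvPolynomial.mem_coeffs_iff.1 hc
    exact ⟨⟨_, hk m⟩, rfl⟩
  intro h
  refine hΦ ?_
  rw [MvPolynomial.eval_map] at h
  rw [(algebraicIndependent_iff.1 ht) Ψ h, map_zero]

end SchurRepresentations

section GenericCokernel

set_option linter.unusedSectionVars false

variable {Q : Quiv} {R : Set (FormalRel Q)} {α β γ δ : Q.V → ℕ}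

/-- The cokernel of a generic map between projectives has a small endomorphism ring, if it is
indecomposable. -/
lemma exists_point_finrank_le [Finite Q.A] (hT : IsTame R) {P₁ : modSet R δ} {P₀ : modSet R γ}
    (hP₁ : IsProjRep R P₁.1) {N : Type} [Fintype N] {D : N → HomS P₁.1 P₀.1}
    (hD : ∀ f, ∃ t : N → ℂ, ∑ j, t j • D j = f) {Φ : MvPolynomial N ℂ} (hΦ : Φ ≠ 0) :
    ∃ t : N → ℂ, MvPolynomial.eval t Φ ≠ 0 ∧ ∀ (Y : Type) [AddCommGroup Y] [Module ℂ Y]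
      [Module (BqAlg R) Y] [IsScalarTower ℂ (BqAlg R) Y] [FiniteDimensional ℂ Y],
      Indec (BqAlg R) Y → ∀ p : TotM P₀ →ₗ[BqAlg R] Y, Function.Surjective p →
      p ∘ₗ (∑ j, t j • homEquiv P₁ P₀ (D j)) = 0 →
      Module.finrank ℂ (Y →ₗ[BqAlg R] Y) + Module.finrank ℂ (TotM P₁ →ₗ[BqAlg R] Y) ≤
        1 + Module.finrank ℂ (TotM P₀ →ₗ[BqAlg R] Y) := by
  obtain ⟨s, hs, hsk⟩ := exists_parameters_of_isTame hT
  let s' : Set ℂ := s ∪ Set.range (fun m => Φ.coeff m) ∪ (⋃ a, ⋃ i, Set.range (P₀.1 a i)) ∪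
    ⋃ j, ⋃ x, ⋃ i, Set.range ((D j).1 x i)
  have hs' : s'.Countable :=
    ((hs.union (Set.countable_range _)).union <| Set.countable_iUnion fun a =>
      Set.countable_iUnion fun i => Set.countable_range _).union <|
      Set.countable_iUnion fun j => Set.countable_iUnion fun x => Set.countable_iUnion fun i =>
        Set.countable_range _
  obtain ⟨t, ht⟩ := exists_algebraicIndependent N (countable_closure_subfield hs')
  have hsub : s' ⊆ Subfield.closure s' := Subfield.subset_closure
  have hP₀k : ∀ a i j, P₀.1 a i j ∈ Subfield.closure s' := fun a i j =>
    hsub (Or.inl (Or.inr (Set.mem_iUnion₂.2 ⟨a, i, j, rfl⟩)))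
  have hDk : ∀ j x i l, (D j).1 x i l ∈ Subfield.closure s' := fun j x i l =>
    hsub (Or.inr (Set.mem_iUnion.2 ⟨j, Set.mem_iUnion₂.2 ⟨x, i, l, rfl⟩⟩))
  refine ⟨t, eval_ne_zero_of_algebraicIndependent ht hΦ fun m =>
    hsub (Or.inl (Or.inl (Or.inr ⟨m, rfl⟩))), ?_⟩
  intro Y _ _ _ _ _ hY p hp hpt
  refine finrank_end_add_le (adjoin_bqGen R) (hasLifting_of_isProjRep P₁ hP₁) (TotM.basis P₀)
    (TotM.basis P₁) (isRatBasis_basis P₀ hP₀k) (fun j z i => ?_) (fun f => ?_)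
    (hsk _ (fun x hx => hsub (Or.inl (Or.inl (Or.inl hx)))) Y hY) ht hp hpt
  · rw [TotM.basis_repr, coord_homEquiv]
    exact Subfield.mulVec_mem (hDk _ _) (TotM.coord_basis_mem _ _ _ _) _
  · obtain ⟨t, ht⟩ := hD ((homEquiv P₁ P₀).symm f)
    refine ⟨t, ?_⟩
    rw [← (homEquiv P₁ P₀).apply_symm_apply f, ← ht, map_sum]
    simp only [map_smul]

end GenericCokernel

/-- Let `A = ℂQ/⟨R⟩` be an acyclic tame bound quiver algebra and `α` a
dimension vector with `P_A(α) ≠ ∅`.  If `C(α)` is an indecomposable irreducible component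
of `mod(A,α)` which is not an orbit closure, then `C(α)` contains a Schur module, i.e. a
module `V` with `End_A(V) ≅ ℂ` (equivalently `dim_ℂ End_A(V) = 1`). -/
theorem statement13 (Q : Quiv) [Fintype Q.A] (hacyc : QAcyclic Q)
    (R : Set (FormalRel Q)) (hRfin : R.Finite) (hRadm : AdmissibleRels R)
    (htame : IsTame R)
    (α : Q.V → ℕ) (hne : (PAset R α).Nonempty)
    (hindec : IsIndecComp (Cset R α) (modSet R α))
    (hnotorb : ¬ IsOrbitClosure R (Cset R α)) :
    ∃ V ∈ Cset R α, Module.finrank ℂ (HomS V V) = 1 := by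
  obtain ⟨⟨hirr, -, hCm, -⟩, U, hU, hCU, hUI⟩ := hindec
  have hPC : PAset R α ⊆ Cset R α := subset_zclosure _
  have hCU' : (Cset R α ∩ U).Nonempty := by
    obtain ⟨W, hW⟩ := hne
    obtain ⟨X, hX, -⟩ := zclosure_inter_nonempty (U := Set.univ) (by
      let _ : TopologicalSpace (QRep Q α) := zarTop α
      exact isOpen_univ) ⟨W, hCU (hPC hW), trivial⟩
    exact ⟨X, hX⟩
  obtain ⟨V₀, ⟨hV₀m, γ, δ, P₀, P₁, hm₀, hm₁, hP₀, hP₁, i, hi, p, hp, hinj, hsurj, hex⟩, hV₀U⟩ :=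
    zclosure_inter_nonempty hU hCU'
  obtain ⟨F₀, hF₀, hF₀V, hF₀U⟩ := exists_ne_zero_of_zIsOpen hU hV₀U
  lift P₀ to modSet R γ using hm₀
  lift P₁ to modSet R δ using hm₁
  have hV₀C : V₀ ∈ Cset R α :=
    hPC ⟨hV₀m, γ, δ, P₀, P₁, P₀.2, P₁.2, hP₀, hP₁, i, hi, p, hp, hinj, hsurj, hex⟩
  let D := Module.finBasis ℂ (HomS P₁.1 P₀.1)
  have hD : ∀ f, ∃ t : Fin _ → ℂ, ∑ j, t j • D j = f := fun f => ⟨_, D.sum_repr f⟩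
  clear_value D
  have key := fun (s : Finset (modSet R α)) (F : modSet R α → QRep Q α → ℂ) =>
    exists_generic_cokernel hacyc hRadm hP₁ hP₀ hirr hCm hV₀C hi hp
      (fun x => ⟨hinj x, hsurj x, hex x⟩) hD s (F := F)
  obtain ⟨Φ, hΦ, h⟩ := key {⟨V₀, hV₀m⟩} (fun _ => F₀) (fun _ _ => hF₀) fun _ _ => ⟨V₀, hV₀C, hF₀V⟩
  obtain ⟨t, ht, hY⟩ := exists_point_finrank_le htame hP₁ hD hΦ
  obtain ⟨Y, hYP, hYF, q, hq, hqe⟩ := h t ht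
  have hYI : Indec (BqAlg R) (TotM Y) :=
    indec_iff.2 (hUI Y.1 ⟨hPC hYP, hF₀U _ (hYF _ (Finset.mem_singleton_self _))⟩)
  have hend := hY (TotM Y) hYI q hq (LinearMap.ext fun z => (hqe _).2 ⟨z, rfl⟩)
  by_cases hle : Module.finrank ℂ (TotM P₀ →ₗ[BqAlg R] TotM Y) ≤
      Module.finrank ℂ (TotM P₁ →ₗ[BqAlg R] TotM Y)
  · refine ⟨Y.1, hPC hYP, ?_⟩
    rw [(homEquiv Y Y).finrank_eq]
    have := hYI.1
    have : 0 < Module.finrank ℂ (TotM Y →ₗ[BqAlg R] TotM Y) :=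
      Module.finrank_pos_iff_exists_ne_zero.2 ⟨LinearMap.id, fun h0 => by
        obtain ⟨y, hy⟩ := exists_ne (0 : TotM Y)
        exact hy (LinearMap.congr_fun h0 y)⟩
    omega
  exfalso
  obtain ⟨Θ, hΘ, hfac⟩ := exists_poly_factor hq hqe hend
  let r : modSet R α → modSet R α → Prop := fun V W => ¬ Nonempty (TotM V ≃ₗ[BqAlg R] TotM W)
  have hr : Std.Symm r := ⟨fun V W h ⟨e⟩ => h ⟨e.symm⟩⟩
  obtain ⟨M, hM, hMr⟩ := exists_seq_of_forall_finset_exists' (fun V : modSet R α =>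
    V.1 ∈ PAset R α ∧ Indec (BqAlg R) (TotM V) ∧ ∃ (f : TotM P₁ →ₗ[BqAlg R] TotM P₀)
      (p : TotM P₀ →ₗ[BqAlg R] TotM V), Function.Surjective p ∧
      (∀ x, p x = 0 ↔ ∃ y, f y = x) ∧
      ∀ u : TotM P₁ →ₗ[BqAlg R] TotM Y, ∃ w : TotM P₀ →ₗ[BqAlg R] TotM Y, w ∘ₗ f = u) r (by
    classical
    intro s hs
    have hs' : ∀ E ∈ insert Y s, E.1 ∈ PAset R α :=
      Finset.forall_mem_insert _ _ _ |>.2 ⟨hYP, fun E hE => (hs E hE).1⟩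
    choose! F hF hFC hFE using fun E (hE : E ∈ insert Y s) =>
      exists_avoiding hirr hnotorb hU hCU' (hs' E hE)
    obtain ⟨Ψ, hΨ, h⟩ := key (insert Y s) F hF hFC
    obtain ⟨t, ht⟩ : ∃ t, MvPolynomial.eval t (Ψ * Θ) ≠ 0 := by
      by_contra! hcon
      exact mul_ne_zero hΨ hΘ (MvPolynomial.funext fun t => by rw [hcon t, map_zero])
    rw [map_mul, mul_ne_zero_iff] at ht
    obtain ⟨V, hVP, hVF, p, hp, hpe⟩ := h t ht.1
    have hVE : ∀ E ∈ insert Y s, ¬ Nonempty (TotM E ≃ₗ[BqAlg R] TotM V) := fun E hE ⟨e⟩ =>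
      (hFE E hE V.1 (hVF E hE)).2 (mem_orbitOf_of_equiv e)
    have hYs := Finset.mem_insert_self Y s
    refine ⟨V, ⟨hVP, indec_iff.2 (hUI V.1 ⟨hPC hVP, (hFE Y hYs V.1 (hVF Y hYs)).1⟩), _, p, hp,
      hpe, ?_⟩, fun E hE => hVE E (Finset.mem_insert_of_mem hE)⟩
    exact hfac t ht.2 (TotM V) p hp hpe (by rw [finrank_totM, finrank_totM])
      fun ⟨e⟩ => hVE Y hYs ⟨e.symm⟩)
  choose hMP hMI f p hp hfp hMfac using hM
  obtain ⟨s, hs, hsk⟩ := exists_parameters_of_isTame htame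
  have hL₀ := hasLifting_of_isProjRep P₀ hP₀
  have hL₁ := hasLifting_of_isProjRep P₁ hP₁
  refine false_of_family (adjoin_bqGen R) (countable_closure_subfield hs)
    (fun M _ _ _ _ _ => hasParameters_of_indec (hsk _ Subfield.subset_closure) _ M rfl)
    (b := ∑ x, α x) (ι := Fin ((4 * (∑ x, α x) ^ 2 + 1) * (2 ^ (∑ x, α x) - 1) + 1))
    (by rw [Fintype.card_fin]; exact Nat.lt_succ_self _) (M := fun i => TotM (M i))
    (fun i => hMI i) (fun i => (finrank_totM _).le)
    (fun i j hij g hg => hMr (fun h => hij (Fin.ext h)) ⟨LinearEquiv.ofBijective g hg⟩)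
    (finrank_totM Y).le (fun i => exists_hom_ne_zero hq hqe ?_) hL₀ hL₁ (fun i => f i)
    (fun i => p i) (fun i => hp i) (fun i => hfp i) (fun i => hMfac i)
  rw [finrank_hom_eq hacyc hRadm hL₀ (M i) Y, finrank_hom_eq hacyc hRadm hL₁ (M i) Y]
  exact not_le.1 hle
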